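/- For every i with 1 <= i <= N, every k in Z, and every P in N_q^-, there exist unique finitely supported families (Q_p)_{p>=0} and (R_r)_{r>=0} of elements of N_q^- such that the identity [x^+_{i,k}, P] = (q_i - q_i^{-1})^{-1} ( sum_{p>=0} psi_{i,p} gamma^{p/2} Q_p + sum_{r>=0} phi_{i,-r} gamma^{r/2} R_r ) holds in U_q. -/

import Mathlib

/-!
STATEMENT 7: the commutator lemma for `N_q^-` (existence and uniqueness of the
families `(Q_p)` and `(R_r)`).
-/


noncomputable section
open scoped BigOperators

/-- The base field `ℚ(q^{1/2})`. -/
abbrev Fq : Type := RatFunc ℚ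

/-- `q^{1/2}`. -/
def sqq : Fq := RatFunc.X

/-- `q`. -/
def qq : Fq := sqq ^ 2

/-- Generators of the quantum affine algebra `U_q(ĝ)` in the Drinfeld realization. -/
inductive Gen (N : ℕ) : Type
  | xp (i : Fin N) (r : ℤ)
  | xm (i : Fin N) (r : ℤ)
  | h  (i : Fin N) (s : ℤ)
  | K (i : Fin N)
  | Kinv (i : Fin N)
  | g2
  | g2inv
  | D
  | Dinv

open Gen

/-- The free algebra on the Drinfeld generators. -/
abbrev FA (N : ℕ) : Type := FreeAlgebra Fq (Gen N)

variable {N : ℕ}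

def e (x : Gen N) : FA N := FreeAlgebra.ι Fq x

variable (d : Fin N → ℤ) (A : Fin N → Fin N → ℤ)

/-- `q_i = q^{d_i}`. -/
def qi (i : Fin N) : Fq := qq ^ (d i)

/-- `q^{(α_i|α_j)} = q^{d_i a_{ij}}`. -/
def qp (i j : Fin N) : Fq := qq ^ (d i * A i j)

/-- The quantum integer `[n]_i`. -/
def qint (i : Fin N) (n : ℤ) : Fq := (qi d i ^ n - qi d i ^ (-n)) / (qi d i - (qi d i)⁻¹)

/-- `[n]_i!`. -/
def qfact (i : Fin N) : ℕ → Fq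
  | 0 => 1
  | n + 1 => qint d i (n + 1) * qfact i n

/-- The `q_i`-binomial coefficient `[n choose r]_{q_i}`. -/
def qbinom (i : Fin N) (n r : ℕ) : Fq := qfact d i n / (qfact d i r * qfact d i (n - r))

/-- `γ^{m/2}` as a (noncommutative) word in the free algebra. -/
def gammaHalf (m : ℤ) : FA N := if 0 ≤ m then (e g2) ^ m.toNat else (e g2inv) ^ (-m).toNat

/-- `γ^{k}`. -/
def gammaPow (k : ℤ) : FA N := gammaHalf (2 * k)

/-- The Schur-like polynomials `S_k((q_i - q_i^{-1}) h_{i,1}, (q_i - q_i^{-1}) h_{i,2}, …)`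
appearing in `ψ_{i,k} = K_i S_k`, defined by the recursion
`k S_k = ∑_{l=1}^{k} l x_l S_{k-l}` for `exp(∑ x_l z^l) = ∑ S_k z^k`. -/
def Ppos (i : Fin N) : ℕ → FA N
  | 0 => 1
  | k + 1 =>
      ((k + 1 : Fq))⁻¹ •
        ∑ l ∈ Finset.range (k + 1),
          (((l + 1 : ℕ) : Fq) * (qi d i - (qi d i)⁻¹)) •
            (e (h i ((l : ℤ) + 1)) * Ppos i (k - l))

/-- The analogous polynomials in the `h_{i,-l}`, `l > 0`, with coefficient
`-(q_i - q_i^{-1})`, appearing in `φ_{i,-k} = K_i^{-1} S_k`. -/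
def Pneg (i : Fin N) : ℕ → FA N
  | 0 => 1
  | k + 1 =>
      ((k + 1 : Fq))⁻¹ •
        ∑ l ∈ Finset.range (k + 1),
          (((l + 1 : ℕ) : Fq) * (-(qi d i - (qi d i)⁻¹))) •
            (e (h i (-((l : ℤ) + 1))) * Pneg i (k - l))

/-- The element `ψ_{i,m}` (zero for `m < 0`). -/
def psiEl (i : Fin N) (m : ℤ) : FA N := if 0 ≤ m then e (K i) * Ppos d i m.toNat else 0

/-- The element `φ_{i,m}` (zero for `m > 0`). -/
def phiEl (i : Fin N) (m : ℤ) : FA N := if m ≤ 0 then e (Kinv i) * Pneg d i (-m).toNat else 0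

/-- A summand of the Drinfeld–Serre relation:
`x_{i,k_{σ(1)}} ⋯ x_{i,k_{σ(r)}} x_{j,l} x_{i,k_{σ(r+1)}} ⋯ x_{i,k_{σ(n)}}`
(`pm = true` for the `x^+` relation, `pm = false` for `x^-`). -/
def dsTerm (pm : Bool) (i j : Fin N) (n' : ℕ) (ks : Fin n' → ℤ) (l : ℤ)
    (σ : Equiv.Perm (Fin n')) (r : ℕ) : FA N :=
  (((List.finRange n').take r).map fun t =>
      e (if pm then xp i (ks (σ t)) else xm i (ks (σ t)))).prod *
    e (if pm then xp j l else xm j l) *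
  (((List.finRange n').drop r).map fun t =>
      e (if pm then xp i (ks (σ t)) else xm i (ks (σ t)))).prod

/-- The defining relations of the quantum affine algebra `U_q(ĝ)`
(Drinfeld realization). -/
inductive QRel (N : ℕ) (d : Fin N → ℤ) (A : Fin N → Fin N → ℤ) : FA N → FA N → Prop
  | K_Kinv (i : Fin N) : QRel N d A (e (K i) * e (Kinv i)) 1
  | Kinv_K (i : Fin N) : QRel N d A (e (Kinv i) * e (K i)) 1
  | D_Dinv : QRel N d A (e D * e Dinv) 1
  | Dinv_D : QRel N d A (e Dinv * e D) 1
  | g_ginv : QRel N d A (e g2 * e g2inv) 1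
  | ginv_g : QRel N d A (e g2inv * e g2) 1
  | g2_comm (x : Gen N) : QRel N d A (e g2 * e x) (e x * e g2)
  | g2inv_comm (x : Gen N) : QRel N d A (e g2inv * e x) (e x * e g2inv)
  | K_comm_K (i j : Fin N) : QRel N d A (e (K i) * e (K j)) (e (K j) * e (K i))
  | K_comm_D (i : Fin N) : QRel N d A (e (K i) * e D) (e D * e (K i))
  | K_comm_h (i j : Fin N) (s : ℤ) :
      QRel N d A (e (K i) * e (h j s)) (e (h j s) * e (K i))
  | h_zero (i : Fin N) : QRel N d A (e (h i 0)) 0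
  | D_h (i : Fin N) (s : ℤ) :
      QRel N d A (e D * e (h i s) * e Dinv) ((qq ^ s) • e (h i s))
  | D_xp (i : Fin N) (r : ℤ) :
      QRel N d A (e D * e (xp i r) * e Dinv) ((qq ^ r) • e (xp i r))
  | D_xm (i : Fin N) (r : ℤ) :
      QRel N d A (e D * e (xm i r) * e Dinv) ((qq ^ r) • e (xm i r))
  | K_xp (i j : Fin N) (r : ℤ) :
      QRel N d A (e (K i) * e (xp j r) * e (Kinv i)) (qp d A i j • e (xp j r))
  | K_xm (i j : Fin N) (r : ℤ) :
      QRel N d A (e (K i) * e (xm j r) * e (Kinv i)) ((qp d A i j)⁻¹ • e (xm j r))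
  | h_h (i j : Fin N) (k l : ℤ) (hk : k ≠ 0) (hl : l ≠ 0) :
      QRel N d A (e (h i k) * e (h j l) - e (h j l) * e (h i k))
        (if l = -k then
          ((k : Fq)⁻¹ * qint d i (k * A i j) * (qi d j - (qi d j)⁻¹)⁻¹) •
            (gammaPow k - gammaPow (-k))
         else 0)
  | h_xp (i j : Fin N) (k l : ℤ) (hk : k ≠ 0) :
      QRel N d A (e (h i k) * e (xp j l) - e (xp j l) * e (h i k))
        (((k : Fq)⁻¹ * qint d i (k * A i j)) • (gammaHalf (-|k|) * e (xp j (k + l))))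
  | h_xm (i j : Fin N) (k l : ℤ) (hk : k ≠ 0) :
      QRel N d A (e (h i k) * e (xm j l) - e (xm j l) * e (h i k))
        ((-((k : Fq)⁻¹ * qint d i (k * A i j))) • (gammaHalf |k| * e (xm j (k + l))))
  | serre_p (i j : Fin N) (k l : ℤ) :
      QRel N d A
        (e (xp i (k+1)) * e (xp j l) - qp d A i j • (e (xp j l) * e (xp i (k+1))))
        (qp d A i j • (e (xp i k) * e (xp j (l+1))) - e (xp j (l+1)) * e (xp i k))
  | serre_m (i j : Fin N) (k l : ℤ) :
      QRel N d A
        (e (xm i (k+1)) * e (xm j l) - (qp d A i j)⁻¹ • (e (xm j l) * e (xm i (k+1))))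
        ((qp d A i j)⁻¹ • (e (xm i k) * e (xm j (l+1))) - e (xm j (l+1)) * e (xm i k))
  | xp_xm (i j : Fin N) (k l : ℤ) :
      QRel N d A (e (xp i k) * e (xm j l) - e (xm j l) * e (xp i k))
        (if i = j then
          ((qi d i - (qi d i)⁻¹)⁻¹) •
            (gammaHalf (k - l) * psiEl d i (k + l) - gammaHalf (l - k) * phiEl d i (k + l))
         else 0)
  | dserre (pm : Bool) (i j : Fin N) (hij : i ≠ j)
      (ks : Fin (1 - A i j).toNat → ℤ) (l : ℤ) :
      QRel N d A
        (∑ σ : Equiv.Perm (Fin (1 - A i j).toNat),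
          ∑ r ∈ Finset.range ((1 - A i j).toNat + 1),
            ((-1 : Fq) ^ r * qbinom d i (1 - A i j).toNat r) •
              dsTerm pm i j (1 - A i j).toNat ks l σ r)
        0

/-- The quantum affine algebra `U_q(ĝ)` (Drinfeld realization). -/
abbrev Uq (N : ℕ) (d : Fin N → ℤ) (A : Fin N → Fin N → ℤ) : Type := RingQuot (QRel N d A)

/-- The image of a generator in `U_q(ĝ)`. -/
def G (x : Gen N) : Uq N d A := RingQuot.mkAlgHom Fq (QRel N d A) (e x)

/-- The image of `ψ_{i,m}` in `U_q(ĝ)`. -/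
def psiU (i : Fin N) (m : ℤ) : Uq N d A := RingQuot.mkAlgHom Fq (QRel N d A) (psiEl d i m)

/-- The image of `φ_{i,m}` in `U_q(ĝ)`. -/
def phiU (i : Fin N) (m : ℤ) : Uq N d A := RingQuot.mkAlgHom Fq (QRel N d A) (phiEl d i m)

/-- The image of `γ^{m/2}` in `U_q(ĝ)`. -/
def gU (m : ℤ) : Uq N d A := RingQuot.mkAlgHom Fq (QRel N d A) (gammaHalf m)


/-- The generating set of the subalgebra `N_q^-`. -/
def NqSet : Set (Uq N d A) :=
  {G d A Gen.g2, G d A Gen.g2inv} ∪ Set.range (fun p : Fin N × ℤ => G d A (Gen.xm p.1 p.2))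

/-- The subalgebra `N_q^-` of `U_q(ĝ)` generated by `γ^{±1/2}` and the `x^-_{i,l}`. -/
def Nq : Subalgebra Fq (Uq N d A) := Algebra.adjoin Fq (NqSet d A)

/-- `γ^{1/2}` as an element of `N_q^-`. -/
def g2N : Nq d A :=
  ⟨G d A Gen.g2, Algebra.subset_adjoin (Set.mem_union_left _ (Set.mem_insert _ _))⟩

/-- `γ^{-1/2}` as an element of `N_q^-`. -/
def g2invN : Nq d A :=
  ⟨G d A Gen.g2inv, Algebra.subset_adjoin (Set.mem_union_left _ (Set.mem_insert_of_mem _ rfl))⟩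

/-- `x^-_{i,m}` as an element of `N_q^-`. -/
def xmN (i : Fin N) (m : ℤ) : Nq d A :=
  ⟨G d A (Gen.xm i m), Algebra.subset_adjoin (Set.mem_union_right _ ⟨(i, m), rfl⟩)⟩

/-- `γ^{m/2}` as an element of `N_q^-`. -/
def gN (m : ℤ) : Nq d A :=
  if 0 ≤ m then (g2N d A) ^ m.toNat else (g2invN d A) ^ (-m).toNat

/-- The characterizing property of the family of operators
`Ω_{ψ_i}(m), Ω_{φ_i}(m) : N_q^- → N_q^-`: they vanish for small (resp. large) index, and
`[x^+_{i,k}, P] = (q_i - q_i^{-1})^{-1} (∑_{p ≥ 0} ψ_{i,p} γ^{p/2} Ω_{ψ_i}(k-p)(P)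
   - ∑_{r ≥ 0} φ_{i,-r} γ^{r/2} Ω_{φ_i}(k+r)(P))`,
both sums having only finitely many nonzero terms.  (By the commutator lemma there is a
unique such family.) -/
def IsOmegaFamily (Ωψ Ωφ : Fin N → ℤ → ((Nq d A) →ₗ[Fq] (Nq d A))) : Prop :=
  (∀ (i : Fin N) (P : Nq d A), ∃ b : ℤ, ∀ m : ℤ, m ≤ b → Ωψ i m P = 0) ∧
  (∀ (i : Fin N) (P : Nq d A), ∃ b : ℤ, ∀ m : ℤ, b ≤ m → Ωφ i m P = 0) ∧
  (∀ (i : Fin N) (k : ℤ) (P : Nq d A), ∃ M : ℕ,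
    (∀ p : ℕ, M < p → Ωψ i (k - (p : ℤ)) P = 0 ∧ Ωφ i (k + (p : ℤ)) P = 0) ∧
    G d A (Gen.xp i k) * (P : Uq N d A) - (P : Uq N d A) * G d A (Gen.xp i k) =
      ((qi d i - (qi d i)⁻¹)⁻¹) •
        ((∑ p ∈ Finset.range (M + 1),
            psiU d A i (p : ℤ) * gU d A (p : ℤ) *
              ((Ωψ i (k - (p : ℤ)) P : Nq d A) : Uq N d A)) -
         (∑ r ∈ Finset.range (M + 1),
            phiU d A i (-(r : ℤ)) * gU d A (r : ℤ) *
              ((Ωφ i (k + (r : ℤ)) P : Nq d A) : Uq N d A))))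

/-- The Taylor coefficients at `t = 0` of `(a t - 1)/(t - a)` (for `a = q^{(α_i|α_j)}`
this is the series `g_{i,j}(t)`; for `a = q^{-(α_i|α_j)}` it is `g_{i,j,q^{-1}}(t)`). -/
def gcoef (a : Fq) : ℕ → Fq
  | 0 => a⁻¹
  | r + 1 => a ^ (-(r : ℤ) - 2) - a ^ (-(r : ℤ))

section

open Finset

section QNumbers

variable {k : Type*} [Field k]

/-- The balanced quantum integer in the variable `v`. -/
def qnum (v : k) (n : ℤ) : k := (v ^ n - v ^ (-n)) / (v - v⁻¹)

/-- The quantum factorial in the variable `v`. -/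
def qnumFact (v : k) : ℕ → k
  | 0 => 1
  | n + 1 => qnum v (n + 1) * qnumFact v n

/-- The quantum binomial coefficient in the variable `v`. -/
def qnumBinom (v : k) (n r : ℕ) : k := qnumFact v n / (qnumFact v r * qnumFact v (n - r))

/-- `v` is nonzero and not a root of unity. -/
def NotRootOfUnity (v : k) : Prop := v ≠ 0 ∧ ∀ n : ℤ, v ^ n = 1 → n = 0

theorem NotRootOfUnity.inv {v : k} (hv : NotRootOfUnity v) : NotRootOfUnity v⁻¹ := by
  refine ⟨inv_ne_zero hv.1, fun n hn => ?_⟩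
  rw [inv_zpow'] at hn
  have := hv.2 _ hn
  omega

theorem qnum_inv (v : k) (n : ℤ) : qnum v⁻¹ n = qnum v n := by
  unfold qnum
  rw [inv_zpow', inv_zpow', neg_neg, inv_inv, ← neg_sub (v ^ n), ← neg_sub v, neg_div_neg_eq]

theorem qnumFact_inv (v : k) (n : ℕ) : qnumFact v⁻¹ n = qnumFact v n := by
  induction n with
  | zero => rfl
  | succ n ih => simp only [qnumFact, ih, qnum_inv]

theorem qnumBinom_inv (v : k) (n r : ℕ) : qnumBinom v⁻¹ n r = qnumBinom v n r := by
  simp only [qnumBinom, qnumFact_inv]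

variable {v : k} (hv : NotRootOfUnity v)
include hv

theorem NotRootOfUnity.zpow_sub_ne_zero {n : ℤ} (hn : n ≠ 0) : v ^ n - v ^ (-n) ≠ 0 := by
  intro h
  have h1 : v ^ (2 * n) = 1 := by
    have h2 := sub_eq_zero.1 h
    have : v ^ (2 * n) = v ^ n * v ^ n := by rw [two_mul, zpow_add₀ hv.1]
    rw [this]
    nth_rewrite 2 [h2]
    rw [← zpow_add₀ hv.1]; simp
  have := hv.2 _ h1
  omega

theorem NotRootOfUnity.sub_inv_ne_zero : v - v⁻¹ ≠ 0 := by
  have := hv.zpow_sub_ne_zero (n := 1) one_ne_zero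
  simpa using this

theorem NotRootOfUnity.qnum_ne_zero {n : ℤ} (hn : n ≠ 0) : qnum v n ≠ 0 :=
  div_ne_zero (hv.zpow_sub_ne_zero hn) hv.sub_inv_ne_zero

theorem NotRootOfUnity.qnumFact_ne_zero (n : ℕ) : qnumFact v n ≠ 0 := by
  induction n with
  | zero => exact one_ne_zero
  | succ n ih => exact mul_ne_zero (hv.qnum_ne_zero (by omega)) ih

theorem sub_inv_mul_qnum (n : ℤ) : (v - v⁻¹) * qnum v n = v ^ n - v ^ (-n) :=
  mul_div_cancel₀ _ hv.sub_inv_ne_zero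

theorem qnumBinom_succ_succ_mul {n r : ℕ} :
    qnumBinom v (n + 1) (r + 1) * qnum v (r + 1) = qnum v (n + 1) * qnumBinom v n r := by
  have h1 := hv.qnumFact_ne_zero r
  have h2 := hv.qnumFact_ne_zero (n - r)
  have h3 : qnum v (r + 1) ≠ 0 := hv.qnum_ne_zero (by omega)
  simp only [qnumBinom, qnumFact, Nat.add_sub_add_right]
  field_simp

theorem qnumBinom_succ_mul {n r : ℕ} (hr : r ≤ n) :
    qnumBinom v (n + 1) r * qnum v ((n : ℤ) + 1 - r) = qnum v (n + 1) * qnumBinom v n r := by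
  have h1 := hv.qnumFact_ne_zero r
  have h2 := hv.qnumFact_ne_zero (n - r)
  have h3 : qnum v ((n : ℤ) + 1 - r) ≠ 0 := hv.qnum_ne_zero (by omega)
  have h4 : (((n - r : ℕ) : ℤ) + 1) = (n : ℤ) + 1 - r := by omega
  rw [qnumBinom, Nat.succ_sub hr]
  simp only [qnumBinom, qnumFact, h4]
  field_simp

theorem qnumBinom_zero (n : ℕ) : qnumBinom v n 0 = 1 := by
  simp [qnumBinom, qnumFact, div_self (hv.qnumFact_ne_zero n)]

theorem qnumBinom_self (n : ℕ) : qnumBinom v n n = 1 := by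
  simp [qnumBinom, qnumFact, div_self (hv.qnumFact_ne_zero n)]

/-- The quantum Pascal identity. -/
theorem qnumBinom_pascal {n r : ℕ} (hr : r < n) :
    qnumBinom v (n + 1) (r + 1) =
      v ^ (-((n : ℤ) - r)) * qnumBinom v n r + v ^ ((r : ℤ) + 1) * qnumBinom v n (r + 1) := by
  have h1 := hv.qnumFact_ne_zero r
  have h2 := hv.qnumFact_ne_zero (n - (r + 1))
  have h3 : qnum v ((r : ℤ) + 1) ≠ 0 := hv.qnum_ne_zero (by omega)
  have h4 : qnum v ((n : ℤ) - r) ≠ 0 := hv.qnum_ne_zero (by omega)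
  have e1 : n - r = (n - (r + 1)) + 1 := by omega
  have e2 : (((n - (r + 1) : ℕ) : ℤ) + 1) = (n : ℤ) - r := by omega
  have key : qnum v ((n : ℤ) + 1) =
      v ^ (-((n : ℤ) - r)) * qnum v ((r : ℤ) + 1) + v ^ ((r : ℤ) + 1) * qnum v ((n : ℤ) - r) := by
    have h0 := hv.sub_inv_ne_zero
    refine mul_left_cancel₀ h0 ?_
    rw [mul_add, mul_left_comm, mul_left_comm (v - v⁻¹), sub_inv_mul_qnum hv,
      sub_inv_mul_qnum hv, sub_inv_mul_qnum hv, mul_sub, mul_sub, ← zpow_add₀ hv.1,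
      ← zpow_add₀ hv.1, ← zpow_add₀ hv.1, ← zpow_add₀ hv.1]
    ring_nf
  simp only [qnumBinom, Nat.add_sub_add_right, e1, qnumFact, e2, key]
  field_simp

theorem geom_sum_sq (m : ℕ) :
    v * ∑ i ∈ range m, (v ^ 2) ^ i = v ^ m * qnum v m := by
  have h0 := hv.sub_inv_ne_zero
  refine mul_left_cancel₀ h0 ?_
  rw [mul_left_comm _ (v ^ m), sub_inv_mul_qnum hv]
  have h1 := mul_geom_sum (v ^ 2) m
  have : (v - v⁻¹) * (v * ∑ i ∈ range m, (v ^ 2) ^ i) =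
      (v ^ 2 - 1) * ∑ i ∈ range m, (v ^ 2) ^ i := by
    rw [← mul_assoc, sub_mul, inv_mul_cancel₀ hv.1, sq]
  rw [this, h1, mul_sub, ← zpow_natCast v m, ← zpow_add₀ hv.1 (m : ℤ) m,
    ← zpow_add₀ hv.1 (m : ℤ) (-m), add_neg_cancel, zpow_zero, ← Nat.cast_add, zpow_natCast,
    ← pow_mul, two_mul]

end QNumbers

theorem qq_notRoot : NotRootOfUnity qq := by
  have h0 : qq ≠ 0 := pow_ne_zero _ RatFunc.X_ne_zero
  have hnat : ∀ n : ℕ, qq ^ n = 1 → n = 0 := by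
    intro n hn
    by_contra hne
    have h1 : (algebraMap (Polynomial ℚ) (RatFunc ℚ)) (Polynomial.X ^ (2 * n)) =
        algebraMap (Polynomial ℚ) (RatFunc ℚ) 1 := by
      rw [map_pow, RatFunc.algebraMap_X, map_one, pow_mul]; exact hn
    have h2 := RatFunc.algebraMap_injective ℚ h1
    have h3 := congrArg Polynomial.natDegree h2
    simp at h3
    exact hne h3
  refine ⟨h0, fun n hn => ?_⟩
  rcases le_total 0 n with h | h
  · lift n to ℕ using h
    exact_mod_cast hnat n (by exact_mod_cast hn)
  · obtain ⟨m, rfl⟩ : ∃ m : ℕ, n = -m := ⟨n.natAbs, by omega⟩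
    rw [zpow_neg, inv_eq_one] at hn
    have := hnat m (by exact_mod_cast hn)
    omega

section Params

variable {N : ℕ} (d : Fin N → ℤ) (A : Fin N → Fin N → ℤ)

theorem qi_notRoot {d : Fin N → ℤ} (hd : ∀ i, 0 < d i) (i : Fin N) : NotRootOfUnity (qi d i) := by
  refine ⟨zpow_ne_zero _ qq_notRoot.1, fun n hn => ?_⟩
  rw [qi, ← zpow_mul] at hn
  have := qq_notRoot.2 _ hn
  have h2 := (hd i).ne'
  simpa [h2] using this

theorem qint_eq_qnum (i : Fin N) (n : ℤ) : qint d i n = qnum (qi d i) n := rfl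

theorem qfact_eq_qnumFact (i : Fin N) (n : ℕ) : qfact d i n = qnumFact (qi d i) n := by
  induction n with
  | zero => rfl
  | succ n ih => simp only [qfact, qnumFact, ih, qint_eq_qnum]

theorem qbinom_eq_qnumBinom (i : Fin N) (n r : ℕ) :
    qbinom d i n r = qnumBinom (qi d i) n r := by
  simp only [qbinom, qnumBinom, qfact_eq_qnumFact]

theorem qp_ne_zero (i j : Fin N) : qp d A i j ≠ 0 := zpow_ne_zero _ qq_notRoot.1

theorem qp_eq_qi_zpow (i j : Fin N) : qp d A i j = qi d i ^ (A i j) := by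
  rw [qp, qi, zpow_mul]

theorem qp_symm {d : Fin N → ℤ} {A : Fin N → Fin N → ℤ}
    (hsym : ∀ i j, d i * A i j = d j * A j i) (i j : Fin N) :
    qp d A i j = qp d A j i := by
  rw [qp, qp, hsym]

end Params

section SerreIdentities

variable {k : Type*} [Field k] {E : Type*} [Ring E] [Algebra k E]

section QPlane

variable {Q : k} {a b : E} (hba : b * a = Q • (a * b))
include hba

theorem qplane_mul_left : (Q • a - b) * a = Q • (a * (a - b)) := by
  rw [sub_mul, hba, smul_mul_assoc, mul_sub, smul_sub]

theorem qplane_mul_right : b * (a - Q • b) = Q • ((a - b) * b) := by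
  rw [mul_sub, hba, mul_smul_comm, sub_mul, smul_sub]

theorem qplane_pow_left (j : ℕ) :
    (Q • a - b) ^ j = (a - b) ^ j + (Q ^ j - 1) • (a * (a - b) ^ (j - 1)) := by
  induction j with
  | zero => simp
  | succ j ih =>
    rw [pow_succ', ih, mul_add, mul_smul_comm, ← mul_assoc, qplane_mul_left hba]
    have h1 : (Q • a - b) * (a - b) ^ j = (a - b) ^ (j + 1) + (Q - 1) • (a * (a - b) ^ j) := by
      have : Q • a - b = (a - b) + (Q - 1) • a := by rw [sub_smul, one_smul]; abel
      rw [this, add_mul, smul_mul_assoc, pow_succ']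
    rw [h1]
    rcases j with _ | j
    · simp
    · simp only [Nat.add_sub_cancel, smul_mul_assoc, mul_assoc, ← pow_succ']
      module

theorem qplane_pow_right (r : ℕ) :
    (a - Q • b) ^ r = (a - b) ^ r - (Q ^ r - 1) • ((a - b) ^ (r - 1) * b) := by
  induction r with
  | zero => simp
  | succ r ih =>
    rw [pow_succ, ih, sub_mul, smul_mul_assoc, mul_assoc, qplane_mul_right hba]
    have h1 : (a - b) ^ r * (a - Q • b) = (a - b) ^ (r + 1) - (Q - 1) • ((a - b) ^ r * b) := by
      have : a - Q • b = (a - b) - (Q - 1) • b := by rw [sub_smul, one_smul]; abel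
      rw [this, mul_sub, mul_smul_comm, pow_succ]
    rw [h1]
    rcases r with _ | r
    · simp
    · simp only [Nat.add_sub_cancel, mul_smul_comm, ← mul_assoc, ← pow_succ]
      module

theorem qplane_geom_sum (r : ℕ) :
    ∑ i ∈ range r, (a - Q • b) ^ i * (Q • a - b) ^ (r - 1 - i) =
      (∑ i ∈ range r, Q ^ i) • (a - b) ^ (r - 1) := by
  induction r with
  | zero => simp
  | succ r ih =>
    rcases r with _ | r
    · simp
    rw [sum_range_succ']
    have h1 : ∀ i ∈ range (r + 1), (a - Q • b) ^ (i + 1) * (Q • a - b) ^ (r + 1 + 1 - 1 - (i + 1)) =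
        (a - Q • b) * ((a - Q • b) ^ i * (Q • a - b) ^ (r + 1 - 1 - i)) := by
      intro i hi
      rw [pow_succ', mul_assoc]
      congr 3
      omega
    rw [sum_congr rfl h1, ← mul_sum, ih, sum_range_succ _ (r + 1)]
    simp only [Nat.add_sub_cancel, pow_zero, one_mul, Nat.sub_zero, mul_smul_comm]
    rw [qplane_pow_left hba (r + 1)]
    have h2 : (a - Q • b) * (a - b) ^ r = (a - b) ^ (r + 1) - (Q - 1) • (b * (a - b) ^ r) := by
      have : a - Q • b = (a - b) - (Q - 1) • b := by rw [sub_smul, one_smul]; abel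
      rw [this, sub_mul, smul_mul_assoc, pow_succ']
    have h3 : (a - b) ^ (r + 1) = a * (a - b) ^ r - b * (a - b) ^ r := by rw [pow_succ', sub_mul]
    have h4 : (∑ i ∈ range (r + 1), Q ^ i) * (Q - 1) = Q ^ (r + 1) - 1 := geom_sum_mul Q (r + 1)
    rw [h2, smul_sub, smul_smul, h4, Nat.add_sub_cancel, h3]
    module

end QPlane

end SerreIdentities

section SerreIdentities

variable {k : Type*} [Field k] {E : Type*} [Ring E] [Algebra k E]

/-- The identity behind `[x⁺_i, S_{ij}] = 0` for the Drinfeld-Serre element `S_{ij}`. -/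
theorem serre_identity_self {v : k} (hv : NotRootOfUnity v) (s : ℕ) {a b c d : E}
    (hba : b * a = (v ^ 2) • (a * b))
    (hbc : b * c + d * a = (v ^ s)⁻¹ • (c * b + a * d)) :
    ∑ r ∈ range (s + 1 + 1), ((-1) ^ r * qnumBinom v (s + 1) r) •
      ((∑ i ∈ range r, (a - v ^ 2 • b) ^ i * (v ^ 2 • a - b) ^ (r - 1 - i)) *
          ((v ^ s)⁻¹ • c - d) * (v ^ 2 • a - b) ^ (s + 1 - r) +
        (a - v ^ 2 • b) ^ r * (c - (v ^ s)⁻¹ • d) *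
          ∑ i ∈ range (s + 1 - r),
            (a - v ^ 2 • b) ^ i * (v ^ 2 • a - b) ^ (s + 1 - r - 1 - i)) = 0 := by
  have hv0 := hv.1
  set Q : k := v ^ 2 with hQ
  set R : k := (v ^ s)⁻¹ with hR
  have hR0 : R ≠ 0 := inv_ne_zero (pow_ne_zero _ hv0)
  set t := a - b with ht
  set X := Q • a - b with hX
  set T := a - Q • b with hT
  set Y := R • c - d with hY
  set Y' := c - R • d with hY'
  have hgeo : ∀ m : ℕ, ∑ i ∈ range m, Q ^ i = v⁻¹ * (v ^ m * qnum v m) := fun m => by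
    rw [← geom_sum_sq hv m, inv_mul_cancel_left₀ hv0]
  have hgeoT : ∀ m : ℕ, ∑ i ∈ range m, T ^ i * X ^ (m - 1 - i) =
      (∑ i ∈ range m, Q ^ i) • t ^ (m - 1) := qplane_geom_sum hba
  simp only [hgeoT, smul_add, sum_add_distrib]
  rw [sum_range_succ', sum_range_succ _ (s + 1)]
  simp only [range_zero, sum_empty, zero_smul, zero_mul, smul_zero, add_zero, Nat.sub_self,
    mul_zero]
  set z : k := v - v⁻¹ with hz
  have hz0 : z ≠ 0 := hv.sub_inv_ne_zero
  have hz' : ∀ m : ℤ, v ^ m - v ^ (-m) = z * qnum v m := fun m => (sub_inv_mul_qnum hv m).symm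
  have hterm : ∀ r ∈ range (s + 1),
      ((-1) ^ (r + 1) * qnumBinom v (s + 1) (r + 1)) •
        ((∑ i ∈ range (r + 1), Q ^ i) • t ^ (r + 1 - 1) * Y * X ^ (s + 1 - (r + 1))) +
      ((-1) ^ r * qnumBinom v (s + 1) r) •
        (T ^ r * Y' * (∑ i ∈ range (s + 1 - r), Q ^ i) • t ^ (s + 1 - r - 1)) =
      (qnum v (s + 1) * z) • (((-1) ^ r * (qnumBinom v s r * qnum v ((s : ℤ) - r))) •
          (t ^ r * c * t ^ (s - r) - R⁻¹ • (t ^ r * Y * a * t ^ (s - r - 1))) +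
        ((-1) ^ r * (qnumBinom v s r * qnum v r)) •
          (t ^ r * d * t ^ (s - r) - R⁻¹ • (t ^ (r - 1) * b * Y' * t ^ (s - r)))) := by
    intro r hr
    have hrs : r ≤ s := by have := mem_range.1 hr; omega
    have e1 : qnumBinom v (s + 1) (r + 1) * (v⁻¹ * (v ^ (r + 1) * qnum v ((r + 1 : ℕ) : ℤ))) =
        qnum v (s + 1) * qnumBinom v s r * v ^ r := by
      have := qnumBinom_succ_succ_mul hv (n := s) (r := r)
      push_cast
      rw [mul_left_comm, mul_left_comm _ (v ^ (r + 1)), this, pow_succ]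
      field_simp
    have e2 : qnumBinom v (s + 1) r * (v⁻¹ * (v ^ (s + 1 - r) * qnum v ((s + 1 - r : ℕ) : ℤ))) =
        qnum v (s + 1) * qnumBinom v s r * v ^ (s - r) := by
      have := qnumBinom_succ_mul hv hrs
      rw [Nat.cast_sub (by omega)]
      push_cast
      rw [mul_left_comm, mul_left_comm _ (v ^ (s + 1 - r)), this, Nat.succ_sub hrs, pow_succ]
      field_simp
    have e3 : v ^ r * (Q ^ (s - r) - 1) = R⁻¹ * (z * qnum v ((s : ℤ) - r)) := by
      rw [← hz', hR, inv_inv, hQ, ← pow_mul, ← Nat.cast_sub hrs, zpow_neg, zpow_natCast]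
      have : v ^ s = v ^ r * v ^ (s - r) := by rw [← pow_add]; congr 1; omega
      rw [this]
      field_simp
      ring
    have e4 : v ^ (s - r) * (Q ^ r - 1) = R⁻¹ * (z * qnum v r) := by
      rw [← hz', hR, inv_inv, hQ, ← pow_mul, zpow_neg, zpow_natCast]
      have : v ^ s = v ^ r * v ^ (s - r) := by rw [← pow_add]; congr 1; omega
      rw [this]
      field_simp
      ring
    have e5 : v ^ (s - r) • Y' - v ^ r • Y = (z * qnum v ((s : ℤ) - r)) • c +
      (z * qnum v r) • d := by
      have f1 : v ^ r * R = v ^ (-((s : ℤ) - r)) := by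
        rw [hR, neg_sub, zpow_sub₀ hv0, zpow_natCast, zpow_natCast, div_eq_mul_inv]
      have f2 : v ^ (s - r) * R = v ^ (-(r : ℤ)) := by
        rw [hR, zpow_neg, zpow_natCast]
        have : v ^ s = v ^ r * v ^ (s - r) := by rw [← pow_add]; congr 1; omega
        rw [this]
        field_simp
      rw [hY, hY', smul_sub, smul_sub, smul_smul, smul_smul, f1, f2, ← hz', ← hz',
        ← Nat.cast_sub hrs, zpow_natCast, zpow_natCast]
      module
    have g1 : s + 1 - (r + 1) = s - r := by omega
    have g2 : s + 1 - r - 1 = s - r := by omega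
    rw [hgeo, hgeo, g1, g2, Nat.add_sub_cancel, smul_mul_assoc, smul_mul_assoc, mul_smul_comm,
      smul_smul, smul_smul, mul_assoc ((-1) ^ (r + 1)), e1, mul_assoc ((-1) ^ r) (qnumBinom _ _ _),
      e2]
    have p1 : X ^ (s - r) = t ^ (s - r) + (Q ^ (s - r) - 1) • (a * t ^ (s - r - 1)) :=
      qplane_pow_left hba _
    have p2 : T ^ r = t ^ r - (Q ^ r - 1) • (t ^ (r - 1) * b) := qplane_pow_right hba _
    rw [p1, p2]
    have main : v ^ (s - r) • ((t ^ r - (Q ^ r - 1) • (t ^ (r - 1) * b)) * Y' * t ^ (s - r)) -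
        v ^ r • (t ^ r * Y * (t ^ (s - r) + (Q ^ (s - r) - 1) • (a * t ^ (s - r - 1)))) =
        t ^ r * (v ^ (s - r) • Y' - v ^ r • Y) * t ^ (s - r) -
          (v ^ (s - r) * (Q ^ r - 1)) • (t ^ (r - 1) * b * Y' * t ^ (s - r)) -
          (v ^ r * (Q ^ (s - r) - 1)) • (t ^ r * Y * a * t ^ (s - r - 1)) := by
      simp only [sub_mul, mul_sub, mul_add, smul_sub, smul_add, smul_mul_assoc, mul_smul_comm,
        smul_smul, mul_assoc]
      abel
    rw [e3, e4, e5] at main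
    have lhs : ((-1) ^ (r + 1) * (qnum v (s + 1) * qnumBinom v s r * v ^ r)) •
          (t ^ r * Y * (t ^ (s - r) + (Q ^ (s - r) - 1) • (a * t ^ (s - r - 1)))) +
        ((-1) ^ r * (qnum v (s + 1) * qnumBinom v s r * v ^ (s - r))) •
          ((t ^ r - (Q ^ r - 1) • (t ^ (r - 1) * b)) * Y' * t ^ (s - r)) =
        ((-1) ^ r * (qnum v (s + 1) * qnumBinom v s r)) •
        (v ^ (s - r) • ((t ^ r - (Q ^ r - 1) • (t ^ (r - 1) * b)) * Y' * t ^ (s - r)) -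
        v ^ r • (t ^ r * Y * (t ^ (s - r) + (Q ^ (s - r) - 1) • (a * t ^ (s - r - 1))))) := by
      rw [pow_succ]
      module
    rw [lhs, main]
    simp only [mul_add, add_mul, smul_mul_assoc, mul_smul_comm]
    module
  rw [← sum_add_distrib, sum_congr rfl hterm, ← smul_sum]
  convert smul_zero _
  rw [sum_add_distrib, sum_range_succ, sum_range_succ']
  simp only [sub_self, Nat.cast_zero]
  have hq0 : qnum v 0 = 0 := by simp [qnum]
  rw [hq0]
  simp only [mul_zero, zero_smul, add_zero]
  rw [← sum_add_distrib]
  refine sum_eq_zero fun r hr => ?_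
  have hrs := mem_range.1 hr
  obtain ⟨s', rfl⟩ : ∃ s', s = s' + 1 := ⟨s - 1, by omega⟩
  have c1 : qnumBinom v (s' + 1) r * qnum v (((s' + 1 : ℕ) : ℤ) - r) =
      qnum v (s' + 1) * qnumBinom v s' r := by
    have := qnumBinom_succ_mul hv (n := s') (r := r) (by omega)
    rw [← this]; push_cast; rfl
  have c2 : qnumBinom v (s' + 1) (r + 1) * qnum v ((r + 1 : ℕ) : ℤ) =
      qnum v (s' + 1) * qnumBinom v s' r := by
    have := qnumBinom_succ_succ_mul hv (n := s') (r := r)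
    rw [← this]; push_cast; rfl
  rw [c1, c2]
  have g1 : s' + 1 - r = (s' - r) + 1 := by omega
  have g2 : s' + 1 - (r + 1) = s' - r := by omega
  rw [g1, g2, Nat.add_sub_cancel, Nat.add_sub_cancel]
  have brace : c * t - R⁻¹ • (Y * a) - (t * d - R⁻¹ • (b * Y')) = 0 := by
    have h1 : R⁻¹ • (b * Y') - R⁻¹ • (Y * a) = R⁻¹ • (b * c + d * a) - b * d - c * a := by
      rw [hY, hY', mul_sub, sub_mul, smul_sub, smul_sub, smul_mul_assoc, mul_smul_comm,
        inv_smul_smul₀ hR0, inv_smul_smul₀ hR0, smul_add]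
      abel
    have h2 : c * t - R⁻¹ • (Y * a) - (t * d - R⁻¹ • (b * Y')) =
        c * t - t * d + (R⁻¹ • (b * Y') - R⁻¹ • (Y * a)) := by abel
    rw [h2, h1, hbc, inv_smul_smul₀ hR0, ht]
    noncomm_ring
  have brace' := congrArg (fun w => t ^ r * w * t ^ (s' - r)) brace
  simp only [mul_zero, zero_mul] at brace'
  have : ∀ (α : k) (w₁ w₂ : E), w₁ - w₂ = 0 →
      ((-1) ^ r * α) • w₁ + ((-1) ^ (r + 1) * α) • w₂ = 0 := by
    intro α w₁ w₂ h
    rw [sub_eq_zero.1 h, pow_succ]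
    module
  refine this _ _ _ ?_
  rw [← brace']
  simp only [mul_sub, sub_mul, smul_mul_assoc, mul_smul_comm, pow_succ, mul_assoc,
    ← pow_succ']
  
theorem qnumBinom_symm (v : k) {n r : ℕ} (hr : r ≤ n) :
    qnumBinom v n (n - r) = qnumBinom v n r := by
  rw [qnumBinom, qnumBinom, Nat.sub_sub_self hr, mul_comm (qnumFact v r)]

theorem qplane_binomial {v : k} (hv : NotRootOfUnity v) (R : k) {a b : E}
    (hba : b * a = (v ^ 2) • (a * b)) (m : ℕ) :
    ∑ j ∈ range (m + 1), ((-R) ^ j * v ^ ((j : ℤ) * (m - 1)) * qnumBinom v m j) •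
      ((a - R • b) ^ (m - j) * (R • a - b) ^ j) =
      (∏ i ∈ range m, (1 - R ^ 2 * (v ^ 2) ^ i)) • a ^ m := by
  set T := a - R • b with hT
  set X := R • a - b with hX
  induction m with
  | zero => simp [qnumBinom_zero hv]
  | succ m ih =>
    have hpow : b * a ^ m = ((v ^ 2) ^ m) • (a ^ m * b) := by
      clear ih
      induction m with
      | zero => simp
      | succ m ih =>
        rw [pow_succ, ← mul_assoc, ih, smul_mul_assoc, mul_assoc, hba, mul_smul_comm, smul_smul,
          ← pow_succ, mul_assoc]
    have hrec : T * a ^ m - (R * (v ^ 2) ^ m) • (a ^ m * X) =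
        (1 - R ^ 2 * (v ^ 2) ^ m) • a ^ (m + 1) := by
      rw [hT, hX, sub_mul, smul_mul_assoc, hpow, mul_sub, mul_smul_comm, ← pow_succ, ← pow_succ']
      module
    rw [prod_range_succ, mul_smul, ← hrec, smul_sub, smul_comm _ (R * (v ^ 2) ^ m),
      ← mul_smul_comm, ← smul_mul_assoc, ← ih, mul_sum, sum_mul, smul_sum, sum_range_succ,
      sum_range_succ', sum_range_succ' _ m, sum_range_succ _ m]
    have hmid : ∀ j ∈ range m,
        ((-R) ^ (j + 1) * v ^ (((j + 1 : ℕ) : ℤ) * ((m + 1 : ℕ) - 1)) *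
            qnumBinom v (m + 1) (j + 1)) • (T ^ (m + 1 - (j + 1)) * X ^ (j + 1)) =
        T * (((-R) ^ (j + 1) * v ^ (((j + 1 : ℕ) : ℤ) * (m - 1)) * qnumBinom v m (j + 1)) •
            (T ^ (m - (j + 1)) * X ^ (j + 1))) -
        (R * (v ^ 2) ^ m) • (((-R) ^ j * v ^ ((j : ℤ) * (m - 1)) * qnumBinom v m j) •
            (T ^ (m - j) * X ^ j) * X) := by
      intro j hj
      have hj := mem_range.1 hj
      have hp := qnumBinom_pascal hv.inv hj
      rw [qnumBinom_inv, qnumBinom_inv, qnumBinom_inv, inv_zpow', inv_zpow', neg_neg] at hp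
      have g1 : m + 1 - (j + 1) = m - j := by omega
      have g2 : m - j = (m - (j + 1)) + 1 := by omega
      have e1 : v ^ (((j + 1 : ℕ) : ℤ) * ((m + 1 : ℕ) - 1)) * v ^ (-((j : ℤ) + 1)) =
          v ^ (((j + 1 : ℕ) : ℤ) * (m - 1)) := by
        rw [← zpow_add₀ hv.1]; congr 1; push_cast; ring
      have e2 : v ^ (((j + 1 : ℕ) : ℤ) * ((m + 1 : ℕ) - 1)) * v ^ ((m : ℤ) - j) =
          v ^ ((j : ℤ) * (m - 1)) * (v ^ 2) ^ m := by
        rw [← pow_mul, ← zpow_natCast v (2 * m), ← zpow_add₀ hv.1, ← zpow_add₀ hv.1]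
        congr 1; push_cast; ring
      rw [hp, g1, mul_smul_comm, ← mul_assoc, smul_mul_assoc, mul_assoc (T ^ (m - j)), ← pow_succ,
        ← pow_succ' T, ← g2, mul_add, ← mul_assoc, ← mul_assoc,
        mul_assoc _ (v ^ (((j + 1 : ℕ) : ℤ) * ((m + 1 : ℕ) - 1))) (v ^ ((m : ℤ) - j)),
        mul_assoc _ (v ^ (((j + 1 : ℕ) : ℤ) * ((m + 1 : ℕ) - 1))) (v ^ (-((j : ℤ) + 1))),
        e1, e2, pow_succ (-R)]
      module
    rw [sum_congr rfl hmid, sum_sub_distrib]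
    have hlast : ((-R) ^ (m + 1) * v ^ (((m + 1 : ℕ) : ℤ) * ((m + 1 : ℕ) - 1)) *
            qnumBinom v (m + 1) (m + 1)) • (T ^ (m + 1 - (m + 1)) * X ^ (m + 1)) =
        - ((R * (v ^ 2) ^ m) • (((-R) ^ m * v ^ ((m : ℤ) * (m - 1)) * qnumBinom v m m) •
            (T ^ (m - m) * X ^ m) * X)) := by
      have e2 : v ^ (((m + 1 : ℕ) : ℤ) * ((m + 1 : ℕ) - 1)) =
          v ^ ((m : ℤ) * (m - 1)) * (v ^ 2) ^ m := by
        rw [← pow_mul, ← zpow_natCast v (2 * m), ← zpow_add₀ hv.1]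
        congr 1; push_cast; ring
      rw [qnumBinom_self hv, qnumBinom_self hv, e2, Nat.sub_self, Nat.sub_self, pow_zero, one_mul,
        one_mul, smul_mul_assoc, ← pow_succ, pow_succ (-R)]
      module
    have hfirst : ((-R) ^ 0 * v ^ (((0 : ℕ) : ℤ) * ((m + 1 : ℕ) - 1)) *
            qnumBinom v (m + 1) 0) • (T ^ (m + 1 - 0) * X ^ 0) =
        T * (((-R) ^ 0 * v ^ (((0 : ℕ) : ℤ) * (m - 1)) * qnumBinom v m 0) •
            (T ^ (m - 0) * X ^ 0)) := by
      simp [qnumBinom_zero hv, pow_succ']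
    rw [hlast, hfirst]
    abel

/-- The identity behind `[x⁺_j, S_{ij}] = 0` for the Drinfeld-Serre element `S_{ij}`. -/
theorem serre_identity_partner {v : k} (hv : NotRootOfUnity v) (s : ℕ) {a b : E}
    (hba : b * a = (v ^ 2) • (a * b)) :
    ∑ r ∈ range (s + 1 + 1), ((-1) ^ r * qnumBinom v (s + 1) r) •
      ((a - (v ^ s)⁻¹ • b) ^ r * ((v ^ s)⁻¹ • a - b) ^ (s + 1 - r)) = 0 := by
  have h := qplane_binomial hv (v ^ s)⁻¹ hba (s + 1)
  have hs : (1 : k) - ((v ^ s)⁻¹) ^ 2 * (v ^ 2) ^ s = 0 := by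
    have := pow_ne_zero s hv.1
    rw [← pow_mul, mul_comm 2 s, pow_mul]
    field_simp
    simp
  rw [prod_range_succ, hs, mul_zero, zero_smul] at h
  rw [← sum_range_reflect, ← smul_zero ((-1 : k) ^ (s + 1)), ← h, smul_sum]
  refine sum_congr rfl fun j hj => ?_
  have hj' : j ≤ s + 1 := by have := mem_range.1 hj; omega
  have g1 : s + 1 + 1 - 1 - j = s + 1 - j := by omega
  rw [g1, qnumBinom_symm v hj', Nat.sub_sub_self hj', smul_smul]
  congr 1
  have e1 : (-(v ^ s)⁻¹) ^ j * v ^ ((j : ℤ) * ((s + 1 : ℕ) - 1)) = (-1) ^ j := by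
    have : v ^ ((j : ℤ) * ((s + 1 : ℕ) - 1)) = (v ^ s) ^ j := by
      rw [← pow_mul, ← zpow_natCast]; congr 1; push_cast; ring
    rw [this, ← mul_pow, neg_mul, inv_mul_cancel₀ (pow_ne_zero _ hv.1)]
  rw [e1, ← mul_assoc]
  congr 1
  have : (-1 : k) ^ (s + 1) = (-1) ^ (s + 1 - j) * (-1) ^ j := by rw [← pow_add]; congr 1; omega
  rw [this, mul_assoc, ← mul_pow]
  simp

end SerreIdentities

section Currents

variable {k : Type*} [Field k] {E : Type*} [Ring E] [Algebra k E]

/-- The power series `∑ R^{-(s+1)} x_{l+s} w^s`. -/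
def current (x : ℤ → E) (R : k) (l : ℤ) : PowerSeries E :=
  PowerSeries.mk fun s => (R⁻¹) ^ (s + 1) • x (l + s)

/-- The quadratic Drinfeld relation between two families. -/
def QuadRel (x y : ℤ → E) (R : k) : Prop :=
  ∀ m l : ℤ, x (m + 1) * y l - R • (y l * x (m + 1)) = R • (x m * y (l + 1)) - y (l + 1) * x m

/-- The commutation relation of a family `x` with a Cartan series `θ`. -/
def TwistRel (θ : PowerSeries E) (x : ℤ → E) (R : k) : Prop :=
  ∀ l : ℤ, PowerSeries.C (x l) * θ =
    θ * (current x R l - R • (PowerSeries.X * current x R (l + 1)))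

theorem coeff_field_smul (n : ℕ) (c : k) (f : PowerSeries E) :
    PowerSeries.coeff n (c • f) = c • PowerSeries.coeff n f := rfl

theorem smul_current {R : k} (hR : R ≠ 0) (x : ℤ → E) (l : ℤ) :
    R • current x R l = PowerSeries.C (x l) + PowerSeries.X * current x R (l + 1) := by
  ext n
  rcases n with _ | n
  · simp [current, hR]
  · simp only [current, map_add, PowerSeries.coeff_succ_X_mul, PowerSeries.coeff_mk,
      PowerSeries.coeff_C, Nat.succ_ne_zero, if_false, zero_add, coeff_field_smul, smul_smul]
    rw [pow_succ' _ (n + 1), mul_inv_cancel_left₀ hR]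
    congr 2
    push_cast
    ring

theorem C_eq_current {R : k} (hR : R ≠ 0) (x : ℤ → E) (l : ℤ) :
    PowerSeries.C (x l) = R • current x R l - PowerSeries.X * current x R (l + 1) := by
  rw [smul_current hR, add_sub_cancel_right]

theorem X_mul_current_mul (f g : PowerSeries E) :
    f * (PowerSeries.X * g) = PowerSeries.X * (f * g) := by
  rw [← mul_assoc, (PowerSeries.commute_X f).eq, mul_assoc]

theorem coeff_current_mul (x y : ℤ → E) (R S : k) (l m : ℤ) (n : ℕ) :
    PowerSeries.coeff n (current x R l * current y S m) =
      ∑ p ∈ antidiagonal n, ((R⁻¹) ^ (p.1 + 1) * (S⁻¹) ^ (p.2 + 1)) •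
        (x (l + p.1) * y (m + p.2)) := by
  rw [PowerSeries.coeff_mul]
  refine sum_congr rfl fun p _ => ?_
  simp only [current, PowerSeries.coeff_mk, smul_mul_assoc, mul_smul_comm, smul_smul]
  rw [mul_comm]

theorem coeff_current_mul' (x y : ℤ → E) (R S : k) (l m : ℤ) (n : ℕ) :
    PowerSeries.coeff n (current y S m * current x R l) =
      ∑ p ∈ antidiagonal n, ((R⁻¹) ^ (p.1 + 1) * (S⁻¹) ^ (p.2 + 1)) •
        (y (m + p.2) * x (l + p.1)) := by
  rw [coeff_current_mul, ← Nat.sum_antidiagonal_swap]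
  refine sum_congr rfl fun p _ => ?_
  simp only [Prod.fst_swap, Prod.snd_swap]
  rw [mul_comm]

/-- Two currents of the same family generate a quantum plane. -/
theorem QuadRel.current_self (h2 : (2 : k) ≠ 0) {x : ℤ → E} {Q : k} (hx : QuadRel x x Q) (R : k)
    (l : ℤ) :
    (PowerSeries.X * current x R (l + 1)) * current x R l =
      Q • (current x R l * (PowerSeries.X * current x R (l + 1))) := by
  rw [X_mul_current_mul, mul_assoc, ← mul_smul_comm]
  congr 1
  ext n
  rw [coeff_field_smul, coeff_current_mul, coeff_current_mul', ← sub_eq_zero, smul_sum,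
    ← sum_sub_distrib]
  have hanti : ∀ p ∈ antidiagonal n,
      ((R⁻¹) ^ (p.1 + 1) * (R⁻¹) ^ (p.2 + 1)) • (x (l + 1 + p.1) * x (l + p.2)) -
        Q • ((R⁻¹) ^ (p.1 + 1) * (R⁻¹) ^ (p.2 + 1)) • (x (l + p.2) * x (l + 1 + p.1)) =
      - (((R⁻¹) ^ (p.2 + 1) * (R⁻¹) ^ (p.1 + 1)) • (x (l + 1 + p.2) * x (l + p.1)) -
        Q • ((R⁻¹) ^ (p.2 + 1) * (R⁻¹) ^ (p.1 + 1)) • (x (l + p.1) * x (l + 1 + p.2))) := by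
    intro p _
    have := hx (l + p.1) (l + p.2)
    rw [add_right_comm l (p.1 : ℤ) 1, add_right_comm l (p.2 : ℤ) 1] at this
    rw [smul_comm Q, smul_comm Q, ← smul_sub, ← smul_sub, this, ← smul_neg, neg_sub,
      mul_comm ((R⁻¹) ^ (p.2 + 1))]
  set S := ∑ p ∈ antidiagonal n,
    (((R⁻¹) ^ (p.1 + 1) * (R⁻¹) ^ (p.2 + 1)) • (x (l + 1 + p.1) * x (l + p.2)) -
        Q • ((R⁻¹) ^ (p.1 + 1) * (R⁻¹) ^ (p.2 + 1)) • (x (l + p.2) * x (l + 1 + p.1))) with hS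
  have hSS : S = -S := by
    conv_lhs => rw [hS, sum_congr rfl hanti, sum_neg_distrib, ← Nat.sum_antidiagonal_swap]
    rfl
  have h3 : (2 : k) • S = 0 := by rw [two_smul]; nth_rewrite 1 [hSS]; simp
  exact (smul_eq_zero.1 h3).resolve_left h2

theorem QuadRel.current_pair {x y : ℤ → E} {R : k} (hxy : QuadRel x y R) (S S' : k) (m l : ℤ) :
    (PowerSeries.X * current x S (m + 1)) * current y S' l +
        (PowerSeries.X * current y S' (l + 1)) * current x S m =
      R • (current y S' l * (PowerSeries.X * current x S (m + 1)) +
        current x S m * (PowerSeries.X * current y S' (l + 1))) := by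
  rw [X_mul_current_mul, X_mul_current_mul, mul_assoc, mul_assoc, ← mul_add, ← mul_add,
    ← mul_smul_comm]
  congr 1
  ext n
  rw [coeff_field_smul, map_add, map_add, coeff_current_mul x y S S' (m + 1) l,
    coeff_current_mul' x y S S' m (l + 1), coeff_current_mul' x y S S' (m + 1) l,
    coeff_current_mul x y S S' m (l + 1), ← sum_add_distrib, ← sum_add_distrib, smul_sum]
  refine sum_congr rfl fun p _ => ?_
  have := hxy (m + p.1) (l + p.2)
  rw [add_right_comm m (p.1 : ℤ) 1, add_right_comm l (p.2 : ℤ) 1] at this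
  rw [← smul_add, ← smul_add, smul_comm R]
  congr 1
  rw [sub_eq_sub_iff_add_eq_add] at this
  rw [this, smul_add]
  abel

theorem QuadRel.reverse {x y : ℤ → E} {R : k} (hR : R ≠ 0) (h : QuadRel x y R) :
    QuadRel (fun m => x (-m)) (fun m => y (-m)) R⁻¹ := by
  intro m l
  have := congrArg (R⁻¹ • ·) (h (-m - 1) (-l - 1))
  simp only [sub_add_cancel, smul_sub, inv_smul_smul₀ hR] at this
  simp only [neg_add, ← sub_eq_add_neg]
  rw [sub_eq_sub_iff_add_eq_add] at this ⊢
  rw [← this]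

/-- A sum of translates of a family. -/
def translateSum {ι : Type*} (s : Finset ι) (ks : ι → ℤ) (x : ℤ → E) (m : ℤ) : E :=
  ∑ t ∈ s, x (m + ks t)

theorem QuadRel.translateSum {ι : Type*} (s : Finset ι) (ks : ι → ℤ) {x y : ℤ → E} {R : k}
    (h : QuadRel x y R) : QuadRel (translateSum s ks x) y R := by
  intro m l
  simp only [_root_.translateSum, sum_mul, mul_sum, smul_sum, ← sum_sub_distrib]
  refine sum_congr rfl fun t _ => ?_
  rw [add_right_comm]
  exact h _ _

theorem QuadRel.translateSum_self {ι : Type*} (s : Finset ι) (ks : ι → ℤ) {x : ℤ → E} {R : k}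
    (h : QuadRel x x R) : QuadRel (_root_.translateSum s ks x) (_root_.translateSum s ks x) R := by
  refine QuadRel.translateSum s ks fun m l => ?_
  simp only [_root_.translateSum, sum_mul, mul_sum, smul_sum, ← sum_sub_distrib]
  refine sum_congr rfl fun t _ => ?_
  rw [add_right_comm l]
  exact h _ _

theorem TwistRel.translateSum {ι : Type*} (s : Finset ι) (ks : ι → ℤ) {θ : PowerSeries E}
    {x : ℤ → E} {R : k} (h : TwistRel θ x R) : TwistRel θ (_root_.translateSum s ks x) R := by
  intro l
  have hc : ∀ l, current (_root_.translateSum s ks x) R l = ∑ t ∈ s, current x R (l + ks t) := by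
    intro l
    ext n
    simp only [current, _root_.translateSum, PowerSeries.coeff_mk, map_sum, smul_sum]
    refine sum_congr rfl fun t _ => ?_
    rw [add_right_comm]
  rw [hc, hc, _root_.translateSum, map_sum, sum_mul, mul_sum, smul_sum, ← sum_sub_distrib, mul_sum]
  refine sum_congr rfl fun t _ => ?_
  rw [h, add_right_comm l]

/-- The coefficients of a power series, extended by zero to negative degrees. -/
def coeffInt (θ : PowerSeries E) (n : ℤ) : E :=
  if 0 ≤ n then PowerSeries.coeff n.toNat θ else 0

/-- The quadratic relation between a Cartan series and a family. -/
theorem TwistRel.quad {R : k} (hR : R ≠ 0) {θ : PowerSeries E} {y : ℤ → E} (h : TwistRel θ y R)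
    (n l : ℤ) :
    coeffInt θ (n + 1) * y l - R • (y l * coeffInt θ (n + 1)) =
      R • (coeffInt θ n * y (l + 1)) - y (l + 1) * coeffInt θ n := by
  have key : R • (PowerSeries.C (y l) * θ) - PowerSeries.X * (PowerSeries.C (y (l + 1)) * θ) =
      θ * PowerSeries.C (y l) - R • (PowerSeries.X * (θ * PowerSeries.C (y (l + 1)))) := by
    rw [h l, h (l + 1), C_eq_current hR y l, C_eq_current hR y (l + 1)]
    simp only [mul_sub, mul_smul_comm, X_mul_current_mul, smul_sub]
    abel
  have hc : ∀ (m : ℕ) (z : E), PowerSeries.coeff m (θ * PowerSeries.C z) =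
      PowerSeries.coeff m θ * z := fun m z => PowerSeries.coeff_mul_C _ _ _
  have hc' : ∀ (m : ℕ) (z : E), PowerSeries.coeff m (PowerSeries.C z * θ) =
      z * PowerSeries.coeff m θ := fun m z => PowerSeries.coeff_C_mul _ _ _
  rcases lt_trichotomy n (-1) with hn | rfl | hn
  · have h1 : ¬ (0 ≤ n + 1) := by omega
    have h2 : ¬ (0 ≤ n) := by omega
    simp [coeffInt, h1, h2]
  · have := congrArg (PowerSeries.coeff 0) key
    simp only [map_sub, coeff_field_smul, PowerSeries.coeff_zero_X_mul, hc, hc',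
      smul_zero, sub_zero]
      at this
    simp only [PowerSeries.coeff_zero_eq_constantCoeff] at this
    simp [coeffInt, this]
  · obtain ⟨m, rfl⟩ := Int.eq_ofNat_of_zero_le (show 0 ≤ n by omega)
    have := congrArg (PowerSeries.coeff (m + 1)) key
    simp only [map_sub, coeff_field_smul, PowerSeries.coeff_succ_X_mul, hc, hc'] at this
    have h1 : (0 : ℤ) ≤ m + 1 := by omega
    have h2 : (0 : ℤ) ≤ m := by omega
    have h3 : ((m : ℤ) + 1).toNat = m + 1 := by omega
    simp only [coeffInt, h1, h2, if_true, h3, Int.toNat_natCast]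
    rw [sub_eq_sub_iff_add_eq_add] at this ⊢
    rw [← this, add_comm]

end Currents

section SerreElement

variable {k : Type*} [Field k] {E : Type*} [Ring E] [Algebra k E]

/-- The non-symmetrized Drinfeld-Serre element. -/
def serreSum (v : k) (s : ℕ) (X Y : E) : E :=
  ∑ r ∈ range (s + 1 + 1), ((-1) ^ r * qnumBinom v (s + 1) r) • (X ^ r * Y * X ^ (s + 1 - r))

/-- The value at `L` of the derivative of `serreSum` in the direction of `X`. -/
def serreDeriv (v : k) (s : ℕ) (X Y L : E) : E :=
  ∑ r ∈ range (s + 1 + 1), ((-1) ^ r * qnumBinom v (s + 1) r) •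
    ((∑ i ∈ range r, X ^ i * L * X ^ (r - 1 - i)) * Y * X ^ (s + 1 - r) +
      X ^ r * Y * ∑ i ∈ range (s + 1 - r), X ^ i * L * X ^ (s + 1 - r - 1 - i))

theorem mul_pow_sub_pow_mul {p X L : E} (h : p * X - X * p = L) (r : ℕ) :
    p * X ^ r - X ^ r * p = ∑ i ∈ range r, X ^ i * L * X ^ (r - 1 - i) := by
  induction r with
  | zero => simp
  | succ r ih =>
    have h1 : ∀ i ∈ range r, X ^ i * L * X ^ (r + 1 - 1 - i) =
        (X ^ i * L * X ^ (r - 1 - i)) * X := by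
      intro i hi
      have := mem_range.1 hi
      rw [mul_assoc _ _ X, ← pow_succ]
      congr 2
      omega
    rw [sum_range_succ, sum_congr rfl h1, ← sum_mul, ← ih, Nat.add_sub_cancel, Nat.sub_self,
      pow_zero, mul_one, ← h, pow_succ]
    noncomm_ring

theorem mul_serreSum_sub {p X Y L : E} (v : k) (s : ℕ) (h : p * X - X * p = L)
    (hY : p * Y = Y * p) :
    p * serreSum v s X Y - serreSum v s X Y * p = serreDeriv v s X Y L := by
  rw [serreSum, serreDeriv, mul_sum, sum_mul, ← sum_sub_distrib]
  refine sum_congr rfl fun r _ => ?_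
  rw [mul_smul_comm, smul_mul_assoc, ← smul_sub, ← mul_pow_sub_pow_mul h, ← mul_pow_sub_pow_mul h]
  congr 1
  have : p * (X ^ r * Y * X ^ (s + 1 - r)) - X ^ r * Y * X ^ (s + 1 - r) * p =
      (p * X ^ r - X ^ r * p) * Y * X ^ (s + 1 - r) + X ^ r * (p * Y - Y * p) * X ^ (s + 1 - r) +
        X ^ r * Y * (p * X ^ (s + 1 - r) - X ^ (s + 1 - r) * p) := by noncomm_ring
  rw [this, hY, sub_self, mul_zero, zero_mul, add_zero]

theorem mul_serreSum_sub_partner {p X Y L : E} (v : k) (s : ℕ) (h : p * X = X * p)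
    (hY : p * Y - Y * p = L) :
    p * serreSum v s X Y - serreSum v s X Y * p = serreSum v s X L := by
  rw [serreSum, serreSum, mul_sum, sum_mul, ← sum_sub_distrib]
  refine sum_congr rfl fun r _ => ?_
  rw [mul_smul_comm, smul_mul_assoc, ← smul_sub, ← hY]
  congr 1
  have h1 : p * X ^ r = X ^ r * p := ((Commute.pow_right (show Commute p X from h) r)).eq
  have h2 : p * X ^ (s + 1 - r) = X ^ (s + 1 - r) * p :=
    ((Commute.pow_right (show Commute p X from h) _)).eq
  rw [← mul_assoc, ← mul_assoc, h1, mul_assoc _ (X ^ (s + 1 - r)) p, ← h2]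
  noncomm_ring

theorem serreDeriv_sub (v : k) (s : ℕ) (X Y L L' : E) :
    serreDeriv v s X Y (L - L') = serreDeriv v s X Y L - serreDeriv v s X Y L' := by
  rw [serreDeriv, serreDeriv, serreDeriv, ← sum_sub_distrib]
  refine sum_congr rfl fun r _ => ?_
  rw [← smul_sub]
  congr 1
  simp only [mul_sub, sub_mul, sum_sub_distrib]
  abel

theorem serreDeriv_smul (v : k) (s : ℕ) (X Y : E) (c : k) (L : E) :
    serreDeriv v s X Y (c • L) = c • serreDeriv v s X Y L := by
  simp only [serreDeriv, mul_smul_comm, smul_mul_assoc, ← smul_sum, ← smul_add]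
  rw [smul_sum]
  exact sum_congr rfl fun r _ => smul_comm _ _ _

theorem serreDeriv_mul_central (v : k) (s : ℕ) (X Y : E) {g : E} (hg : ∀ z, g * z = z * g) (L : E) :
    serreDeriv v s X Y (g * L) = g * serreDeriv v s X Y L := by
  have h1 : ∀ z w : E, z * (g * w) = g * (z * w) := fun z w => by
    rw [← mul_assoc, ← hg, mul_assoc]
  simp only [serreDeriv, mul_sum, sum_mul, mul_smul_comm, mul_add, mul_assoc, h1]

theorem serreDeriv_sum {ι : Type*} (v : k) (s : ℕ) (X Y : E) (t : Finset ι) (L : ι → E) :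
    serreDeriv v s X Y (∑ b ∈ t, L b) = ∑ b ∈ t, serreDeriv v s X Y (L b) := by
  classical
  have h0 : serreDeriv v s X Y 0 = 0 := by simp [serreDeriv]
  have hadd : ∀ a b, serreDeriv v s X Y (a + b) = serreDeriv v s X Y a + serreDeriv v s X Y b := by
    intro a b
    have := serreDeriv_sub v s X Y a (-b)
    have h2 := serreDeriv_sub v s X Y 0 b
    rw [sub_neg_eq_add] at this
    rw [zero_sub, h0, zero_sub] at h2
    rw [this, h2, sub_neg_eq_add]
  induction t using Finset.induction_on with
  | empty => simp [h0]
  | insert a t ha ih => rw [sum_insert ha, sum_insert ha, hadd, ih]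

theorem serreSum_sub (v : k) (s : ℕ) (X L L' : E) :
    serreSum v s X (L - L') = serreSum v s X L - serreSum v s X L' := by
  simp only [serreSum, mul_sub, sub_mul, smul_sub, sum_sub_distrib]

theorem serreSum_smul (v : k) (s : ℕ) (X : E) (c : k) (L : E) :
    serreSum v s X (c • L) = c • serreSum v s X L := by
  simp only [serreSum, mul_smul_comm, smul_mul_assoc]
  rw [smul_sum]
  exact sum_congr rfl fun r _ => smul_comm _ _ _

theorem serreSum_mul_central (v : k) (s : ℕ) (X : E) {g : E} (hg : ∀ z, g * z = z * g) (L : E) :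
    serreSum v s X (g * L) = g * serreSum v s X L := by
  have h1 : ∀ z w : E, z * (g * w) = g * (z * w) := fun z w => by
    rw [← mul_assoc, ← hg, mul_assoc]
  simp only [serreSum, mul_sum, mul_smul_comm, mul_assoc, h1]

section Vanishing

variable {v : k} (hv : NotRootOfUnity v) (h2 : (2 : k) ≠ 0) {s : ℕ} {θ : PowerSeries E}
include hv h2

theorem serreDeriv_coeffInt {x y : ℤ → E} (hxx : QuadRel x x (v ^ 2))
    (hxy : QuadRel x y (v ^ s)⁻¹) (hθx : TwistRel θ x (v ^ 2)) (hθy : TwistRel θ y (v ^ s)⁻¹)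
    (m l n : ℤ) : serreDeriv v s (x m) (y l) (coeffInt θ n) = 0 := by
  have hQ : v ^ 2 ≠ 0 := pow_ne_zero _ hv.1
  have hR : (v ^ s)⁻¹ ≠ 0 := inv_ne_zero (pow_ne_zero _ hv.1)
  set a := current x (v ^ 2) m
  set b := PowerSeries.X * current x (v ^ 2) (m + 1)
  set c := current y (v ^ s)⁻¹ l
  set e := PowerSeries.X * current y (v ^ s)⁻¹ (l + 1)
  have hX : PowerSeries.C (x m) = v ^ 2 • a - b := C_eq_current hQ x m
  have hY : PowerSeries.C (y l) = (v ^ s)⁻¹ • c - e := C_eq_current hR y l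
  have hXθ : PowerSeries.C (x m) * θ = θ * (a - v ^ 2 • b) := hθx m
  have hYθ : PowerSeries.C (y l) * θ = θ * (c - (v ^ s)⁻¹ • e) := hθy l
  have hpow : ∀ i, PowerSeries.C (x m) ^ i * θ = θ * (a - v ^ 2 • b) ^ i := by
    intro i
    induction i with
    | zero => simp
    | succ i ih => rw [pow_succ, mul_assoc, hXθ, ← mul_assoc, ih, mul_assoc, ← pow_succ]
  have hid := serre_identity_self hv s (hxx.current_self h2 (v ^ 2) m)
    (hxy.current_pair (v ^ 2) (v ^ s)⁻¹ m l)
  rw [← hX, ← hY] at hid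
  have hser : serreDeriv v s (PowerSeries.C (x m)) (PowerSeries.C (y l)) θ = 0 := by
    rw [← mul_zero θ, ← hid, serreDeriv, mul_sum]
    refine sum_congr rfl fun r _ => ?_
    rw [mul_smul_comm]
    congr 1
    simp only [hpow, mul_add, mul_sum, sum_mul, mul_assoc]
    congr 1
    refine sum_congr rfl fun i _ => ?_
    rw [← mul_assoc (PowerSeries.C (y l)), hYθ, mul_assoc θ, ← mul_assoc _ θ, hpow]
    simp only [mul_assoc]
    rfl
  have hcoeff : ∀ n : ℕ, serreDeriv v s (x m) (y l) (PowerSeries.coeff n θ) =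
      PowerSeries.coeff n (serreDeriv v s (PowerSeries.C (x m)) (PowerSeries.C (y l)) θ) := by
    intro n
    simp only [serreDeriv, map_sum, coeff_field_smul, map_add, sum_mul, mul_sum, ← map_pow,
      mul_assoc, ← map_mul, PowerSeries.coeff_C_mul, PowerSeries.coeff_mul_C]
  unfold coeffInt
  split_ifs
  · rw [hcoeff, hser, map_zero]
  · simp [serreDeriv]

theorem serreSum_coeffInt {x : ℤ → E} (hxx : QuadRel x x (v ^ 2))
    (hθx : TwistRel θ x (v ^ s)⁻¹) (m n : ℤ) : serreSum v s (x m) (coeffInt θ n) = 0 := by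
  have hR : (v ^ s)⁻¹ ≠ 0 := inv_ne_zero (pow_ne_zero _ hv.1)
  set a := current x (v ^ s)⁻¹ m
  set b := PowerSeries.X * current x (v ^ s)⁻¹ (m + 1)
  have hX : PowerSeries.C (x m) = (v ^ s)⁻¹ • a - b := C_eq_current hR x m
  have hXθ : PowerSeries.C (x m) * θ = θ * (a - (v ^ s)⁻¹ • b) := hθx m
  have hpow : ∀ i, PowerSeries.C (x m) ^ i * θ = θ * (a - (v ^ s)⁻¹ • b) ^ i := by
    intro i
    induction i with
    | zero => simp
    | succ i ih => rw [pow_succ, mul_assoc, hXθ, ← mul_assoc, ih, mul_assoc, ← pow_succ]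
  have hid := serre_identity_partner hv s (hxx.current_self h2 (v ^ s)⁻¹ m)
  rw [← hX] at hid
  have hser : serreSum v s (PowerSeries.C (x m)) θ = 0 := by
    rw [← mul_zero θ, ← hid, serreSum, mul_sum]
    refine sum_congr rfl fun r _ => ?_
    rw [mul_smul_comm, hpow, mul_assoc]
  have hcoeff : ∀ n : ℕ, serreSum v s (x m) (PowerSeries.coeff n θ) =
      PowerSeries.coeff n (serreSum v s (PowerSeries.C (x m)) θ) := by
    intro n
    simp only [serreSum, map_sum, coeff_field_smul, ← map_pow,
      PowerSeries.coeff_C_mul, PowerSeries.coeff_mul_C]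
  unfold coeffInt
  split_ifs
  · rw [hcoeff, hser, map_zero]
  · simp [serreSum]

end Vanishing

section Polarization

variable {n : ℕ}

/-- The word `z_0 ⋯ z_{r-1} Y z_r ⋯ z_{n-1}`. -/
def insertWord (z : Fin n → E) (Y : E) (r : ℕ) : E :=
  (((List.finRange n).take r).map z).prod * Y * (((List.finRange n).drop r).map z).prod

theorem insertWord_const (X Y : E) {r : ℕ} (hr : r ≤ n) :
    insertWord (fun _ : Fin n => X) Y r = X ^ r * Y * X ^ (n - r) := by
  simp [insertWord, hr]

theorem insertWord_eq_prod (z : Fin n → E) (Y : E) (r : ℕ) (hr : r ≤ n) :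
    insertWord z Y r = (List.ofFn fun i : Fin n => (if (i : ℕ) = r then Y else 1) * z i).prod *
      (if r = n then Y else 1) := by
  set u : Fin n → E := fun i => (if (i : ℕ) = r then Y else 1) * z i with hu
  have h1 : ((List.finRange n).take r).map z = ((List.finRange n).take r).map u := by
    refine List.map_congr_left fun i hi => ?_
    obtain ⟨j, hj, rfl⟩ := List.mem_take_iff_getElem.1 hi
    have hj' : j < r := by simp at hj; omega
    simp [hu, hj'.ne]
  have h2 : ((List.finRange n).drop (r + 1)).map z = ((List.finRange n).drop (r + 1)).map u := by
    refine List.map_congr_left fun i hi => ?_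
    obtain ⟨j, hj, rfl⟩ := List.mem_drop_iff_getElem.1 hi
    have hj' : r + 1 + j ≠ r := by omega
    simp [hu, hj']
  rw [insertWord, List.ofFn_eq_map, ← List.take_append_drop r (List.finRange n), List.map_append,
    List.prod_append, ← h1, List.take_append_drop]
  rcases hr.lt_or_eq with hlt | rfl
  · rw [if_neg hlt.ne, mul_one, mul_assoc]
    congr 1
    rw [List.drop_eq_getElem_cons (by simpa using hlt), List.map_cons, List.map_cons, h2]
    simp [hu, mul_assoc]
  · rw [List.drop_eq_nil_of_le (by simp)]
    simp

theorem insertWord_sum (z : Fin n → E) (Y : E) {r : ℕ} (hr : r ≤ n) (U : Finset (Fin n)) :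
    insertWord (fun _ : Fin n => ∑ t ∈ U, z t) Y r =
      ∑ f ∈ Fintype.piFinset fun _ : Fin n => U, insertWord (fun i => z (f i)) Y r := by
  simp only [insertWord_eq_prod _ _ _ hr, mul_sum]
  rw [← sum_mul]
  congr 1
  have := (MultilinearMap.mkPiAlgebraFin ℤ n E).map_sum_finset
    (fun (i : Fin n) (t : Fin n) => (if (i : ℕ) = r then Y else 1) * z t) (fun _ => U)
  simpa only [MultilinearMap.mkPiAlgebraFin_apply] using this

theorem sum_perm_eq_polarization (F : (Fin n → Fin n) → E) :
    ∑ σ : Equiv.Perm (Fin n), F σ =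
      ∑ U : Finset (Fin n), (-1 : ℤ) ^ U.card •
        ∑ f ∈ Fintype.piFinset fun _ : Fin n => Uᶜ, F f := by
  classical
  have h1 : ∀ U : Finset (Fin n), (∑ f ∈ Fintype.piFinset fun _ : Fin n => Uᶜ, F f) =
      ∑ f : Fin n → Fin n, if U ⊆ (univ.image f)ᶜ then F f else 0 := by
    intro U
    rw [← sum_filter]
    refine sum_congr ?_ fun _ _ => rfl
    ext f
    simp only [Fintype.mem_piFinset, mem_compl, mem_filter, mem_univ, true_and, subset_iff,
      mem_image, not_exists]
    exact ⟨fun h u hu x hx => h x (hx ▸ hu), fun h i hi => h hi i rfl⟩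
  simp only [h1, smul_sum]
  rw [sum_comm]
  have h3 : ∀ f : Fin n → Fin n,
      (∑ U : Finset (Fin n), (-1 : ℤ) ^ U.card • if U ⊆ (univ.image f)ᶜ then F f else 0) =
        if Function.Bijective f then F f else 0 := by
    intro f
    simp only [smul_ite, smul_zero]
    rw [← sum_filter]
    have : (univ.filter fun U : Finset (Fin n) => U ⊆ (univ.image f)ᶜ) =
        ((univ.image f)ᶜ).powerset := by ext; simp
    rw [this, ← sum_smul, sum_powerset_neg_one_pow_card]
    have hb : (univ.image f)ᶜ = ∅ ↔ Function.Bijective f := by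
      rw [compl_eq_empty_iff, ← Finite.surjective_iff_bijective, Finset.eq_univ_iff_forall]
      simp [Function.Surjective]
    simp only [hb]
    split_ifs <;> simp
  rw [sum_congr rfl fun f _ => h3 f, ← sum_filter]
  refine sum_bij (fun σ _ => (σ : Fin n → Fin n)) ?_ ?_ ?_ ?_
  · intro σ _; exact mem_filter.2 ⟨mem_univ _, σ.bijective⟩
  · intro σ _ τ _ h; exact DFunLike.coe_injective h
  · intro f hf
    exact ⟨Equiv.ofBijective f (mem_filter.1 hf).2, mem_univ _, rfl⟩
  · intro σ _; rfl

/-- Polarization of the Drinfeld-Serre element. -/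
theorem sum_perm_insertWord (v : k) (s : ℕ) (z : Fin (s + 1) → E) (Y : E) :
    ∑ σ : Equiv.Perm (Fin (s + 1)), ∑ r ∈ range (s + 1 + 1),
      ((-1) ^ r * qnumBinom v (s + 1) r) • insertWord (fun t => z (σ t)) Y r =
    ∑ U : Finset (Fin (s + 1)), (-1 : ℤ) ^ U.card • serreSum v s (∑ t ∈ Uᶜ, z t) Y := by
  rw [sum_perm_eq_polarization fun f => ∑ r ∈ range (s + 1 + 1),
      ((-1) ^ r * qnumBinom v (s + 1) r) • insertWord (fun t => z (f t)) Y r]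
  refine sum_congr rfl fun U _ => ?_
  rw [serreSum, sum_comm]
  congr 1
  refine sum_congr rfl fun r hr => ?_
  have hr' : r ≤ s + 1 := by have := mem_range.1 hr; omega
  rw [← insertWord_const _ _ hr', insertWord_sum z Y hr', smul_sum]

end Polarization

end SerreElement

section Commutators

variable {k : Type*} [Field k] {E : Type*} [Ring E] [Algebra k E]

theorem QuadRel.symm {x y : ℤ → E} {R : k} (h : QuadRel x y R) : QuadRel y x R := by
  intro m l
  have := h l m
  rw [sub_eq_sub_iff_add_eq_add] at this ⊢
  rw [add_comm, this, add_comm]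

theorem QuadRel.sub_left {x x' y : ℤ → E} {R : k} (h : QuadRel x y R) (h' : QuadRel x' y R) :
    QuadRel (fun m => x m - x' m) y R := by
  intro m l
  have := congrArg₂ (· - ·) (h m l) (h' m l)
  simp only [sub_mul, mul_sub, smul_sub] at this ⊢
  rw [sub_sub_sub_comm, this, sub_sub_sub_comm]

theorem QuadRel.smul_left {x y : ℤ → E} {R : k} (c : k) (h : QuadRel x y R) :
    QuadRel (fun m => c • x m) y R := by
  intro m l
  have := congrArg (c • ·) (h m l)
  simp only [smul_sub, smul_comm c R] at this
  simpa only [smul_mul_assoc, mul_smul_comm] using this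

theorem QuadRel.mul_central_left {x y : ℤ → E} {R : k} {g : E} (hg : ∀ z, g * z = z * g)
    (h : QuadRel x y R) : QuadRel (fun m => g * x m) y R := by
  intro m l
  have := congrArg (g * ·) (h m l)
  have h1 : ∀ z w : E, z * (g * w) = g * (z * w) := fun z w => by
    rw [← mul_assoc, ← hg, mul_assoc]
  simp only [mul_sub, mul_smul_comm] at this
  simpa only [mul_assoc, h1] using this

theorem QuadRel.shift_left {x y : ℤ → E} {R : k} (h : QuadRel x y R) (n : ℤ) :
    QuadRel (fun m => x (n + m)) y R := by
  intro m l
  have := h (n + m) l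
  rwa [add_assoc] at this

theorem quadRel_zero_left (y : ℤ → E) (R : k) : QuadRel (fun _ => 0) y R := by
  intro m l
  simp

/-- The two Cartan series `θ`, `θ'` (in `w` and in `w⁻¹`) have the commutation relations with
the family `x` governed by `R`. -/
structure CartanRel (θ θ' : PowerSeries E) (x : ℤ → E) (R : k) : Prop where
  pos : TwistRel θ x R
  neg : TwistRel θ' (fun m => x (-m)) R⁻¹

/-- The value of `[x⁺_{i,n}, x⁻_{i,m}]` in terms of two Cartan series. -/
def cartanValue (c : k) (g g' : E) (θ θ' : PowerSeries E) (n m : ℤ) : E :=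
  c • (g * coeffInt θ (n + m) - g' * coeffInt θ' (-(n + m)))

theorem CartanRel.quadRel {θ θ' : PowerSeries E} {x : ℤ → E} {R : k} (hR : R ≠ 0)
    (h : CartanRel θ θ' x R) (c : k) {g g' : E} (hg : ∀ z, g * z = z * g)
    (hg' : ∀ z, g' * z = z * g') (n : ℤ) : QuadRel (cartanValue c g g' θ θ' n) x R := by
  have h1 : QuadRel (coeffInt θ) x R := fun m l => h.pos.quad hR m l
  have h2 : QuadRel (coeffInt θ') (fun m => x (-m)) R⁻¹ :=
    fun m l => h.neg.quad (inv_ne_zero hR) m l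
  have h3 : QuadRel (fun m => coeffInt θ' (-m)) x R := by
    have := h2.reverse (inv_ne_zero hR)
    simpa only [neg_neg, inv_inv] using this
  exact (((h1.shift_left n).mul_central_left hg).sub_left
    ((h3.shift_left n).mul_central_left hg')).smul_left c

/-- An element commutes with the quadratic relations if the commutators satisfy them. -/
theorem commute_quad {p : E} {x y Lx Ly : ℤ → E} {R : k}
    (hx : ∀ m, p * x m - x m * p = Lx m) (hy : ∀ m, p * y m - y m * p = Ly m)
    (h1 : QuadRel Lx y R) (h2 : QuadRel x Ly R) (m l : ℤ) :
    Commute p (x (m + 1) * y l - R • (y l * x (m + 1)) -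
      (R • (x m * y (l + 1)) - y (l + 1) * x m)) := by
  have e1 : ∀ m l, p * (x m * y l) - x m * y l * p = Lx m * y l + x m * Ly l := fun m l => by
    rw [← hx, ← hy]; noncomm_ring
  have e2 : ∀ m l, p * (y l * x m) - y l * x m * p = y l * Lx m + Ly l * x m := fun m l => by
    rw [← hx, ← hy]; noncomm_ring
  refine sub_eq_zero.1 ?_
  have h3 : p * (x (m + 1) * y l - R • (y l * x (m + 1)) -
        (R • (x m * y (l + 1)) - y (l + 1) * x m)) -
      (x (m + 1) * y l - R • (y l * x (m + 1)) -
        (R • (x m * y (l + 1)) - y (l + 1) * x m)) * p =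
      (p * (x (m + 1) * y l) - x (m + 1) * y l * p) -
        R • (p * (y l * x (m + 1)) - y l * x (m + 1) * p) -
        (R • (p * (x m * y (l + 1)) - x m * y (l + 1) * p) -
          (p * (y (l + 1) * x m) - y (l + 1) * x m * p)) := by
    simp only [mul_sub, sub_mul, smul_sub, mul_smul_comm, smul_mul_assoc]
    abel
  rw [h3, e1, e1, e2, e2]
  have a1 := sub_eq_zero.2 (h1 m l)
  have a2 := sub_eq_zero.2 (h2 m l)
  rw [← add_zero (0 : E)]
  nth_rewrite 1 [← a1]
  rw [← a2]
  simp only [smul_add]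
  abel

variable {v : k} (hv : NotRootOfUnity v) (h2 : (2 : k) ≠ 0) {s : ℕ} {θ θ' : PowerSeries E}
  {x y : ℤ → E} {p g g' : E} (hg : ∀ z, g * z = z * g) (hg' : ∀ z, g' * z = z * g') {c : k} {n : ℤ}
include hv h2 hg hg'

omit hv h2 hg hg' in
theorem serreSum_inv (X Y : E) : serreSum v⁻¹ s X Y = serreSum v s X Y := by
  simp only [serreSum, qnumBinom_inv]

/-- An element commuting with `y` up to Cartan series of the type of `x` commutes with the
Drinfeld-Serre element. -/
theorem commute_serre_self (hxx : QuadRel x x (v ^ 2)) (hxy : QuadRel x y (v ^ s)⁻¹)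
    (hθx : CartanRel θ θ' x (v ^ 2)) (hθy : CartanRel θ θ' y (v ^ s)⁻¹)
    (hx : ∀ m, p * x m - x m * p = cartanValue c g g' θ θ' n m) (hy : ∀ m, p * y m = y m * p)
    (ks : Fin (s + 1) → ℤ) (l : ℤ) :
    Commute p (∑ σ : Equiv.Perm (Fin (s + 1)), ∑ r ∈ range (s + 1 + 1),
      ((-1) ^ r * qnumBinom v (s + 1) r) • insertWord (fun t => x (ks (σ t))) (y l) r) := by
  rw [sum_perm_insertWord v s (fun t => x (ks t))]
  refine Commute.sum_right _ _ _ fun U _ => Commute.smul_right ?_ _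
  refine sub_eq_zero.1 ?_
  set X := ∑ t ∈ Uᶜ, x (ks t) with hX
  have hL : p * X - X * p = ∑ t ∈ Uᶜ, cartanValue c g g' θ θ' n (ks t) := by
    rw [hX, mul_sum, sum_mul, ← sum_sub_distrib]
    exact sum_congr rfl fun t _ => hx _
  rw [mul_serreSum_sub v s hL (hy l), serreDeriv_sum]
  refine sum_eq_zero fun t _ => ?_
  rw [cartanValue, serreDeriv_smul, serreDeriv_sub, serreDeriv_mul_central _ _ _ _ hg,
    serreDeriv_mul_central _ _ _ _ hg']
  have h3 : serreDeriv v s X (y l) (coeffInt θ (n + ks t)) = 0 := by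
    have := serreDeriv_coeffInt hv h2 (hxx.translateSum_self Uᶜ ks) (hxy.translateSum Uᶜ ks)
      (hθx.pos.translateSum Uᶜ ks) hθy.pos 0 l (n + ks t)
    simpa only [translateSum, zero_add] using this
  have h4 : serreDeriv v s X (y l) (coeffInt θ' (-(n + ks t))) = 0 := by
    have hv2 : v ^ 2 ≠ 0 := pow_ne_zero _ hv.1
    have hvs : (v ^ s)⁻¹ ≠ 0 := inv_ne_zero (pow_ne_zero _ hv.1)
    have i1 : (v ^ 2)⁻¹ = (v⁻¹) ^ 2 := (inv_pow v 2).symm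
    have i2 : ((v ^ s)⁻¹)⁻¹ = ((v⁻¹) ^ s)⁻¹ := by rw [inv_pow]
    have j1 := hxx.reverse hv2
    have j2 := hxy.reverse hvs
    have j3 := hθx.neg
    have j4 := hθy.neg
    rw [i1] at j1 j3
    rw [i2] at j2 j4
    have := serreDeriv_coeffInt hv.inv h2 (j1.translateSum_self Uᶜ fun t => -ks t)
      (j2.translateSum Uᶜ fun t => -ks t) (j3.translateSum Uᶜ fun t => -ks t) j4 0 (-l)
      (-(n + ks t))
    simp only [serreDeriv, qnumBinom_inv] at this ⊢
    simpa only [translateSum, zero_add, neg_neg] using this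
  rw [h3, h4, mul_zero, mul_zero, sub_zero, smul_zero]

/-- An element commuting with `x` up to Cartan series of the type of `y` commutes with the
Drinfeld-Serre element. -/
theorem commute_serre_partner (hxx : QuadRel x x (v ^ 2))
    (hθx : CartanRel θ θ' x (v ^ s)⁻¹)
    (hy : ∀ m, p * y m - y m * p = cartanValue c g g' θ θ' n m) (hx : ∀ m, p * x m = x m * p)
    (ks : Fin (s + 1) → ℤ) (l : ℤ) :
    Commute p (∑ σ : Equiv.Perm (Fin (s + 1)), ∑ r ∈ range (s + 1 + 1),
      ((-1) ^ r * qnumBinom v (s + 1) r) • insertWord (fun t => x (ks (σ t))) (y l) r) := by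
  rw [sum_perm_insertWord v s (fun t => x (ks t))]
  refine Commute.sum_right _ _ _ fun U _ => Commute.smul_right ?_ _
  refine sub_eq_zero.1 ?_
  set X := ∑ t ∈ Uᶜ, x (ks t) with hX
  have hL : p * X = X * p := by
    rw [hX, mul_sum, sum_mul]
    exact sum_congr rfl fun t _ => hx _
  rw [mul_serreSum_sub_partner v s hL (hy l), cartanValue, serreSum_smul, serreSum_sub,
    serreSum_mul_central _ _ _ hg, serreSum_mul_central _ _ _ hg']
  have h3 : serreSum v s X (coeffInt θ (n + l)) = 0 := by
    have := serreSum_coeffInt hv h2 (hxx.translateSum_self Uᶜ ks)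
      (hθx.pos.translateSum Uᶜ ks) 0 (n + l)
    simpa only [translateSum, zero_add] using this
  have h4 : serreSum v s X (coeffInt θ' (-(n + l))) = 0 := by
    have hv2 : v ^ 2 ≠ 0 := pow_ne_zero _ hv.1
    have i1 : (v ^ 2)⁻¹ = (v⁻¹) ^ 2 := (inv_pow v 2).symm
    have i2 : ((v ^ s)⁻¹)⁻¹ = ((v⁻¹) ^ s)⁻¹ := by rw [inv_pow]
    have j1 := hxx.reverse hv2
    have j3 := hθx.neg
    rw [i1] at j1
    rw [i2] at j3
    have := serreSum_coeffInt hv.inv h2 (j1.translateSum_self Uᶜ fun t => -ks t)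
      (j3.translateSum Uᶜ fun t => -ks t) 0 (-(n + l))
    rw [serreSum_inv] at this
    simpa only [translateSum, zero_add, neg_neg] using this
  rw [h3, h4, mul_zero, mul_zero, sub_zero, smul_zero]

end Commutators

section ExpSequences

variable {k : Type*} [Field k] [CharZero k] {E : Type*} [Ring E] [Algebra k E]

/-- `∑ S_n w^n` is the exponential of `∑_{a>0} (H_a / a) w^a`, in the sense that it satisfies the
corresponding differential equation. -/
structure IsExpSeq (k : Type*) [Field k] {E : Type*} [Ring E] [Algebra k E] (H S : ℕ → E) :
    Prop where
  zero : S 0 = 1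
  deriv : ∀ n : ℕ, (n : k) • S n = ∑ p ∈ antidiagonal n, H p.1 * S p.2

/-- The Taylor coefficients of `(1 - β w) / (1 - α w)`. -/
def ratioCoeff (α β : k) : ℕ → k
  | 0 => 1
  | s + 1 => α ^ s * (α - β)

omit [CharZero k] in
theorem sum_ratioCoeff (α β : k) (u : ℕ) :
    ∑ p ∈ antidiagonal u, (α ^ p.1 - β ^ p.1) * ratioCoeff α β p.2 = u * ratioCoeff α β u := by
  rcases u with _ | u
  · simp
  rw [Nat.sum_antidiagonal_succ', Nat.sum_antidiagonal_eq_sum_range_succ_mk]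
  simp only [ratioCoeff]
  have h1 : ∑ i ∈ range u.succ, (α ^ i - β ^ i) * (α ^ (u - i) * (α - β)) =
      (u + 1) * (α ^ u * (α - β)) - (α ^ (u + 1) - β ^ (u + 1)) := by
    rw [← (Commute.all α β).geom_sum₂_mul (u + 1), ← sum_range_reflect, sum_mul,
      Nat.succ_eq_add_one,
      show ((u : k) + 1) * (α ^ u * (α - β)) = ∑ i ∈ range (u + 1), α ^ u * (α - β) by simp,
      ← sum_sub_distrib]
    refine sum_congr rfl fun i hi => ?_
    have hi' : i ≤ u := by simpa [Nat.lt_succ_iff] using hi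
    rw [show u + 1 - 1 - i = u - i by omega, show u - (u - i) = i by omega]
    rw [show α ^ u = α ^ (u - i) * α ^ i by rw [← pow_add]; congr 1; omega]
    ring
  rw [h1]
  push_cast
  ring

omit [CharZero k] in
theorem IsExpSeq.scale {H S : ℕ → E} (h : IsExpSeq k H S) {u : E} (hu : ∀ z, u * z = z * u) :
    IsExpSeq k (fun n => u ^ n * H n) (fun n => u ^ n * S n) := by
  have hc : ∀ n z, u ^ n * z = z * u ^ n := fun n z => (Commute.pow_left (hu z) n).eq
  refine ⟨by simp [h.zero], fun n => ?_⟩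
  rw [← mul_smul_comm, h.deriv n, mul_sum]
  refine sum_congr rfl fun p hp => ?_
  rw [← HasAntidiagonal.mem_antidiagonal.1 hp, pow_add, mul_assoc, mul_assoc, ← mul_assoc _ (H p.1),
    hc p.2 (H p.1),
    mul_assoc]

omit [Field k] [CharZero k] [Ring E] [Algebra k E] in
theorem sum_antidiagonal_assoc {M : Type*} [AddCommMonoid M] (n : ℕ) (f : ℕ → ℕ → ℕ → M) :
    ∑ p ∈ antidiagonal n, ∑ r ∈ antidiagonal p.2, f p.1 r.1 r.2 =
      ∑ p ∈ antidiagonal n, ∑ r ∈ antidiagonal p.1, f r.1 r.2 p.2 := by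
  rw [sum_sigma', sum_sigma']
  refine sum_nbij' (fun a => ⟨(a.1.1 + a.2.1, a.2.2), (a.1.1, a.2.1)⟩)
    (fun a => ⟨(a.2.1, a.2.2 + a.1.2), (a.2.2, a.1.2)⟩) ?_ ?_ ?_ ?_ ?_
  all_goals
    rintro ⟨⟨a, b⟩, ⟨c, e⟩⟩ h
    simp only [mem_sigma, HasAntidiagonal.mem_antidiagonal] at h
    obtain ⟨rfl, rfl⟩ := h
    simp [add_assoc]

theorem IsExpSeq.mul_eq {H S : ℕ → E} (hS : IsExpSeq k H S) {x : ℤ → E} (α β : k)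
    (hx : ∀ (a : ℕ) m, x m * H a = H a * x m + (α ^ a - β ^ a) • x (m + a)) (n : ℕ) :
    ∀ m, x m * S n = ∑ p ∈ antidiagonal n, ratioCoeff α β p.2 • (S p.1 * x (m + p.2)) := by
  induction n using Nat.strong_induction_on with
  | _ n ih =>
  intro m
  rcases Nat.eq_zero_or_pos n with rfl | hn
  · simp [hS.zero, ratioCoeff]
  have hn' : (n : k) ≠ 0 := Nat.cast_ne_zero.2 hn.ne'
  have hH : H 0 = 0 := by
    have := hS.deriv 0
    simpa [hS.zero] using this.symm
  have key : (n : k) • (x m * S n) = (n : k) •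
      ∑ p ∈ antidiagonal n, ratioCoeff α β p.2 • (S p.1 * x (m + p.2)) := by
    rw [← mul_smul_comm, hS.deriv, mul_sum]
    have h2 : ∀ p ∈ antidiagonal n, x m * (H p.1 * S p.2) =
        ∑ r ∈ antidiagonal p.2, ratioCoeff α β r.2 • (H p.1 * S r.1 * x (m + r.2)) +
        ∑ r ∈ antidiagonal p.2, ((α ^ p.1 - β ^ p.1) * ratioCoeff α β r.2) •
          (S r.1 * x (m + (p.1 + r.2 : ℕ))) := by
      intro p hp
      rcases Nat.eq_zero_or_pos p.1 with h0 | h0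
      · simp [h0, hH]
      have hlt : p.2 < n := by have := HasAntidiagonal.mem_antidiagonal.1 hp; omega
      rw [← mul_assoc, hx, add_mul, mul_assoc, ih _ hlt, smul_mul_assoc, ih _ hlt, mul_sum,
        smul_sum]
      congr 1
      · exact sum_congr rfl fun r _ => by rw [mul_smul_comm, mul_assoc]
      · refine sum_congr rfl fun r _ => ?_
        rw [smul_smul, Nat.cast_add, add_assoc]
    rw [sum_congr rfl h2, sum_add_distrib]
    have h3 : ∑ p ∈ antidiagonal n,
        ∑ r ∈ antidiagonal p.2, ratioCoeff α β r.2 • (H p.1 * S r.1 * x (m + r.2)) =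
        ∑ p ∈ antidiagonal n, (p.1 : k) • ratioCoeff α β p.2 • (S p.1 * x (m + p.2)) := by
      rw [sum_antidiagonal_assoc n fun a t s => ratioCoeff α β s • (H a * S t * x (m + s))]
      refine sum_congr rfl fun p _ => ?_
      rw [← smul_sum, ← sum_mul, ← hS.deriv, smul_comm, smul_mul_assoc]
    have h4 : ∑ p ∈ antidiagonal n,
        ∑ r ∈ antidiagonal p.2, ((α ^ p.1 - β ^ p.1) * ratioCoeff α β r.2) •
          (S r.1 * x (m + (p.1 + r.2 : ℕ))) =
        ∑ p ∈ antidiagonal n, (p.2 : k) • ratioCoeff α β p.2 • (S p.1 * x (m + p.2)) := by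
      have e1 : ∀ p ∈ antidiagonal n, (p.2 : k) • ratioCoeff α β p.2 • (S p.1 * x (m + p.2)) =
          ∑ r ∈ antidiagonal p.2, ((α ^ r.1 - β ^ r.1) * ratioCoeff α β r.2) •
            (S p.1 * x (m + (r.1 + r.2 : ℕ))) := by
        intro p _
        rw [smul_smul, ← sum_ratioCoeff, sum_smul]
        exact sum_congr rfl fun r hr => by rw [HasAntidiagonal.mem_antidiagonal.1 hr]
      rw [sum_congr rfl e1, sum_antidiagonal_assoc n fun a t s =>
        ((α ^ a - β ^ a) * ratioCoeff α β s) • (S t * x (m + (a + s : ℕ))),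
        sum_antidiagonal_assoc n fun t a s =>
        ((α ^ a - β ^ a) * ratioCoeff α β s) • (S t * x (m + (a + s : ℕ)))]
      refine sum_congr rfl fun p _ => ?_
      rw [← Nat.sum_antidiagonal_swap]
      rfl
    rw [h3, h4, ← sum_add_distrib, smul_sum]
    refine sum_congr rfl fun p hp => ?_
    rw [← add_smul, ← Nat.cast_add, HasAntidiagonal.mem_antidiagonal.1 hp]
  exact (smul_right_injective E hn') key

/-- A Cartan series `∑ κ S_n w^n` built from an exponential satisfies the twist relation. -/
theorem IsExpSeq.twistRel {H S : ℕ → E} (hS : IsExpSeq k H S) {x : ℤ → E} {R : k} (hR : R ≠ 0)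
    (hx : ∀ (a : ℕ) m, x m * H a = H a * x m + ((R⁻¹) ^ a - R ^ a) • x (m + a))
    {κ : E} (hκ : ∀ m, x m * κ = R⁻¹ • (κ * x m)) :
    TwistRel (PowerSeries.mk fun n => κ * S n) x R := by
  intro l
  ext n
  rw [PowerSeries.coeff_C_mul, PowerSeries.coeff_mk, ← mul_assoc, hκ, smul_mul_assoc, mul_assoc,
    hS.mul_eq _ _ hx, mul_sum, smul_sum, PowerSeries.coeff_mul]
  refine sum_congr rfl fun p _ => ?_
  rw [PowerSeries.coeff_mk, mul_smul_comm, ← mul_assoc]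
  have : PowerSeries.coeff p.2 (current x R l - R • (PowerSeries.X * current x R (l + 1))) =
      (R⁻¹ * ratioCoeff R⁻¹ R p.2) • x (l + p.2) := by
    rcases p.2 with _ | s
    · simp [current, ratioCoeff]
    · rw [map_sub, coeff_field_smul, PowerSeries.coeff_succ_X_mul, current, current,
        PowerSeries.coeff_mk, PowerSeries.coeff_mk, smul_smul, ratioCoeff, Nat.cast_succ,
        show l + 1 + (s : ℤ) = l + (s + 1) by ring, ← sub_smul]
      congr 1
      rw [pow_succ R⁻¹ s, pow_succ R⁻¹ (s + 1), mul_comm (R⁻¹ ^ s), mul_inv_cancel_left₀ hR]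
      linear_combination R⁻¹ ^ s * inv_mul_cancel₀ hR
  rw [this, smul_smul, mul_smul_comm]

end ExpSequences

section Drinfeld
variable {N : ℕ} (d : Fin N → ℤ) (A : Fin N → Fin N → ℤ)

/-- The defining relations of `U_q(ĝ)` other than the quadratic and the Drinfeld-Serre ones. -/
inductive QRelCore (N : ℕ) (d : Fin N → ℤ) (A : Fin N → Fin N → ℤ) : FA N → FA N → Prop
  | K_Kinv (i : Fin N) : QRelCore N d A (e (K i) * e (Kinv i)) 1
  | Kinv_K (i : Fin N) : QRelCore N d A (e (Kinv i) * e (K i)) 1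
  | D_Dinv : QRelCore N d A (e D * e Dinv) 1
  | Dinv_D : QRelCore N d A (e Dinv * e D) 1
  | g_ginv : QRelCore N d A (e g2 * e g2inv) 1
  | ginv_g : QRelCore N d A (e g2inv * e g2) 1
  | g2_comm (x : Gen N) : QRelCore N d A (e g2 * e x) (e x * e g2)
  | g2inv_comm (x : Gen N) : QRelCore N d A (e g2inv * e x) (e x * e g2inv)
  | K_comm_K (i j : Fin N) : QRelCore N d A (e (K i) * e (K j)) (e (K j) * e (K i))
  | K_comm_D (i : Fin N) : QRelCore N d A (e (K i) * e D) (e D * e (K i))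
  | K_comm_h (i j : Fin N) (s : ℤ) :
      QRelCore N d A (e (K i) * e (h j s)) (e (h j s) * e (K i))
  | h_zero (i : Fin N) : QRelCore N d A (e (h i 0)) 0
  | D_h (i : Fin N) (s : ℤ) :
      QRelCore N d A (e D * e (h i s) * e Dinv) ((qq ^ s) • e (h i s))
  | D_xp (i : Fin N) (r : ℤ) :
      QRelCore N d A (e D * e (xp i r) * e Dinv) ((qq ^ r) • e (xp i r))
  | D_xm (i : Fin N) (r : ℤ) :
      QRelCore N d A (e D * e (xm i r) * e Dinv) ((qq ^ r) • e (xm i r))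
  | K_xp (i j : Fin N) (r : ℤ) :
      QRelCore N d A (e (K i) * e (xp j r) * e (Kinv i)) (qp d A i j • e (xp j r))
  | K_xm (i j : Fin N) (r : ℤ) :
      QRelCore N d A (e (K i) * e (xm j r) * e (Kinv i)) ((qp d A i j)⁻¹ • e (xm j r))
  | h_h (i j : Fin N) (k l : ℤ) (hk : k ≠ 0) (hl : l ≠ 0) :
      QRelCore N d A (e (h i k) * e (h j l) - e (h j l) * e (h i k))
        (if l = -k then
          ((k : Fq)⁻¹ * qint d i (k * A i j) * (qi d j - (qi d j)⁻¹)⁻¹) •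
            (gammaPow k - gammaPow (-k))
         else 0)
  | h_xp (i j : Fin N) (k l : ℤ) (hk : k ≠ 0) :
      QRelCore N d A (e (h i k) * e (xp j l) - e (xp j l) * e (h i k))
        (((k : Fq)⁻¹ * qint d i (k * A i j)) • (gammaHalf (-|k|) * e (xp j (k + l))))
  | h_xm (i j : Fin N) (k l : ℤ) (hk : k ≠ 0) :
      QRelCore N d A (e (h i k) * e (xm j l) - e (xm j l) * e (h i k))
        ((-((k : Fq)⁻¹ * qint d i (k * A i j))) • (gammaHalf |k| * e (xm j (k + l))))
  | xp_xm (i j : Fin N) (k l : ℤ) :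
      QRelCore N d A (e (xp i k) * e (xm j l) - e (xm j l) * e (xp i k))
        (if i = j then
          ((qi d i - (qi d i)⁻¹)⁻¹) •
            (gammaHalf (k - l) * psiEl d i (k + l) - gammaHalf (l - k) * phiEl d i (k + l))
         else 0)

/-- A representation of the core relations in which `γ^{1/2}` is central. -/
structure CoreRep {E : Type*} [Ring E] [Algebra Fq E] (ρ : FA N →ₐ[Fq] E) : Prop where
  rel : ∀ a b, QRelCore N d A a b → ρ a = ρ b
  central : ∀ z, ρ (e g2) * z = z * ρ (e g2)

variable {d A} {E : Type*} [Ring E] [Algebra Fq E] {ρ : FA N →ₐ[Fq] E}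

theorem mul_eq_of_commutator {g g' a x y : E} {c s t : Fq} (hg : ∀ z, g * z = z * g)
    (h : a * x - x * a = s • (g' * y)) (hgg : g * g' = 1) (hc : c * s = -t) :
    x * (g * c • a) = g * c • a * x + t • y := by
  have h1 : a * x = s • (g' * y) + x * a := by rw [← h, sub_add_cancel]
  rw [mul_assoc g, smul_mul_assoc, h1, smul_add, smul_smul, hc, mul_add, ← mul_assoc x, ← hg,
    mul_assoc, mul_smul_comm, mul_smul_comm, mul_smul_comm, ← mul_assoc g g', hgg,
    one_mul, neg_smul, neg_add_cancel_comm]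

theorem CoreRep.of_surjective (hs : Function.Surjective ρ)
    (hρ : ∀ a b, QRelCore N d A a b → ρ a = ρ b) : CoreRep d A ρ := by
  refine ⟨hρ, fun z => ?_⟩
  obtain ⟨a, rfl⟩ := hs z
  induction a using FreeAlgebra.induction with
  | grade0 r => rw [AlgHom.commutes, Algebra.commutes]
  | grade1 x => simpa [e] using hρ _ _ (.g2_comm x)
  | mul a b ha hb => rw [map_mul, ← mul_assoc, ha, mul_assoc, hb, mul_assoc]
  | add a b ha hb => rw [map_add, mul_add, add_mul, ha, hb]

/-- The generator `x^±_{i,r}`. -/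
def gx (pm : Bool) (i : Fin N) (r : ℤ) : Gen N := if pm then xp i r else xm i r

/-- The sign of `x^±`. -/
def sgn (pm : Bool) : ℤ := if pm then 1 else -1

namespace CoreRep

/-- The image of `γ^{1/2}` as a unit. -/
def gu (h : CoreRep d A ρ) : Eˣ where
  val := ρ (e g2)
  inv := ρ (e g2inv)
  val_inv := by simpa using h.rel _ _ .g_ginv
  inv_val := by simpa using h.rel _ _ .ginv_g

/-- The image of `K_i` as a unit. -/
def Ku (h : CoreRep d A ρ) (i : Fin N) : Eˣ where
  val := ρ (e (K i))
  inv := ρ (e (Kinv i))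
  val_inv := by simpa using h.rel _ _ (.K_Kinv i)
  inv_val := by simpa using h.rel _ _ (.Kinv_K i)

variable (h : CoreRep d A ρ)
include h

theorem map_gammaHalf (m : ℤ) : ρ (gammaHalf m) = (h.gu ^ m : Eˣ) := by
  unfold gammaHalf
  split_ifs with hm
  · obtain ⟨n, rfl⟩ := Int.eq_ofNat_of_zero_le hm
    simp [gu]
  · obtain ⟨n, hn⟩ := Int.eq_ofNat_of_zero_le (show 0 ≤ -m by omega)
    obtain rfl : m = -(n : ℤ) := by omega
    simp only [neg_neg, Int.toNat_natCast, map_pow, zpow_neg, zpow_natCast, ← inv_pow,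
      Units.val_pow_eq_pow_val]
    rfl

theorem gu_comm (m : ℤ) (z : E) : ((h.gu ^ m : Eˣ) : E) * z = z * (h.gu ^ m : Eˣ) := by
  have h1 : Commute z (h.gu : E) := (h.central z).symm
  exact (h1.units_zpow_right m).eq.symm

theorem gu_add (m n : ℤ) : ((h.gu ^ m : Eˣ) : E) * (h.gu ^ n : Eˣ) = (h.gu ^ (m + n) : Eˣ) := by
  rw [zpow_add, Units.val_mul]

theorem gu_pow (m : ℤ) (n : ℕ) : ((h.gu ^ m : Eˣ) : E) ^ n = (h.gu ^ (m * n) : Eˣ) := by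
  rw [zpow_mul, ← Units.val_pow_eq_pow_val, zpow_natCast]

theorem gu_comm_pow (m : ℤ) (n : ℕ) (z : E) :
    ((h.gu ^ m : Eˣ) : E) ^ n * z = z * ((h.gu ^ m : Eˣ) : E) ^ n := by
  rw [h.gu_pow, h.gu_comm]

theorem K_mul_x (pm : Bool) (i j : Fin N) (r : ℤ) :
    ρ (e (K i)) * ρ (e (gx pm j r)) = qp d A i j ^ sgn pm • (ρ (e (gx pm j r)) * ρ (e (K i))) := by
  have h1 : ρ (e (K i)) * ρ (e (gx pm j r)) * ρ (e (Kinv i)) =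
      qp d A i j ^ sgn pm • ρ (e (gx pm j r)) := by
    cases pm
    · simpa [gx, sgn] using h.rel _ _ (.K_xm i j r)
    · simpa [gx, sgn] using h.rel _ _ (.K_xp i j r)
  have h2 : ρ (e (Kinv i)) * ρ (e (K i)) = 1 := by simpa using h.rel _ _ (.Kinv_K i)
  rw [← smul_mul_assoc, ← h1, mul_assoc _ (ρ (e (Kinv i))), h2, mul_one]

theorem x_mul_K (pm : Bool) (i j : Fin N) (r : ℤ) :
    ρ (e (gx pm j r)) * ρ (e (K i)) = (qp d A i j ^ sgn pm)⁻¹ •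
      (ρ (e (K i)) * ρ (e (gx pm j r))) := by
  rw [h.K_mul_x, inv_smul_smul₀ (zpow_ne_zero _ (qp_ne_zero d A i j))]

theorem x_mul_Kinv (pm : Bool) (i j : Fin N) (r : ℤ) :
    ρ (e (gx pm j r)) * ρ (e (Kinv i)) =
      qp d A i j ^ sgn pm • (ρ (e (Kinv i)) * ρ (e (gx pm j r))) := by
  have h1 : ρ (e (Kinv i)) * ρ (e (K i)) = 1 := by simpa using h.rel _ _ (.Kinv_K i)
  have h2 : ρ (e (K i)) * ρ (e (Kinv i)) = 1 := by simpa using h.rel _ _ (.K_Kinv i)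
  have := congrArg (fun z => ρ (e (Kinv i)) * z * ρ (e (Kinv i))) (h.K_mul_x pm i j r)
  simp only [mul_smul_comm, smul_mul_assoc, mul_assoc, h2, mul_one] at this
  rw [← mul_assoc, h1, one_mul] at this
  exact this

theorem h_x (pm : Bool) (i j : Fin N) {k : ℤ} (l : ℤ) (hk : k ≠ 0) :
    ρ (e (Gen.h i k)) * ρ (e (gx pm j l)) - ρ (e (gx pm j l)) * ρ (e (Gen.h i k)) =
      ((sgn pm : Fq) * ((k : Fq)⁻¹ * qint d i (k * A i j))) •
        ((h.gu ^ (-sgn pm * |k|) : Eˣ) * ρ (e (gx pm j (k + l)))) := by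
  cases pm
  · have := h.rel _ _ (.h_xm i j k l hk)
    rw [map_smul, map_mul, h.map_gammaHalf] at this
    simpa [gx, sgn] using this
  · have := h.rel _ _ (.h_xp i j k l hk)
    rw [map_smul, map_mul, h.map_gammaHalf] at this
    simpa [gx, sgn] using this

omit h in
theorem ppos_isExpSeq (ρ : FA N →ₐ[Fq] E) (i : Fin N) :
    IsExpSeq Fq (fun a : ℕ => ((a : Fq) * (qi d i - (qi d i)⁻¹)) • ρ (e (Gen.h i a)))
      (fun n => ρ (Ppos d i n)) := by
  refine ⟨by simp [Ppos], fun n => ?_⟩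
  rcases n with _ | n
  · simp
  rw [Nat.sum_antidiagonal_succ, Nat.sum_antidiagonal_eq_sum_range_succ_mk, Ppos, map_smul,
    smul_smul, Nat.cast_succ, mul_inv_cancel₀ (Nat.cast_add_one_ne_zero n), one_smul, map_sum]
  simp

omit h in
theorem pneg_isExpSeq (ρ : FA N →ₐ[Fq] E) (i : Fin N) :
    IsExpSeq Fq (fun a : ℕ => ((a : Fq) * -(qi d i - (qi d i)⁻¹)) • ρ (e (Gen.h i (-a))))
      (fun n => ρ (Pneg d i n)) := by
  refine ⟨by simp [Pneg], fun n => ?_⟩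
  rcases n with _ | n
  · simp
  rw [Nat.sum_antidiagonal_succ, Nat.sum_antidiagonal_eq_sum_range_succ_mk, Pneg, map_smul,
    smul_smul, Nat.cast_succ, mul_inv_cancel₀ (Nat.cast_add_one_ne_zero n), one_smul, map_sum]
  simp

/-- The series `∑ γ^{± n/2} ψ_{i,n} w^n`. -/
def psiSeries (h : CoreRep d A ρ) (pm : Bool) (i : Fin N) : PowerSeries E :=
  PowerSeries.mk fun n => ρ (e (K i)) * (((h.gu ^ sgn pm : Eˣ) : E) ^ n * ρ (Ppos d i n))

/-- The series `∑ γ^{± n/2} φ_{i,-n} w^n`. -/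
def phiSeries (h : CoreRep d A ρ) (pm : Bool) (i : Fin N) : PowerSeries E :=
  PowerSeries.mk fun n => ρ (e (Kinv i)) * (((h.gu ^ sgn pm : Eˣ) : E) ^ n * ρ (Pneg d i n))

theorem map_psiEl (pm : Bool) (i : Fin N) (m : ℤ) :
    ρ (psiEl d i m) = (h.gu ^ (-sgn pm * m) : Eˣ) * coeffInt (h.psiSeries pm i) m := by
  unfold psiEl coeffInt
  split_ifs with hm
  · lift m to ℕ using hm
    rw [psiSeries, PowerSeries.coeff_mk, h.gu_pow, Int.toNat_natCast, h.gu_comm, mul_assoc,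
      mul_assoc, ← h.gu_comm, ← mul_assoc _ _ (ρ (Ppos d i m)), h.gu_add, map_mul]
    simp
  · simp

theorem map_phiEl (pm : Bool) (i : Fin N) (m : ℤ) :
    ρ (phiEl d i m) = (h.gu ^ (sgn pm * m) : Eˣ) * coeffInt (h.phiSeries pm i) (-m) := by
  unfold phiEl coeffInt
  by_cases hm : m ≤ 0
  · obtain ⟨n, hn⟩ := Int.eq_ofNat_of_zero_le (show 0 ≤ -m by omega)
    obtain rfl : m = -(n : ℤ) := by omega
    rw [if_pos hm, if_pos (by omega), phiSeries, PowerSeries.coeff_mk, h.gu_pow, neg_neg,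
      Int.toNat_natCast, h.gu_comm, mul_assoc,
      mul_assoc, ← h.gu_comm, ← mul_assoc _ _ (ρ (Pneg d i n)), h.gu_add, map_mul]
    simp
  · rw [if_neg hm, if_neg (by omega)]
    simp

theorem cartanRel (hd : ∀ i, 0 < d i) (pm : Bool) (i j : Fin N) :
    CartanRel (h.psiSeries pm i) (h.phiSeries pm i) (fun r => ρ (e (gx pm j r)))
      (qp d A i j ^ sgn pm) := by
  have hP : qp d A i j ^ sgn pm ≠ 0 := zpow_ne_zero _ (qp_ne_zero d A i j)
  have hu : ∀ z, ((h.gu ^ sgn pm : Eˣ) : E) * z = z * (h.gu ^ sgn pm : Eˣ) := h.gu_comm _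
  have hq : (qi d i - (qi d i)⁻¹) ≠ 0 := (qi_notRoot hd i).sub_inv_ne_zero
  have hqn : ∀ a : ℤ, (sgn pm : Fq) * ((qi d i - (qi d i)⁻¹) * qint d i (a * A i j)) =
      (qp d A i j ^ sgn pm) ^ a - (qp d A i j ^ sgn pm) ^ (-a) := by
    intro a
    rw [qint_eq_qnum, sub_inv_mul_qnum (qi_notRoot hd i), qp_eq_qi_zpow]
    cases pm <;> simp only [sgn, ← zpow_mul] <;> simp [mul_comm]
  refine ⟨((ppos_isExpSeq ρ i).scale hu).twistRel hP (fun a m => ?_) (h.x_mul_K pm i j),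
    ((pneg_isExpSeq ρ i).scale hu).twistRel (inv_ne_zero hP) (fun a m => ?_) fun m => ?_⟩
  · rcases Nat.eq_zero_or_pos a with rfl | ha
    · simp
    have ha' : (a : ℤ) ≠ 0 := by omega
    have ha'' : (a : Fq) ≠ 0 := Nat.cast_ne_zero.2 ha.ne'
    rw [add_comm m]
    refine mul_eq_of_commutator (h.gu_comm_pow _ a) (h.h_x pm i j m ha') ?_ ?_
    · rw [h.gu_pow, h.gu_add]
      simp
    · have := hqn a
      rw [← inv_zpow', zpow_natCast, zpow_natCast] at this
      rw [← neg_sub (_ ^ a), ← this, Int.cast_natCast]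
      field_simp
  · rcases Nat.eq_zero_or_pos a with rfl | ha
    · simp
    have ha' : -(a : ℤ) ≠ 0 := by omega
    have ha'' : (a : Fq) ≠ 0 := Nat.cast_ne_zero.2 ha.ne'
    simp only [neg_add, inv_inv]
    rw [add_comm (-m)]
    refine mul_eq_of_commutator (h.gu_comm_pow _ a) (h.h_x pm i j (-m) ha') ?_ ?_
    · rw [h.gu_pow, h.gu_add]
      simp
    · have := hqn (-a)
      rw [neg_neg, ← inv_zpow', zpow_natCast, zpow_natCast] at this
      rw [← neg_sub ((qp d A i j ^ sgn pm)⁻¹ ^ a), ← this, Int.cast_neg, Int.cast_natCast]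
      field_simp
  · rw [inv_inv]
    exact h.x_mul_Kinv pm i j (-m)

end CoreRep
end Drinfeld

section Drinfeld
variable {N : ℕ} (d : Fin N → ℤ) (A : Fin N → Fin N → ℤ)

/-- The difference of the two sides of the quadratic relation. -/
def quadElt (pm : Bool) (i j : Fin N) (m l : ℤ) : FA N :=
  e (gx pm i (m + 1)) * e (gx pm j l) -
    qp d A i j ^ sgn pm • (e (gx pm j l) * e (gx pm i (m + 1))) -
  (qp d A i j ^ sgn pm • (e (gx pm i m) * e (gx pm j (l + 1))) -
    e (gx pm j (l + 1)) * e (gx pm i m))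

/-- The left hand side of the Drinfeld-Serre relation. -/
def serreElt (pm : Bool) (i j : Fin N) (ks : Fin (1 - A i j).toNat → ℤ) (l : ℤ) : FA N :=
  ∑ σ : Equiv.Perm (Fin (1 - A i j).toNat),
    ∑ r ∈ Finset.range ((1 - A i j).toNat + 1),
      ((-1 : Fq) ^ r * qbinom d i (1 - A i j).toNat r) •
        dsTerm pm i j (1 - A i j).toNat ks l σ r

variable {d A} {E : Type*} [Ring E] [Algebra Fq E] {ρ : FA N →ₐ[Fq] E}

theorem map_quadElt_eq_zero_iff {pm : Bool} {i j : Fin N} :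
    (∀ m l, ρ (quadElt d A pm i j m l) = 0) ↔
      QuadRel (fun m => ρ (e (gx pm i m))) (fun m => ρ (e (gx pm j m))) (qp d A i j ^ sgn pm) := by
  refine forall₂_congr fun m l => ?_
  simp only [quadElt, map_sub, map_smul, map_mul]
  rw [sub_eq_zero]

theorem map_dsTerm (pm : Bool) (i j : Fin N) (n : ℕ) (ks : Fin n → ℤ) (l : ℤ)
    (σ : Equiv.Perm (Fin n)) (r : ℕ) :
    ρ (dsTerm pm i j n ks l σ r) =
      insertWord (fun t => ρ (e (gx pm i (ks (σ t))))) (ρ (e (gx pm j l))) r := by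
  simp only [dsTerm, insertWord, map_mul, map_list_prod, List.map_map]
  rfl

namespace CoreRep

variable (h : CoreRep d A ρ)
include h

theorem x_comm (pm : Bool) (i j : Fin N) (n m : ℤ) :
    ρ (e (gx (!pm) i n)) * ρ (e (gx pm j m)) - ρ (e (gx pm j m)) * ρ (e (gx (!pm) i n)) =
      if i = j then
        cartanValue (E := E) (-(sgn pm : Fq) * (qi d i - (qi d i)⁻¹)⁻¹)
          ((h.gu ^ (-sgn pm * 2 * n) : Eˣ) : E) ((h.gu ^ (sgn pm * 2 * n) : Eˣ) : E)
          (h.psiSeries pm i) (h.phiSeries pm i) n m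
      else 0 := by
  cases pm
  · have := h.rel _ _ (.xp_xm i j n m)
    rw [apply_ite ρ, map_smul, map_sub, map_sub, map_mul, map_mul, map_mul, map_mul,
      h.map_gammaHalf, h.map_gammaHalf,
      h.map_psiEl false, h.map_phiEl false, map_zero, ← mul_assoc, ← mul_assoc, h.gu_add,
      h.gu_add] at this
    refine this.trans ?_
    unfold cartanValue
    congr 2
    · simp [sgn]
    · congr 4 <;> simp only [sgn] <;> simp <;> ring
  · have := h.rel _ _ (.xp_xm j i m n)
    rw [apply_ite ρ, map_smul, map_sub, map_sub, map_mul, map_mul, map_mul, map_mul,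
      h.map_gammaHalf, h.map_gammaHalf,
      h.map_psiEl true, h.map_phiEl true, map_zero, ← mul_assoc, ← mul_assoc, h.gu_add,
      h.gu_add] at this
    rw [← neg_inj, neg_sub]
    refine this.trans ?_
    by_cases hij : j = i
    · subst hij
      rw [if_pos rfl, if_pos rfl]
      unfold cartanValue
      rw [← neg_smul]
      congr 1
      · simp [sgn]
      · congr 3
        · congr 2; rw [sgn, if_pos rfl]; ring
        · rw [add_comm]
        · congr 2; rw [sgn, if_pos rfl]; ring
        · rw [add_comm]
    · rw [if_neg hij, if_neg (Ne.symm hij), neg_zero]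

theorem commute_quadElt (hd : ∀ i, 0 < d i) (hsym : ∀ i j, d i * A i j = d j * A j i)
    (pm : Bool) (p i j : Fin N) (n m l : ℤ) :
    Commute (ρ (e (gx (!pm) p n))) (ρ (quadElt d A pm i j m l)) := by
  simp only [quadElt, map_sub, map_smul, map_mul]
  refine commute_quad (h.x_comm pm p i n) (h.x_comm pm p j n) ?_ ?_ m l
  · by_cases hp : p = i
    · subst hp
      simp only [if_true]
      exact CartanRel.quadRel (zpow_ne_zero _ (qp_ne_zero d A p j)) (h.cartanRel hd pm p j) _
        (h.gu_comm _) (h.gu_comm _) n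
    · simp only [if_neg hp]
      exact quadRel_zero_left _ _
  · refine QuadRel.symm ?_
    by_cases hp : p = j
    · subst hp
      simp only [if_true]
      rw [qp_symm hsym]
      exact CartanRel.quadRel (zpow_ne_zero _ (qp_ne_zero d A p i)) (h.cartanRel hd pm p i) _
        (h.gu_comm _) (h.gu_comm _) n
    · simp only [if_neg hp]
      exact quadRel_zero_left _ _

theorem commute_serreElt (hd : ∀ i, 0 < d i) (hsym : ∀ i j, d i * A i j = d j * A j i)
    (hdiag : ∀ i, A i i = 2) (hoff : ∀ i j, i ≠ j → A i j ≤ 0)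
    (pm : Bool) (p : Fin N) {i j : Fin N} (hij : i ≠ j) (n l : ℤ) (ks : Fin (1 - A i j).toNat → ℤ)
    (hq : ∀ i j m l, ρ (quadElt d A pm i j m l) = 0) :
    Commute (ρ (e (gx (!pm) p n))) (ρ (serreElt d A pm i j ks l)) := by
  obtain ⟨s, hs⟩ := Int.eq_ofNat_of_zero_le (show 0 ≤ - A i j by have := hoff i j hij; omega)
  have hA : A i j = -(s : ℤ) := by omega
  have hn : (1 - A i j).toNat = s + 1 := by omega
  simp only [serreElt, map_sum, map_smul, map_dsTerm]
  generalize (1 - A i j).toNat = n' at hn ks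
  subst hn
  obtain ⟨v, hv, hbin, hv2, hvs⟩ : ∃ v : Fq, NotRootOfUnity v ∧
      (∀ n r, qbinom d i n r = qnumBinom v n r) ∧ qp d A i i ^ sgn pm = v ^ 2 ∧
      qp d A i j ^ sgn pm = (v ^ s)⁻¹ := by
    have h0 := qi_notRoot hd i
    cases pm
    · refine ⟨(qi d i)⁻¹, h0.inv, fun n r => ?_, ?_, ?_⟩
      · rw [qbinom_eq_qnumBinom, qnumBinom_inv]
      · rw [qp_eq_qi_zpow, hdiag]; simp [sgn]
      · rw [qp_eq_qi_zpow, hA]; simp [sgn]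
    · refine ⟨qi d i, h0, fun n r => ?_, ?_, ?_⟩
      · rw [qbinom_eq_qnumBinom]
      · rw [qp_eq_qi_zpow, hdiag]; simp [sgn]
      · rw [qp_eq_qi_zpow, hA]; simp [sgn]
  have hxx := map_quadElt_eq_zero_iff.1 (hq i i)
  have hxy := map_quadElt_eq_zero_iff.1 (hq i j)
  rw [hv2] at hxx
  rw [hvs] at hxy
  have h2 : (2 : Fq) ≠ 0 := two_ne_zero
  simp only [hbin]
  by_cases hpi : p = i
  · subst hpi
    have c1 := h.cartanRel hd pm p p
    have c2 := h.cartanRel hd pm p j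
    rw [hv2] at c1
    rw [hvs] at c2
    refine commute_serre_self hv h2 (h.gu_comm _) (h.gu_comm _) hxx hxy c1 c2
      (fun m => (h.x_comm pm p p n m).trans (if_pos rfl)) (fun m => ?_) ks l
    exact sub_eq_zero.1 ((h.x_comm pm p j n m).trans (if_neg hij))
  by_cases hpj : p = j
  · subst hpj
    have c1 := h.cartanRel hd pm p i
    rw [qp_symm hsym, hvs] at c1
    refine commute_serre_partner hv h2 (h.gu_comm _) (h.gu_comm _) hxx c1
      (fun m => (h.x_comm pm p p n m).trans (if_pos rfl)) (fun m => ?_) ks l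
    exact sub_eq_zero.1 ((h.x_comm pm p i n m).trans (if_neg hpi))
  · have c1 : ∀ m, Commute (ρ (e (gx (!pm) p n))) (ρ (e (gx pm i m))) := fun m =>
      sub_eq_zero.1 ((h.x_comm pm p i n m).trans (if_neg hpi))
    have c2 : ∀ m, Commute (ρ (e (gx (!pm) p n))) (ρ (e (gx pm j m))) := fun m =>
      sub_eq_zero.1 ((h.x_comm pm p j n m).trans (if_neg hpj))
    refine Commute.sum_right _ _ _ fun σ _ => Commute.sum_right _ _ _ fun r _ =>
      Commute.smul_right ?_ _
    refine ((Commute.list_prod_right _ _ ?_).mul_right (c2 l)).mul_right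
      (Commute.list_prod_right _ _ ?_) <;>
    · intro z hz
      obtain ⟨t, -, rfl⟩ := List.mem_map.1 hz
      exact c1 _

end CoreRep
end Drinfeld

section WordModule

variable {X R C : Type*} [CommRing R] [AddCommGroup C] [Module R C]

namespace WordModule

/-- Prepending a letter, as an operator on combinations of words with coefficients in `C`. -/
def prepend (R C : Type*) [CommRing R] [AddCommGroup C] [Module R C] (x : X) :
    Module.End R (List X →₀ C) :=
  Finsupp.lmapDomain C R (x :: ·)

@[simp]
theorem prepend_single (x : X) (w : List X) (c : C) :
    prepend R C x (Finsupp.single w c) = Finsupp.single (x :: w) c := by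
  simp [prepend]

/-- The values on words of the operator determined by its values on the empty word and its
commutation rule with the letters. -/
def opWord (base : Module.End R C) (a b : X → Module.End R (List X →₀ C)) :
    List X → C →ₗ[R] (List X →₀ C)
  | [] => Finsupp.lsingle [] ∘ₗ base
  | x :: w => a x ∘ₗ opWord base a b w + b x ∘ₗ Finsupp.lsingle w

/-- The operator `T` with `T = base` on the empty word and `T x = a_x T + b_x`. -/
def op (base : Module.End R C) (a b : X → Module.End R (List X →₀ C)) :
    Module.End R (List X →₀ C) :=
  Finsupp.lsum R (opWord base a b)

theorem op_single (base : Module.End R C) (a b : X → Module.End R (List X →₀ C)) (w : List X)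
    (c : C) : op base a b (Finsupp.single w c) = opWord base a b w c := by
  simp [op]

@[simp]
theorem op_vac (base : Module.End R C) (a b : X → Module.End R (List X →₀ C)) (c : C) :
    op base a b (Finsupp.single [] c) = Finsupp.single [] (base c) := by
  simp [op_single, opWord]

theorem op_mul_prepend (base : Module.End R C) (a b : X → Module.End R (List X →₀ C)) (x : X) :
    op base a b * prepend R C x = a x * op base a b + b x := by
  refine Finsupp.lhom_ext fun w c => ?_
  simp [op_single, opWord]

theorem eq_zero_of_mul_prepend {T : Module.End R (List X →₀ C)}
    (h0 : ∀ c, T (Finsupp.single [] c) = 0)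
    (h : ∀ x, ∃ a : Module.End R (List X →₀ C), T * prepend R C x = a * T) : T = 0 := by
  refine Finsupp.lhom_ext fun w => ?_
  induction w with
  | nil => exact h0
  | cons x w ih =>
    intro c
    obtain ⟨a, ha⟩ := h x
    have := LinearMap.congr_fun ha (Finsupp.single w c)
    simpa [ih c] using this

theorem eq_of_mul_prepend {S T : Module.End R (List X →₀ C)}
    (h0 : ∀ c, S (Finsupp.single [] c) = T (Finsupp.single [] c))
    (h : ∀ x, ∃ a : Module.End R (List X →₀ C), (S - T) * prepend R C x = a * (S - T)) : S = T :=
  sub_eq_zero.1 (eq_zero_of_mul_prepend (fun c => by simp [h0]) h)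

end WordModule
end WordModule

section Exp
variable {k : Type*} [Field k] [CharZero k] {E : Type*} [Ring E] [Algebra k E]

/-- A derivation sending only `H_b` to a nonzero central element `b z` multiplies the exponential
by `z w^b`. -/
theorem IsExpSeq.commutator {H S : ℕ → E} (hS : IsExpSeq k H S) {p z : E} {b : ℕ} (hb : 0 < b)
    (hz : ∀ a, z * a = a * z)
    (hp : ∀ a, p * H a - H a * p = if a = b then (b : k) • z else 0) (n : ℕ) :
    p * S n - S n * p = if b ≤ n then z * S (n - b) else 0 := by
  induction n using Nat.strong_induction_on with
  | _ n ih =>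
  rcases Nat.eq_zero_or_pos n with rfl | hn
  · rw [if_neg (by omega)]
    simp [hS.zero]
  have hH : H 0 = 0 := by simpa [hS.zero] using (hS.deriv 0).symm
  refine smul_right_injective E (Nat.cast_ne_zero.2 hn.ne' : (n : k) ≠ 0) ?_
  have h1 : (n : k) • (p * S n - S n * p) =
      ∑ r ∈ antidiagonal n, ((if r.1 = b then (b : k) • (z * S r.2) else 0) +
        H r.1 * (if b ≤ r.2 then z * S (r.2 - b) else 0)) := by
    rw [smul_sub, ← mul_smul_comm, ← smul_mul_assoc, hS.deriv, mul_sum, sum_mul, ← sum_sub_distrib]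
    refine sum_congr rfl fun r hr => ?_
    rw [HasAntidiagonal.mem_antidiagonal] at hr
    have h2 : p * (H r.1 * S r.2) - H r.1 * S r.2 * p =
        (p * H r.1 - H r.1 * p) * S r.2 + H r.1 * (p * S r.2 - S r.2 * p) := by noncomm_ring
    rw [h2, hp, ite_mul, zero_mul, smul_mul_assoc]
    congr 1
    rcases Nat.eq_zero_or_pos r.1 with h0 | h0
    · simp [h0, hH]
    · rw [ih _ (by omega)]
  dsimp only
  rw [h1, sum_add_distrib]
  split_ifs with hbn
  · obtain ⟨m, rfl⟩ := Nat.exists_eq_add_of_le hbn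
    have h3 : ∑ r ∈ antidiagonal (b + m), H r.1 * (if b ≤ r.2 then z * S (r.2 - b) else 0) =
        z * ((m : k) • S m) := by
      rw [hS.deriv, mul_sum]
      refine sum_bij_ne_zero (fun r _ _ => (r.1, r.2 - b)) ?_ ?_ ?_ ?_
      · intro r hr h
        rw [HasAntidiagonal.mem_antidiagonal] at hr ⊢
        have : b ≤ r.2 := by by_contra h'; simp [h'] at h
        simp only; omega
      · intro r hr h r' hr' h' heq
        rw [HasAntidiagonal.mem_antidiagonal] at hr hr'
        simp only [Prod.mk.injEq] at heq
        ext
        · exact heq.1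
        · omega
      · intro r hr h
        rw [HasAntidiagonal.mem_antidiagonal] at hr
        refine ⟨(r.1, r.2 + b), by rw [HasAntidiagonal.mem_antidiagonal]; simp only; omega, ?_,
          by simp⟩
        simp only [le_add_iff_nonneg_left, zero_le, if_true, Nat.add_sub_cancel]
        rwa [← mul_assoc, ← hz, mul_assoc]
      · intro r hr h
        have : b ≤ r.2 := by by_contra h'; simp [h'] at h
        rw [if_pos this, ← mul_assoc, ← hz, mul_assoc]
    have h4 : ∑ r ∈ antidiagonal (b + m), (if r.1 = b then (b : k) • (z * S r.2) else 0) =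
        (b : k) • (z * S m) := by
      rw [sum_eq_single (b, m)]
      · simp
      · intro r hr h
        rw [HasAntidiagonal.mem_antidiagonal] at hr
        rw [if_neg]
        rintro rfl
        exact h (Prod.ext rfl (by simp only; omega))
      · intro h
        simp at h
    rw [h3, h4, mul_smul_comm, ← add_smul, Nat.cast_add, Nat.add_sub_cancel_left]
  · rw [smul_zero, sum_eq_zero, sum_eq_zero, add_zero]
    · intro r hr
      rw [HasAntidiagonal.mem_antidiagonal] at hr
      rw [if_neg (by omega), mul_zero]
    · intro r hr
      rw [HasAntidiagonal.mem_antidiagonal] at hr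
      rw [if_neg (by omega)]

theorem IsExpSeq.mul_comm_scale {H S : ℕ → E} (hS : IsExpSeq k H S) {p : E} {c : k}
    (hp : ∀ a, p * H a = c ^ a • (H a * p)) (n : ℕ) : p * S n = c ^ n • (S n * p) := by
  induction n using Nat.strong_induction_on with
  | _ n ih =>
  rcases Nat.eq_zero_or_pos n with rfl | hn
  · simp [hS.zero]
  have hH : H 0 = 0 := by simpa [hS.zero] using (hS.deriv 0).symm
  refine smul_right_injective E (Nat.cast_ne_zero.2 hn.ne' : (n : k) ≠ 0) ?_
  dsimp only
  rw [smul_comm (n : k), ← mul_smul_comm, ← smul_mul_assoc, hS.deriv, mul_sum, sum_mul, smul_sum]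
  refine sum_congr rfl fun r hr => ?_
  rw [HasAntidiagonal.mem_antidiagonal] at hr
  rcases Nat.eq_zero_or_pos r.1 with h0 | h0
  · simp [h0, hH]
  · rw [← mul_assoc, hp, smul_mul_assoc, mul_assoc, ih _ (by omega), mul_smul_comm, smul_smul,
      ← pow_add, hr, mul_assoc]

theorem IsExpSeq.commute {H S : ℕ → E} (hS : IsExpSeq k H S) {p : E}
    (hp : ∀ a, Commute p (H a)) (n : ℕ) : Commute p (S n) := by
  have := hS.mul_comm_scale (c := 1) (p := p) (fun a => by simpa using (hp a).eq) n
  rw [one_pow, one_smul] at this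
  exact this
end Exp

section ModeOperators

namespace WordModule

variable {k : Type*} [Field k] {ι R C : Type*} [CommRing R] [Algebra k R]
  [AddCommGroup C] [Module R C] [Module k C] [IsScalarTower k R C]

/-- The operator rescaling the letters by `s`. -/
def diag (β : Module.End R C) (s : ι × ℤ → k) : Module.End R (List (ι × ℤ) →₀ C) :=
  op β (fun x => s x • prepend R C x) 0

/-- The operator acting on the letters as the derivation `x ↦ c_x x[m]`. -/
def shift (m : ℤ) (β : Module.End R C) (c : ι × ℤ → R) : Module.End R (List (ι × ℤ) →₀ C) :=
  op β (prepend R C) fun x => c x • prepend R C (x.1, x.2 + m)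

/-- The operator annihilating the words of length zero with given commutators with the letters. -/
def lower (b : ι × ℤ → Module.End R (List (ι × ℤ) →₀ C)) : Module.End R (List (ι × ℤ) →₀ C) :=
  op 0 (prepend R C) b

@[simp]
theorem diag_vac (β : Module.End R C) (s : ι × ℤ → k) (c : C) :
    diag β s (Finsupp.single [] c) = Finsupp.single [] (β c) :=
  op_vac _ _ _ c

@[simp]
theorem shift_vac (m : ℤ) (β : Module.End R C) (c : ι × ℤ → R) (v : C) :
    shift m β c (Finsupp.single [] v) = Finsupp.single [] (β v) :=
  op_vac _ _ _ v

@[simp]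
theorem lower_vac (b : ι × ℤ → Module.End R (List (ι × ℤ) →₀ C)) (v : C) :
    lower b (Finsupp.single [] v) = 0 := by
  simp [lower]

theorem diag_mul_prepend (β : Module.End R C) (s : ι × ℤ → k) (x : ι × ℤ) :
    diag β s * prepend R C x = s x • (prepend R C x * diag β s) := by
  rw [diag, op_mul_prepend, Pi.zero_apply, add_zero, smul_mul_assoc]

theorem shift_mul_prepend (m : ℤ) (β : Module.End R C) (c : ι × ℤ → R) (x : ι × ℤ) :
    shift m β c * prepend R C x =
      prepend R C x * shift m β c + c x • prepend R C (x.1, x.2 + m) :=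
  op_mul_prepend _ _ _ x

theorem lower_mul_prepend (b : ι × ℤ → Module.End R (List (ι × ℤ) →₀ C)) (x : ι × ℤ) :
    lower b * prepend R C x = prepend R C x * lower b + b x :=
  op_mul_prepend _ _ _ x

theorem diag_mul_diag (β β' : Module.End R C) (s s' : ι × ℤ → k) :
    diag β s * diag β' s' = diag (β * β') (s * s') := by
  refine eq_of_mul_prepend (by simp) fun x => ⟨(s x * s' x) • prepend R C x, ?_⟩
  rw [sub_mul, mul_assoc, diag_mul_prepend, diag_mul_prepend, mul_smul_comm, ← mul_assoc,
    diag_mul_prepend, smul_mul_assoc, smul_mul_assoc, smul_smul, mul_sub, mul_assoc,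
    Pi.mul_apply, mul_comm (s' x), smul_sub]

theorem diag_one : diag (1 : Module.End R C) (1 : ι × ℤ → k) = 1 := by
  refine eq_of_mul_prepend (by simp) fun x => ⟨prepend R C x, ?_⟩
  rw [sub_mul, diag_mul_prepend, Pi.one_apply, one_smul, mul_sub, mul_one, one_mul]

theorem diag_mul_shift {β : Module.End R C} {s : ι × ℤ → k} {m : ℤ} {β' : Module.End R C}
    {c : ι × ℤ → R} {p : k} (hβ : β * β' = p • (β' * β))
    (hs : ∀ x : ι × ℤ, s (x.1, x.2 + m) = p * s x) :
    diag β s * shift m β' c = p • (shift m β' c * diag β s) := by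
  refine eq_of_mul_prepend (fun v => ?_) fun x => ⟨s x • prepend R C x, ?_⟩
  · have := LinearMap.congr_fun hβ v
    simp only [Module.End.mul_apply, LinearMap.smul_apply] at this
    simp [this]
  · rw [sub_mul, mul_assoc, shift_mul_prepend, mul_add, ← mul_assoc, diag_mul_prepend,
      mul_smul_comm (c x), diag_mul_prepend, smul_mul_assoc p, mul_assoc, diag_mul_prepend,
      mul_smul_comm, ← mul_assoc (shift m β' c), shift_mul_prepend, hs]
    simp only [add_mul, smul_mul_assoc, mul_assoc, smul_add, mul_sub, mul_smul_comm,
      smul_smul, smul_comm (c x), mul_comm p]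
    abel

theorem shift_commutator {m m' : ℤ} {β β' : Module.End R C} {c c' : ι × ℤ → R} {z : R}
    (hβ : β * β' - β' * β = z • 1) (hc : ∀ x : ι × ℤ, c (x.1, x.2 + m') = c x)
    (hc' : ∀ x : ι × ℤ, c' (x.1, x.2 + m) = c' x) :
    shift m β c * shift m' β' c' - shift m' β' c' * shift m β c = z • 1 := by
  refine eq_of_mul_prepend (fun v => ?_) fun x => ⟨prepend R C x, ?_⟩
  · have := LinearMap.congr_fun hβ v
    simp only [Module.End.mul_apply, LinearMap.smul_apply, LinearMap.sub_apply,
      Module.End.one_apply] at this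
    simp only [Module.End.mul_apply, LinearMap.smul_apply, LinearMap.sub_apply,
      Module.End.one_apply, shift_vac, ← Finsupp.single_sub, this, Finsupp.smul_single]
  · rw [sub_mul, sub_mul, mul_assoc, mul_assoc, shift_mul_prepend, shift_mul_prepend, mul_add,
      mul_add, mul_smul_comm, mul_smul_comm, shift_mul_prepend, shift_mul_prepend,
      ← mul_assoc, ← mul_assoc, shift_mul_prepend, shift_mul_prepend, hc, hc']
    simp only [add_mul, smul_mul_assoc, mul_assoc, smul_add, mul_sub, one_mul, mul_one,
      mul_smul_comm, smul_smul, mul_comm (c x), add_assoc, add_comm m m']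
    abel

theorem diag_mul_lower {β : Module.End R C} {s : ι × ℤ → k}
    {b : ι × ℤ → Module.End R (List (ι × ℤ) →₀ C)} {p : k}
    (h : ∀ x, diag β s * b x = (p * s x) • (b x * diag β s)) :
    diag β s * lower b = p • (lower b * diag β s) := by
  refine eq_of_mul_prepend (by simp) fun x => ⟨s x • prepend R C x, ?_⟩
  rw [sub_mul, mul_assoc, lower_mul_prepend, mul_add, ← mul_assoc, diag_mul_prepend, h,
    smul_mul_assoc p, mul_assoc (lower b), diag_mul_prepend, mul_smul_comm, ← mul_assoc (lower b),
    lower_mul_prepend]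
  simp only [add_mul, smul_mul_assoc, mul_assoc, smul_add, mul_sub, mul_smul_comm,
    smul_smul]
  abel

theorem shift_lower_commutator {m : ℤ} {β : Module.End R C} {c : ι × ℤ → R}
    {b b' : ι × ℤ → Module.End R (List (ι × ℤ) →₀ C)} {z : R}
    (h : ∀ x, shift m β c * b x - b x * shift m β c =
      c x • b (x.1, x.2 + m) + z • b' x) :
    shift m β c * lower b - lower b * shift m β c = z • lower b' := by
  refine eq_of_mul_prepend (by simp) fun x => ⟨prepend R C x, ?_⟩
  have h1 := h x
  rw [sub_eq_iff_eq_add] at h1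
  rw [sub_mul, sub_mul, mul_assoc, mul_assoc, lower_mul_prepend, shift_mul_prepend, mul_add,
    mul_add, ← mul_assoc, ← mul_assoc (lower b), shift_mul_prepend, lower_mul_prepend,
    mul_smul_comm, lower_mul_prepend, smul_mul_assoc, lower_mul_prepend, h1]
  simp only [add_mul, smul_mul_assoc, mul_assoc, smul_add, mul_sub, mul_smul_comm]
  abel

end WordModule
end ModeOperators

section Heisenberg

open MvPolynomial in
/-- Multiplication by a variable plus a derivation with constant coefficients. -/
def heis {X R : Type*} [CommRing R] (x : X) (f : X → R) : Module.End R (MvPolynomial X R) :=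
  LinearMap.mulLeft R (MvPolynomial.X x) + (mkDerivation R fun y => C (f y)).toLinearMap

theorem heis_apply {X R : Type*} [CommRing R] (x : X) (f : X → R) (p : MvPolynomial X R) :
    heis x f p = MvPolynomial.X x * p +
      MvPolynomial.mkDerivation R (fun y => MvPolynomial.C (f y)) p :=
  rfl

theorem heis_commutator {X R : Type*} [CommRing R] (x y : X) (f g : X → R) :
    heis x f * heis y g - heis y g * heis x f = (f y - g x) • 1 := by
  have h : ⁅(MvPolynomial.mkDerivation R (fun y => MvPolynomial.C (f y)) :
        Derivation R (MvPolynomial X R) (MvPolynomial X R)),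
      (MvPolynomial.mkDerivation R (fun y => MvPolynomial.C (g y)) :
        Derivation R (MvPolynomial X R) (MvPolynomial X R))⁆ = 0 := by
    refine MvPolynomial.derivation_ext fun z => ?_
    simp [Derivation.commutator_apply]
  refine LinearMap.ext fun p => ?_
  have h1 := DFunLike.congr_fun h p
  rw [Derivation.commutator_apply, Derivation.zero_apply, sub_eq_zero] at h1
  simp only [LinearMap.sub_apply, Module.End.mul_apply, heis_apply, map_add, Derivation.leibniz,
    MvPolynomial.mkDerivation_X, h1, LinearMap.smul_apply, Module.End.one_apply, smul_eq_mul,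
    MvPolynomial.smul_eq_C_mul, map_sub]
  ring

variable {ι R : Type*} [CommRing R] [Algebra Fq R]

/-- The grading automorphism `t_{i,m} ↦ s^m t_{i,m}`. -/
def gradeEnd (ι R : Type*) [CommRing R] [Algebra Fq R] (s : Fq) :
    Module.End R (MvPolynomial (ι × ℤ) R) :=
  (MvPolynomial.aeval fun x : ι × ℤ => s ^ x.2 • MvPolynomial.X (R := R) x).toLinearMap

theorem gradeEnd_apply (s : Fq) (p : MvPolynomial (ι × ℤ) R) : gradeEnd ι R s p =
    MvPolynomial.aeval (fun x : ι × ℤ => s ^ x.2 • MvPolynomial.X (R := R) x) p := rfl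

theorem gradeEnd_one : gradeEnd ι R 1 = 1 := by
  refine LinearMap.ext fun p => ?_
  simp [gradeEnd_apply]

theorem gradeEnd_mul (s s' : Fq) : gradeEnd ι R s * gradeEnd ι R s' = gradeEnd ι R (s * s') := by
  refine LinearMap.ext fun p => ?_
  simp only [Module.End.mul_apply, gradeEnd_apply]
  rw [← AlgHom.comp_apply, MvPolynomial.comp_aeval]
  congr 2
  funext x
  rw [mul_zpow, mul_comm, mul_smul,
    ← IsScalarTower.algebraMap_smul R (s' ^ x.2) (MvPolynomial.X (R := R) x), map_smul,
    MvPolynomial.aeval_X, IsScalarTower.algebraMap_smul]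

theorem gradeEnd_mul_heis {s : Fq} (hs : s ≠ 0) (x : ι × ℤ) {f : ι × ℤ → R}
    (hf : ∀ y, y.2 ≠ -x.2 → f y = 0) :
    gradeEnd ι R s * heis x f = s ^ x.2 • (heis x f * gradeEnd ι R s) := by
  refine LinearMap.ext fun p => ?_
  simp only [Module.End.mul_apply, LinearMap.smul_apply, heis_apply, gradeEnd_apply, map_add,
    map_mul, MvPolynomial.aeval_X, smul_add, smul_mul_assoc]
  congr 1
  induction p using MvPolynomial.induction_on with
  | C a => simp
  | add p q hp hq => simp only [map_add, smul_add, hp, hq]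
  | mul_X p y hp =>
    simp only [Derivation.leibniz, MvPolynomial.mkDerivation_X, map_add, smul_eq_mul, map_mul,
      MvPolynomial.aeval_X, hp, MvPolynomial.aeval_C, smul_add]
    rw [← IsScalarTower.algebraMap_smul R (s ^ y.2) (MvPolynomial.X (R := R) y),
      Derivation.map_smul, MvPolynomial.mkDerivation_X]
    congr 1
    · by_cases hy : y.2 = -x.2
      · rw [← mul_smul_comm, IsScalarTower.algebraMap_smul, smul_smul, hy, ← zpow_add₀ hs,
          add_neg_cancel, zpow_zero, one_smul]
        rfl
      · simp [hf y hy]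
    · rw [mul_smul_comm]

end Heisenberg

theorem IsExpSeq.unique {k : Type*} [Field k] [CharZero k] {E : Type*} [Ring E] [Algebra k E]
    {H S S' : ℕ → E} (hS : IsExpSeq k H S) (hS' : IsExpSeq k H S') (n : ℕ) : S n = S' n := by
  induction n using Nat.strong_induction_on with
  | _ n ih =>
  rcases Nat.eq_zero_or_pos n with rfl | hn
  · rw [hS.zero, hS'.zero]
  have hH : H 0 = 0 := by simpa [hS.zero] using (hS.deriv 0).symm
  refine smul_right_injective E (Nat.cast_ne_zero.2 hn.ne' : (n : k) ≠ 0) ?_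
  dsimp only
  rw [hS.deriv, hS'.deriv]
  refine sum_congr rfl fun r hr => ?_
  rw [HasAntidiagonal.mem_antidiagonal] at hr
  rcases Nat.eq_zero_or_pos r.1 with h0 | h0
  · simp [h0, hH]
  · rw [ih _ (by omega)]

section FockSpace

variable {N : ℕ} {R : Type*} [CommRing R] [Algebra Fq R]

/-- The underlying space of the Fock representation. -/
abbrev FockSpace (N : ℕ) (R : Type*) [CommRing R] : Type _ :=
  List (Fin N × ℤ) →₀ MvPolynomial (Fin N × ℤ) R

namespace Fock

variable (d : Fin N → ℤ) (A : Fin N → Fin N → ℤ) (g κ : Rˣ)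

/-- The scalar in `[h_{i,m}, x^±_{j,l}]`. -/
def hxCoeff (i j : Fin N) (m : ℤ) : Fq := (m : Fq)⁻¹ * qint d i (m * A i j)

/-- The value of `[h_{i,m}, h_{j,-m}]`. -/
def hhCoeff (i j : Fin N) (m : ℤ) : R :=
  (hxCoeff d A i j m * (qi d j - (qi d j)⁻¹)⁻¹) • (((g ^ (2 * m) : Rˣ) : R) - (g ^ (-(2 * m)) : Rˣ))

/-- The action of `K_i` with value `κ` on the vacuum. -/
def opK (i : Fin N) : Module.End R (FockSpace N R) :=
  WordModule.diag ((κ : R) • 1) fun x => (qp d A i x.1)⁻¹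

/-- The action of the inverse of `K_i`. -/
def opKinv (i : Fin N) : Module.End R (FockSpace N R) :=
  WordModule.diag (((κ⁻¹ : Rˣ) : R) • 1) fun x => qp d A i x.1

/-- The grading operator. -/
def opD (N : ℕ) (R : Type*) [CommRing R] [Algebra Fq R] (s : Fq) : Module.End R (FockSpace N R) :=
  WordModule.diag (gradeEnd (Fin N) R s) fun x => s ^ x.2

/-- The action of `h_{i,m}` on the polynomial Fock space. -/
def baseH (i : Fin N) (m : ℤ) : Module.End R (MvPolynomial (Fin N × ℤ) R) :=
  heis (i, m) fun y => if m < 0 ∧ y.2 = -m then hhCoeff d A g i y.1 m else 0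

/-- The action of `h_{i,m}`. -/
def opH (i : Fin N) (m : ℤ) : Module.End R (FockSpace N R) :=
  if m = 0 then 0 else WordModule.shift m (baseH d A g i m) fun x =>
    -(hxCoeff d A i x.1 m • ((g ^ |m| : Rˣ) : R))

/-- The action of the generators other than the `x^+`. -/
def lowGen : Gen N → Module.End R (FockSpace N R)
  | xp _ _ => 0
  | xm i r => WordModule.prepend R _ (i, r)
  | Gen.h i s => opH d A g i s
  | Gen.K i => opK d A κ i
  | Kinv i => opKinv d A κ i
  | g2 => (g : R) • 1
  | g2inv => ((g⁻¹ : Rˣ) : R) • 1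
  | Gen.D => opD N R qq
  | Dinv => opD N R qq⁻¹

/-- The extension of `lowGen` to the free algebra. -/
def low : FA N →ₐ[Fq] Module.End R (FockSpace N R) :=
  FreeAlgebra.lift Fq (lowGen d A g κ)

/-- The right hand side of the relation for `[x^+_{i,k}, x^-_{j,l}]`. -/
def crossElt (i j : Fin N) (k l : ℤ) : FA N :=
  if i = j then
    ((qi d i - (qi d i)⁻¹)⁻¹) •
      (gammaHalf (k - l) * psiEl d i (k + l) - gammaHalf (l - k) * phiEl d i (k + l))
  else 0

/-- The action of `x^+_{i,r}`. -/
def opXp (i : Fin N) (r : ℤ) : Module.End R (FockSpace N R) :=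
  WordModule.lower fun x => low d A g κ (crossElt d i x.1 r x.2)

/-- The action of the generators. -/
def repGen : Gen N → Module.End R (FockSpace N R)
  | xp i r => opXp d A g κ i r
  | x => lowGen d A g κ x

/-- The Fock representation. -/
def rep : FA N →ₐ[Fq] Module.End R (FockSpace N R) :=
  FreeAlgebra.lift Fq (repGen d A g κ)

variable {d A} {g κ}

theorem low_e (x : Gen N) : low d A g κ (e x) = lowGen d A g κ x := by simp [low, e]

theorem rep_e (x : Gen N) : rep d A g κ (e x) = repGen d A g κ x := by simp [rep, e]

theorem low_gammaHalf (m : ℤ) : low d A g κ (gammaHalf m) = ((g ^ m : Rˣ) : R) • 1 := by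
  unfold gammaHalf
  split_ifs with hm
  · obtain ⟨n, rfl⟩ := Int.eq_ofNat_of_zero_le hm
    simp [low_e, lowGen, smul_pow]
  · obtain ⟨n, hn⟩ := Int.eq_ofNat_of_zero_le (show 0 ≤ -m by omega)
    obtain rfl : m = -(n : ℤ) := by omega
    simp only [neg_neg, Int.toNat_natCast, map_pow, zpow_neg, zpow_natCast, ← inv_pow,
      Units.val_pow_eq_pow_val, low_e, lowGen, smul_pow, one_pow]

theorem rep_gammaHalf (m : ℤ) : rep d A g κ (gammaHalf m) = ((g ^ m : Rˣ) : R) • 1 := by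
  rw [← low_gammaHalf (d := d) (A := A) (g := g) (κ := κ)]
  unfold gammaHalf
  split_ifs <;> simp only [map_pow, low_e, rep_e] <;> rfl

theorem rep_crossElt (i j : Fin N) (k l : ℤ) :
    rep d A g κ (crossElt d i j k l) = low d A g κ (crossElt d i j k l) := by
  have h0 : ∀ s, rep d A g κ (e (Gen.h i s)) = low d A g κ (e (Gen.h i s)) := fun s => by
    rw [rep_e, low_e]
    rfl
  have h1 : ∀ n, rep d A g κ (Ppos d i n) = low d A g κ (Ppos d i n) := by
    have := CoreRep.ppos_isExpSeq (E := Module.End R (FockSpace N R)) (d := d) (rep d A g κ) i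
    simp only [h0] at this
    have hl := CoreRep.ppos_isExpSeq (E := Module.End R (FockSpace N R)) (d := d) (low d A g κ) i
    intro n
    have := this.unique hl n
    exact this
  have h2 : ∀ n, rep d A g κ (Pneg d i n) = low d A g κ (Pneg d i n) := by
    have := CoreRep.pneg_isExpSeq (E := Module.End R (FockSpace N R)) (d := d) (rep d A g κ) i
    simp only [h0] at this
    have hl := CoreRep.pneg_isExpSeq (E := Module.End R (FockSpace N R)) (d := d) (low d A g κ) i
    intro n
    have := this.unique hl n
    exact this
  have h3 : ∀ m, rep d A g κ (psiEl d i m) = low d A g κ (psiEl d i m) := fun m => by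
    unfold psiEl
    split_ifs
    · rw [map_mul, map_mul, h1, rep_e, low_e]
      rfl
    · rw [map_zero, map_zero]
  have h4 : ∀ m, rep d A g κ (phiEl d i m) = low d A g κ (phiEl d i m) := fun m => by
    unfold phiEl
    split_ifs
    · rw [map_mul, map_mul, h2, rep_e, low_e]
      rfl
    · rw [map_zero, map_zero]
  unfold crossElt
  split_ifs
  · simp only [map_smul, map_sub, map_mul, h3, h4, low_gammaHalf, rep_gammaHalf]
  · rw [map_zero, map_zero]

theorem opK_mul_opK (i j : Fin N) : opK d A κ i * opK d A κ j = opK d A κ j * opK d A κ i := by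
  rw [opK, opK, WordModule.diag_mul_diag, WordModule.diag_mul_diag, mul_comm (fun x => _)]

theorem opK_mul_opKinv (i : Fin N) : opK d A κ i * opKinv d A κ i = 1 := by
  rw [opK, opKinv, WordModule.diag_mul_diag,
    ← WordModule.diag_one (k := Fq) (ι := Fin N) (R := R) (C := MvPolynomial (Fin N × ℤ) R)]
  congr 1
  · simp [smul_smul]
  · funext x
    simp [inv_mul_cancel₀ (qp_ne_zero d A i x.1)]

theorem opKinv_mul_opK (i : Fin N) : opKinv d A κ i * opK d A κ i = 1 := by
  rw [opK, opKinv, WordModule.diag_mul_diag,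
    ← WordModule.diag_one (k := Fq) (ι := Fin N) (R := R) (C := MvPolynomial (Fin N × ℤ) R)]
  congr 1
  · simp [smul_smul]
  · funext x
    simp [mul_inv_cancel₀ (qp_ne_zero d A i x.1)]

theorem opD_mul_opD {s s' : Fq} (h : s * s' = 1) : opD N R s * opD N R s' = 1 := by
  rw [opD, opD, WordModule.diag_mul_diag,
    ← WordModule.diag_one (k := Fq) (ι := Fin N) (R := R) (C := MvPolynomial (Fin N × ℤ) R),
    gradeEnd_mul, h, gradeEnd_one]
  congr 1
  funext x
  simp [← mul_zpow, h]

theorem opK_mul_opD (i : Fin N) (s : Fq) : opK d A κ i * opD N R s = opD N R s * opK d A κ i := by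
  rw [opK, opD, WordModule.diag_mul_diag, WordModule.diag_mul_diag, mul_comm (fun x => _)]
  simp

theorem opK_mul_opH (i j : Fin N) (m : ℤ) :
    opK d A κ i * opH d A g j m = opH d A g j m * opK d A κ i := by
  unfold opH
  split_ifs
  · simp
  · have := WordModule.diag_mul_shift (β := (κ : R) • 1) (β' := baseH d A g j m)
      (s := fun x => (qp d A i x.1)⁻¹) (m := m) (p := 1)
      (c := fun x => -(hxCoeff d A j x.1 m • ((g ^ |m| : Rˣ) : R))) (by simp) (by simp)
    rwa [one_smul] at this

theorem opD_mul_opH {s : Fq} (hs : s ≠ 0) (j : Fin N) (m : ℤ) :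
    opD N R s * opH d A g j m = s ^ m • (opH d A g j m * opD N R s) := by
  unfold opH
  split_ifs
  · simp
  · refine WordModule.diag_mul_shift (gradeEnd_mul_heis hs (j, m) fun y hy => ?_) fun x => ?_
    · rw [if_neg (fun h => hy h.2)]
    · rw [add_comm, zpow_add₀ hs]

theorem hhCoeff_symm (hd : ∀ i, 0 < d i) (hsym : ∀ i j, d i * A i j = d j * A j i) (i j : Fin N)
    (m : ℤ) : hhCoeff d A g i j m = -hhCoeff d A g j i (-m) := by
  have h1 : hxCoeff d A i j m * (qi d j - (qi d j)⁻¹)⁻¹ =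
      hxCoeff d A j i (-m) * (qi d i - (qi d i)⁻¹)⁻¹ := by
    have h2 : ∀ i j, qi d i ^ (m * A i j) = qp d A i j ^ m := fun i j => by
      rw [qp_eq_qi_zpow, ← zpow_mul, mul_comm]
    have h3 : ∀ i j, qi d i ^ (-(m * A i j)) = qp d A i j ^ (-m) := fun i j => by
      rw [qp_eq_qi_zpow, ← zpow_mul, mul_neg, mul_comm]
    have hi := (qi_notRoot hd i).sub_inv_ne_zero
    have hj := (qi_notRoot hd j).sub_inv_ne_zero
    unfold hxCoeff qint
    rw [neg_mul, neg_neg, h2, h2, h3, h3, qp_symm hsym i j, Int.cast_neg, inv_neg]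
    simp only [div_eq_mul_inv]
    ring
  unfold hhCoeff
  rw [h1, mul_neg, neg_neg, ← smul_neg, neg_sub]

theorem opH_commutator (hd : ∀ i, 0 < d i) (hsym : ∀ i j, d i * A i j = d j * A j i)
    (i j : Fin N) {k l : ℤ} (hk : k ≠ 0) (hl : l ≠ 0) :
    opH d A g i k * opH d A g j l - opH d A g j l * opH d A g i k =
      if l = -k then hhCoeff d A g i j k • 1 else 0 := by
  rw [opH, opH, if_neg hk, if_neg hl]
  have key := heis_commutator (i, k) (j, l)
    (fun y => if k < 0 ∧ y.2 = -k then hhCoeff d A g i y.1 k else 0)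
    (fun y => if l < 0 ∧ y.2 = -l then hhCoeff d A g j y.1 l else 0)
  unfold baseH
  rw [WordModule.shift_commutator key (fun _ => rfl) (fun _ => rfl)]
  by_cases h : l = -k
  · subst h
    rcases lt_or_gt_of_ne hk with h | h
    · simp [h, not_lt.2 h.le]
    · simp [h, not_lt.2 h.le, hhCoeff_symm hd hsym i j k]
  · have h' : k ≠ -l := by omega
    simp [h, h']

end Fock
end FockSpace

section CrossElements

namespace Fock

variable {N : ℕ} {R : Type*} [CommRing R] [Algebra Fq R] {d : Fin N → ℤ} {g : Rˣ}
  {E : Type*} [Ring E] [Algebra R E] [Algebra Fq E] [IsScalarTower Fq R E] {ρ : FA N →ₐ[Fq] E}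

theorem mul_map_psiEl_of_grade {p : E} {s : Fq} {i : Fin N}
    (hK : p * ρ (e (Gen.K i)) = ρ (e (Gen.K i)) * p)
    (hh : ∀ m, p * ρ (e (Gen.h i m)) = s ^ m • (ρ (e (Gen.h i m)) * p)) (m : ℤ) :
    p * ρ (psiEl d i m) = s ^ m • (ρ (psiEl d i m) * p) := by
  unfold psiEl
  split_ifs with hm
  · lift m to ℕ using hm
    have := (CoreRep.ppos_isExpSeq (d := d) ρ i).mul_comm_scale (c := s) (p := p) (fun a => by
      rw [mul_smul_comm, hh, smul_mul_assoc, zpow_natCast, smul_comm]) m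
    rw [map_mul, ← mul_assoc, hK, mul_assoc, Int.toNat_natCast, this, mul_smul_comm, mul_assoc,
      zpow_natCast]
  · simp

theorem mul_map_phiEl_of_grade {p : E} {s : Fq} {i : Fin N}
    (hK : p * ρ (e (Kinv i)) = ρ (e (Kinv i)) * p)
    (hh : ∀ m, p * ρ (e (Gen.h i m)) = s ^ m • (ρ (e (Gen.h i m)) * p)) (m : ℤ) :
    p * ρ (phiEl d i m) = s ^ m • (ρ (phiEl d i m) * p) := by
  unfold phiEl
  split_ifs with hm
  · obtain ⟨n, hn⟩ := Int.eq_ofNat_of_zero_le (show 0 ≤ -m by omega)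
    obtain rfl : m = -(n : ℤ) := by omega
    have := (CoreRep.pneg_isExpSeq (d := d) ρ i).mul_comm_scale (c := s⁻¹) (p := p) (fun a => by
      rw [mul_smul_comm, hh, smul_mul_assoc, zpow_neg, zpow_natCast, inv_pow, smul_comm]) n
    rw [map_mul, ← mul_assoc, hK, mul_assoc, neg_neg, Int.toNat_natCast, this, mul_smul_comm,
      mul_assoc, zpow_neg, zpow_natCast, inv_pow]
  · simp

theorem mul_map_crossElt_of_grade (hg : ∀ m, ρ (gammaHalf m) = ((g ^ m : Rˣ) : R) • 1)
    {p : E} {s : Fq} {i : Fin N} (hK : p * ρ (e (Gen.K i)) = ρ (e (Gen.K i)) * p)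
    (hK' : p * ρ (e (Kinv i)) = ρ (e (Kinv i)) * p)
    (hh : ∀ m, p * ρ (e (Gen.h i m)) = s ^ m • (ρ (e (Gen.h i m)) * p)) (j : Fin N) (k l : ℤ) :
    p * ρ (crossElt d i j k l) = s ^ (k + l) • (ρ (crossElt d i j k l) * p) := by
  unfold crossElt
  split_ifs with h
  · simp only [map_smul, map_sub, map_mul, hg, smul_mul_assoc, one_mul, mul_smul_comm, mul_sub,
      sub_mul, mul_map_psiEl_of_grade hK hh, mul_map_phiEl_of_grade hK' hh, smul_sub,
      smul_comm (s ^ (k + l))]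
  · simp

theorem map_crossElt_commutator (hg : ∀ m, ρ (gammaHalf m) = ((g ^ m : Rˣ) : R) • 1)
    (hd : ∀ i, 0 < d i) {p : E} {c : Fq} {i : Fin N} {k : ℤ} (hk : k ≠ 0)
    (hK : p * ρ (e (Gen.K i)) = ρ (e (Gen.K i)) * p)
    (hK' : p * ρ (e (Kinv i)) = ρ (e (Kinv i)) * p)
    (hh : ∀ m, p * ρ (e (Gen.h i m)) - ρ (e (Gen.h i m)) * p = if m = -k then
      ((c * (qi d i - (qi d i)⁻¹)⁻¹) • (((g ^ (2 * k) : Rˣ) : R) - (g ^ (-(2 * k)) : Rˣ))) • 1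
      else 0) (l m : ℤ) :
    p * ρ (crossElt d i i l m) - ρ (crossElt d i i l m) * p =
      -(c • ((g ^ |k| : Rˣ) : R)) • ρ (crossElt d i i l (m + k)) +
        (c • ((g ^ (-|k|) : Rˣ) : R)) • ρ (crossElt d i i (k + l) m) := by
  have hq := (qi_notRoot hd i).sub_inv_ne_zero
  set z : R := c • (((g ^ (-(2 * |k|)) : Rˣ) : R) - (g ^ (2 * |k|) : Rˣ)) with hz
  have hpsi : ∀ n, p * ρ (psiEl d i n) - ρ (psiEl d i n) * p =
      if 0 < k then 0 else z • ρ (psiEl d i (n + k)) := by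
    intro n
    by_cases hn : 0 ≤ n
    swap
    · have h1 : ¬ 0 ≤ n + k ∨ 0 < k := by omega
      rcases h1 with h1 | h1 <;> simp [psiEl, hn, h1]
    lift n to ℕ using hn
    have h1 : p * ρ (Ppos d i n) - ρ (Ppos d i n) * p =
        if 0 < k then 0 else if k.natAbs ≤ n then (z • 1) * ρ (Ppos d i (n - k.natAbs)) else 0 := by
      split_ifs with h1 h2
      · refine sub_eq_zero.2 ((CoreRep.ppos_isExpSeq ρ i).commute (fun a => ?_) n).eq
        refine Commute.smul_right (sub_eq_zero.1 ((hh a).trans (if_neg (by omega)))) _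
      all_goals
        have := (CoreRep.ppos_isExpSeq (d := d) ρ i).commutator (p := p) (z := z • 1)
          (b := k.natAbs) (by omega) (by simp) (fun a => ?_) n
        · rw [this]; simp [h2]
        rw [mul_smul_comm, smul_mul_assoc, ← smul_sub, hh]
        by_cases h3 : a = k.natAbs
        · have h4 : |k| = a := by rw [h3, Int.natCast_natAbs]
          have h5 : k = -(a : ℤ) := by omega
          rw [if_pos h3, if_pos (by omega), ← h3, hz, h4, h5, smul_assoc, smul_smul, smul_assoc c,
            smul_smul, mul_neg, neg_neg]
          congr 1
          generalize qi d i - (qi d i)⁻¹ = w at hq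
          field_simp
        · rw [if_neg h3, if_neg (by omega), smul_zero]
    have h2 : p * ρ (psiEl d i n) - ρ (psiEl d i n) * p =
        ρ (e (Gen.K i)) * (p * ρ (Ppos d i n) - ρ (Ppos d i n) * p) := by
      rw [psiEl, if_pos (by omega), map_mul, Int.toNat_natCast, ← mul_assoc, hK, mul_sub,
        mul_assoc, mul_assoc]
    rw [h2, h1]
    split_ifs with h3 h4
    · simp
    · rw [psiEl, if_pos (by omega), map_mul, smul_mul_assoc, one_mul, mul_smul_comm]
      congr 5
      omega
    · rw [psiEl, if_neg (by omega)]
      simp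
  have hphi : ∀ n, p * ρ (phiEl d i n) - ρ (phiEl d i n) * p =
      if 0 < k then z • ρ (phiEl d i (n + k)) else 0 := by
    intro n
    by_cases hn : n ≤ 0
    swap
    · have h1 : ¬ n + k ≤ 0 ∨ ¬ 0 < k := by omega
      rcases h1 with h1 | h1 <;> simp [phiEl, hn, h1]
    obtain ⟨a, ha⟩ := Int.eq_ofNat_of_zero_le (show 0 ≤ -n by omega)
    obtain rfl : n = -(a : ℤ) := by omega
    clear ha
    have h1 : p * ρ (Pneg d i a) - ρ (Pneg d i a) * p =
        if 0 < k then if k.natAbs ≤ a then (z • 1) * ρ (Pneg d i (a - k.natAbs)) else 0 else 0 := by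
      split_ifs with h1 h2
      rotate_right
      · refine sub_eq_zero.2 ((CoreRep.pneg_isExpSeq ρ i).commute (fun a => ?_) a).eq
        refine Commute.smul_right (sub_eq_zero.1 ((hh (-a)).trans (if_neg (by omega)))) _
      all_goals
        have := (CoreRep.pneg_isExpSeq (d := d) ρ i).commutator (p := p) (z := z • 1)
          (b := k.natAbs) (by omega) (by simp) (fun a => ?_) a
        · rw [this]; simp [h2]
        rw [mul_smul_comm, smul_mul_assoc, ← smul_sub, hh]
        by_cases h3 : a = k.natAbs
        · have h4 : |k| = a := by rw [h3, Int.natCast_natAbs]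
          have h5 : k = (a : ℤ) := by omega
          rw [if_pos h3, if_pos (by omega), ← h3, hz, h4, h5, smul_assoc, smul_smul, smul_assoc c,
            smul_smul, ← neg_sub ((g ^ (2 * (a : ℤ)) : Rˣ) : R), neg_smul _ (1 : E), smul_neg,
            mul_neg,
            neg_mul, neg_smul]
          congr 2
          generalize qi d i - (qi d i)⁻¹ = w at hq
          field_simp
        · rw [if_neg h3, if_neg (by omega), smul_zero]
    have h2 : p * ρ (phiEl d i (-a)) - ρ (phiEl d i (-a)) * p =
        ρ (e (Kinv i)) * (p * ρ (Pneg d i a) - ρ (Pneg d i a) * p) := by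
      rw [phiEl, if_pos (by omega), map_mul, neg_neg, Int.toNat_natCast, ← mul_assoc, hK', mul_sub,
        mul_assoc, mul_assoc]
    rw [h2, h1]
    split_ifs with h3 h4
    · rw [phiEl, if_pos (by omega), map_mul, smul_mul_assoc, one_mul, mul_smul_comm]
      congr 5
      omega
    · rw [phiEl, if_neg (by omega)]
      simp
    · simp
  have hgm : ∀ m n : ℤ, ((g ^ (m + n) : Rˣ) : R) = (g ^ m : Rˣ) * (g ^ n : Rˣ) :=
    fun (m n : ℤ) => by rw [zpow_add, Units.val_mul]
  have h1 : p * ρ (crossElt d i i l m) - ρ (crossElt d i i l m) * p =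
      (qi d i - (qi d i)⁻¹)⁻¹ •
        (((g ^ (l - m) : Rˣ) : R) • (p * ρ (psiEl d i (l + m)) - ρ (psiEl d i (l + m)) * p) -
          ((g ^ (m - l) : Rˣ) : R) • (p * ρ (phiEl d i (l + m)) - ρ (phiEl d i (l + m)) * p)) := by
    simp only [crossElt, if_true, map_smul, map_sub, map_mul, hg, smul_mul_assoc, one_mul,
      mul_smul_comm, mul_sub, sub_mul, smul_sub]
    abel
  rw [h1, hpsi, hphi]
  simp only [crossElt, if_true, map_smul, map_sub, map_mul, hg, smul_mul_assoc, one_mul]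
  rw [show l + (m + k) = l + m + k by ring, show k + l + m = l + m + k by ring]
  have hc : ∀ (x : E), (qi d i - (qi d i)⁻¹)⁻¹ • x =
      algebraMap Fq R (qi d i - (qi d i)⁻¹)⁻¹ • x := fun x => (algebraMap_smul R _ x).symm
  have hcR : ∀ x : R, c • x = algebraMap Fq R c * x := Algebra.smul_def c
  rw [hz]
  simp only [hc, hcR]
  rw [show l - (m + k) = (l - m) + -k by ring, show m + k - l = (m - l) + k by ring,
    show k + l - m = (l - m) + k by ring, show m - (k + l) = (m - l) + -k by ring]
  rcases lt_or_gt_of_ne hk with h | h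
  · rw [if_neg (by omega), if_neg (by omega), abs_of_neg h]
    simp only [mul_neg, neg_neg, two_mul, neg_add_rev, hgm]
    match_scalars <;> ring
  · rw [if_pos (by omega), if_pos (by omega), abs_of_pos h]
    simp only [two_mul, neg_add_rev, hgm]
    match_scalars <;> ring

end Fock
end CrossElements

section FockRepresentation

namespace Fock

variable {N : ℕ} {R : Type*} [CommRing R] [Algebra Fq R] {d : Fin N → ℤ} {A : Fin N → Fin N → ℤ}
  {g κ : Rˣ}

theorem opKinv_comm {i : Fin N} {z : Module.End R (FockSpace N R)}
    (h : z * opK d A κ i = opK d A κ i * z) : z * opKinv d A κ i = opKinv d A κ i * z := by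
  have h1 := congrArg (fun y => opKinv d A κ i * y * opKinv d A κ i) h
  simp only [mul_assoc, opK_mul_opKinv, mul_one] at h1
  rw [← mul_assoc, opKinv_mul_opK, one_mul] at h1
  exact h1.symm

theorem mul_crossElt_of_grade {p : Module.End R (FockSpace N R)} {s : Fq}
    (hK : ∀ i, p * opK d A κ i = opK d A κ i * p)
    (hh : ∀ i m, p * opH d A g i m = s ^ m • (opH d A g i m * p)) (i j : Fin N) (k l : ℤ) :
    p * low d A g κ (crossElt d i j k l) = s ^ (k + l) •
      (low d A g κ (crossElt d i j k l) * p) := by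
  refine mul_map_crossElt_of_grade (E := Module.End R (FockSpace N R)) low_gammaHalf ?_ ?_ ?_ j k l
  · rw [low_e]
    exact hK i
  · rw [low_e]
    exact opKinv_comm (hK i)
  · intro m
    rw [low_e]
    exact hh i m

theorem opK_mul_opXp (i j : Fin N) (r : ℤ) :
    opK d A κ i * opXp d A g κ j r = qp d A i j • (opXp d A g κ j r * opK d A κ i) := by
  refine WordModule.diag_mul_lower fun x => ?_
  have := mul_crossElt_of_grade (d := d) (A := A) (κ := κ) (g := g) (p := opK d A κ i) (s := 1)
    (opK_mul_opK i) (fun j m => by rw [one_zpow, one_smul, opK_mul_opH]) j x.1 r x.2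
  rw [one_zpow, one_smul] at this
  by_cases h : j = x.1
  · subst h
    rw [mul_inv_cancel₀ (qp_ne_zero d A i _), one_smul]
    exact this
  · simp [crossElt, h]

theorem opD_mul_opXp {s : Fq} (hs : s ≠ 0) (j : Fin N) (r : ℤ) :
    opD N R s * opXp d A g κ j r = s ^ r • (opXp d A g κ j r * opD N R s) := by
  refine WordModule.diag_mul_lower fun x => ?_
  rw [← zpow_add₀ hs]
  exact mul_crossElt_of_grade (fun i => (opK_mul_opD i s).symm) (opD_mul_opH hs) j x.1 r x.2

theorem opH_opXp_commutator (hd : ∀ i, 0 < d i) (hsym : ∀ i j, d i * A i j = d j * A j i)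
    (i j : Fin N) {k : ℤ} (l : ℤ) (hk : k ≠ 0) :
    opH d A g i k * opXp d A g κ j l - opXp d A g κ j l * opH d A g i k =
      (hxCoeff d A i j k • ((g ^ (-|k|) : Rˣ) : R)) • opXp d A g κ j (k + l) := by
  have hH : opH d A g i k = WordModule.shift k (baseH d A g i k) fun x =>
      -(hxCoeff d A i x.1 k • ((g ^ |k| : Rˣ) : R)) := if_neg hk
  rw [hH]
  refine WordModule.shift_lower_commutator fun x => ?_
  rw [← hH]
  by_cases h : j = x.1
  · obtain ⟨x, m⟩ := x
    dsimp only at h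
    subst h
    refine map_crossElt_commutator (E := Module.End R (FockSpace N R)) low_gammaHalf hd hk ?_ ?_
      (fun m => ?_) l m
    · rw [low_e]
      exact (opK_mul_opH j i k).symm
    · rw [low_e]
      exact opKinv_comm (opK_mul_opH j i k).symm
    · rw [low_e]
      rcases eq_or_ne m 0 with rfl | hm
      · rw [if_neg (by omega)]
        simp [lowGen, opH]
      · exact (opH_commutator hd hsym i j hk hm)
  · simp [crossElt, h]

omit [Algebra Fq R] in
theorem smul_mul_right {z : R} {p : Module.End R (FockSpace N R)} : p * (z • 1) = z • 1 * p := by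
  simp

omit [Algebra Fq R] in
theorem sub_smul_one (a b : R) :
    (a - b) • (1 : Module.End R (FockSpace N R)) = a • 1 - b • 1 := by
  have := sub_smul a b (1 : Module.End R (FockSpace N R))
  exact this

theorem rep_coreRep (hd : ∀ i, 0 < d i) (hsym : ∀ i j, d i * A i j = d j * A j i) :
    CoreRep (E := Module.End R (FockSpace N R)) d A (rep d A g κ) := by
  have hq : qq ≠ 0 := qq_notRoot.1
  have hDD : opD N R qq * opD N R qq⁻¹ = 1 := opD_mul_opD (mul_inv_cancel₀ hq)
  have hDD' : opD N R qq⁻¹ * opD N R qq = 1 := opD_mul_opD (inv_mul_cancel₀ hq)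
  refine ⟨fun a b hab => ?_, fun z => ?_⟩
  · induction hab with
    | K_Kinv i =>
      simp only [map_mul, map_one, rep_e]
      exact opK_mul_opKinv i
    | Kinv_K i =>
      simp only [map_mul, map_one, rep_e]
      exact opKinv_mul_opK i
    | D_Dinv =>
      simp only [map_mul, map_one, rep_e]
      exact hDD
    | Dinv_D =>
      simp only [map_mul, map_one, rep_e]
      exact hDD'
    | g_ginv => simp [rep_e, repGen, lowGen, smul_smul]
    | ginv_g => simp [rep_e, repGen, lowGen, smul_smul]
    | g2_comm x =>
      rw [map_mul, map_mul, rep_e, rep_e]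
      exact smul_mul_right.symm
    | g2inv_comm x =>
      rw [map_mul, map_mul, rep_e, rep_e]
      exact smul_mul_right.symm
    | K_comm_K i j =>
      simp only [map_mul, rep_e]
      exact opK_mul_opK i j
    | K_comm_D i =>
      simp only [map_mul, rep_e]
      exact opK_mul_opD i qq
    | K_comm_h i j s =>
      simp only [map_mul, rep_e]
      exact opK_mul_opH i j s
    | h_zero i => simp [rep_e, repGen, lowGen, opH]
    | D_h i s =>
      simp only [map_mul, map_smul, rep_e]
      have := opD_mul_opH (R := R) (d := d) (A := A) (g := g) hq i s
      simp only [repGen, lowGen, this, smul_mul_assoc, mul_assoc, hDD, mul_one]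
    | D_xp i r =>
      simp only [map_mul, map_smul, rep_e]
      have := opD_mul_opXp (R := R) (d := d) (A := A) (g := g) (κ := κ) hq i r
      simp only [repGen, lowGen, this, smul_mul_assoc, mul_assoc, hDD, mul_one]
    | D_xm i r =>
      simp only [map_mul, map_smul, rep_e]
      have : opD N R qq * WordModule.prepend R _ (i, r) =
          qq ^ r • (WordModule.prepend R _ (i, r) * opD N R qq) := WordModule.diag_mul_prepend _ _ _
      simp only [repGen, lowGen, this, smul_mul_assoc, mul_assoc, hDD, mul_one]
    | K_xp i j r =>
      simp only [map_mul, map_smul, rep_e]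
      simp only [repGen, lowGen, opK_mul_opXp, smul_mul_assoc, mul_assoc, opK_mul_opKinv, mul_one]
    | K_xm i j r =>
      simp only [map_mul, map_smul, rep_e]
      have : opK d A κ i * WordModule.prepend R _ (j, r) =
          (qp d A i j)⁻¹ • (WordModule.prepend R _ (j, r) * opK d A κ i) :=
            WordModule.diag_mul_prepend _ _ _
      simp only [repGen, lowGen, this, smul_mul_assoc, mul_assoc, opK_mul_opKinv, mul_one]
    | h_h i j k l hk hl =>
      simp only [map_mul, map_sub, map_smul, rep_e, apply_ite (rep d A g κ), map_zero, gammaPow,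
        rep_gammaHalf]
      refine (opH_commutator hd hsym i j hk hl).trans ?_
      split_ifs
      · rw [hhCoeff, smul_assoc, mul_neg]
        exact congrArg _ (sub_smul_one _ _)
      · rfl
    | h_xp i j k l hk =>
      simp only [map_mul, map_sub, map_smul, rep_e, rep_gammaHalf, smul_mul_assoc, one_mul]
      rw [← smul_assoc]
      exact opH_opXp_commutator hd hsym i j l hk
    | h_xm i j k l hk =>
      simp only [map_mul, map_sub, map_smul, rep_e, rep_gammaHalf, smul_mul_assoc, one_mul]
      have hH : opH d A g i k = WordModule.shift k (baseH d A g i k) fun x =>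
          -(hxCoeff d A i x.1 k • ((g ^ |k| : Rˣ) : R)) := if_neg hk
      have := WordModule.shift_mul_prepend k (baseH d A g i k)
        (fun x => -(hxCoeff d A i x.1 k • ((g ^ |k| : Rˣ) : R))) (j, l)
      rw [← hH] at this
      rw [← smul_assoc, neg_smul, add_comm k, sub_eq_iff_eq_add']
      exact this
    | xp_xm i j k l =>
      rw [map_sub, map_mul, map_mul, sub_eq_iff_eq_add']
      change _ = _ + rep d A g κ (crossElt d i j k l)
      rw [rep_crossElt, rep_e, rep_e]
      exact WordModule.lower_mul_prepend _ (j, l)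
  · rw [rep_e]
    exact smul_mul_right.symm

theorem rep_xm (i : Fin N) (r : ℤ) : rep d A g κ (e (xm i r)) = WordModule.prepend R _ (i, r) := by
  rw [rep_e]
  rfl

theorem rep_xp_vac (i : Fin N) (r : ℤ) (c : MvPolynomial (Fin N × ℤ) R) :
    rep d A g κ (e (xp i r)) (Finsupp.single [] c) = 0 := by
  rw [rep_e]
  exact WordModule.lower_vac _ _

end Fock
end FockRepresentation

section Relations

variable {N : ℕ} {d : Fin N → ℤ} {A : Fin N → Fin N → ℤ} {E : Type*} [Ring E] [Algebra Fq E]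
  {ρ : FA N →ₐ[Fq] E}

theorem QRelCore.toQRel {a b : FA N} (h : QRelCore N d A a b) : QRel N d A a b := by
  cases h with
  | K_Kinv i => exact .K_Kinv i
  | Kinv_K i => exact .Kinv_K i
  | D_Dinv => exact .D_Dinv
  | Dinv_D => exact .Dinv_D
  | g_ginv => exact .g_ginv
  | ginv_g => exact .ginv_g
  | g2_comm x => exact .g2_comm x
  | g2inv_comm x => exact .g2inv_comm x
  | K_comm_K i j => exact .K_comm_K i j
  | K_comm_D i => exact .K_comm_D i
  | K_comm_h i j s => exact .K_comm_h i j s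
  | h_zero i => exact .h_zero i
  | D_h i s => exact .D_h i s
  | D_xp i r => exact .D_xp i r
  | D_xm i r => exact .D_xm i r
  | K_xp i j r => exact .K_xp i j r
  | K_xm i j r => exact .K_xm i j r
  | h_h i j k l hk hl => exact .h_h i j k l hk hl
  | h_xp i j k l hk => exact .h_xp i j k l hk
  | h_xm i j k l hk => exact .h_xm i j k l hk
  | xp_xm i j k l => exact .xp_xm i j k l

/-- A representation of the core relations killing the quadratic and the Drinfeld-Serre elements
factors through the quantum affine algebra. -/
theorem CoreRep.map_eq_of_qRel (h : CoreRep d A ρ)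
    (hq : ∀ pm i j m l, ρ (quadElt d A pm i j m l) = 0)
    (hs : ∀ pm i j, i ≠ j → ∀ ks l, ρ (serreElt d A pm i j ks l) = 0) ⦃a b : FA N⦄
    (hab : QRel N d A a b) : ρ a = ρ b := by
  cases hab with
  | K_Kinv i => exact h.rel _ _ (.K_Kinv i)
  | Kinv_K i => exact h.rel _ _ (.Kinv_K i)
  | D_Dinv => exact h.rel _ _ .D_Dinv
  | Dinv_D => exact h.rel _ _ .Dinv_D
  | g_ginv => exact h.rel _ _ .g_ginv
  | ginv_g => exact h.rel _ _ .ginv_g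
  | g2_comm x => exact h.rel _ _ (.g2_comm x)
  | g2inv_comm x => exact h.rel _ _ (.g2inv_comm x)
  | K_comm_K i j => exact h.rel _ _ (.K_comm_K i j)
  | K_comm_D i => exact h.rel _ _ (.K_comm_D i)
  | K_comm_h i j s => exact h.rel _ _ (.K_comm_h i j s)
  | h_zero i => exact h.rel _ _ (.h_zero i)
  | D_h i s => exact h.rel _ _ (.D_h i s)
  | D_xp i r => exact h.rel _ _ (.D_xp i r)
  | D_xm i r => exact h.rel _ _ (.D_xm i r)
  | K_xp i j r => exact h.rel _ _ (.K_xp i j r)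
  | K_xm i j r => exact h.rel _ _ (.K_xm i j r)
  | h_h i j k l hk hl => exact h.rel _ _ (.h_h i j k l hk hl)
  | h_xp i j k l hk => exact h.rel _ _ (.h_xp i j k l hk)
  | h_xm i j k l hk => exact h.rel _ _ (.h_xm i j k l hk)
  | xp_xm i j k l => exact h.rel _ _ (.xp_xm i j k l)
  | serre_p i j k l =>
    have := hq true i j k l
    rw [quadElt, map_sub, sub_eq_zero] at this
    simpa [gx, sgn] using this
  | serre_m i j k l =>
    have := hq false i j k l
    rw [quadElt, map_sub, sub_eq_zero] at this
    simpa [gx, sgn] using this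
  | dserre pm i j hij ks l =>
    rw [map_zero]
    exact hs pm i j hij ks l

theorem CoreRep.D_mul_x (h : CoreRep d A ρ) (pm : Bool) (i : Fin N) (r : ℤ) :
    ρ (e Gen.D) * ρ (e (gx pm i r)) = qq ^ r • (ρ (e (gx pm i r)) * ρ (e Gen.D)) := by
  have h1 : ρ (e Gen.D * e (gx pm i r) * e Dinv) = ρ (qq ^ r • e (gx pm i r)) := by
    cases pm
    · exact h.rel _ _ (.D_xm i r)
    · exact h.rel _ _ (.D_xp i r)
  have h2 : ρ (e Dinv) * ρ (e Gen.D) = 1 := by simpa using h.rel _ _ .Dinv_D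
  simp only [map_mul, map_smul] at h1
  have h3 := congrArg (fun z => z * ρ (e Gen.D)) h1
  simpa only [mul_assoc, h2, mul_one, smul_mul_assoc] using h3

theorem CoreRep.x_mul_Dinv (h : CoreRep d A ρ) (pm : Bool) (i : Fin N) (r : ℤ) :
    ρ (e (gx pm i r)) * ρ (e Dinv) = qq ^ r • (ρ (e Dinv) * ρ (e (gx pm i r))) := by
  have h1 : ρ (e Gen.D) * ρ (e Dinv) = 1 := by simpa using h.rel _ _ .D_Dinv
  have h2 : ρ (e Dinv) * ρ (e Gen.D) = 1 := by simpa using h.rel _ _ .Dinv_D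
  have h3 := congrArg (fun z => ρ (e Dinv) * z * ρ (e Dinv)) (h.D_mul_x pm i r)
  simp only [mul_smul_comm, smul_mul_assoc, mul_assoc, h1, mul_one] at h3
  rwa [← mul_assoc, h2, one_mul] at h3

theorem map_quadElt_eq_zero_of_qRel (h : ∀ a b, QRel N d A a b → ρ a = ρ b) (pm : Bool)
    (i j : Fin N) (m l : ℤ) : ρ (quadElt d A pm i j m l) = 0 := by
  rw [quadElt, map_sub, sub_eq_zero]
  cases pm
  · simpa [gx, sgn] using h _ _ (.serre_m i j m l)
  · simpa [gx, sgn] using h _ _ (.serre_p i j m l)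

theorem map_serreElt_eq_zero_of_qRel (h : ∀ a b, QRel N d A a b → ρ a = ρ b) (pm : Bool)
    {i j : Fin N} (hij : i ≠ j) (ks : Fin (1 - A i j).toNat → ℤ) (l : ℤ) :
    ρ (serreElt d A pm i j ks l) = 0 :=
  (h _ _ (.dserre pm i j hij ks l)).trans (map_zero ρ)

end Relations

section StableSubmodules

variable {N : ℕ} {d : Fin N → ℤ} {A : Fin N → Fin N → ℤ} {R V : Type*} [CommRing R] [Algebra Fq R]
  [AddCommGroup V] [Module R V] [Module Fq V] [IsScalarTower Fq R V]

/-- The elements of the free algebra preserving a submodule. -/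
def stabilizer (ρ : FA N →ₐ[Fq] Module.End R V) (P : Submodule R V) : Subalgebra Fq (FA N) where
  carrier := {u | ∀ v ∈ P, ρ u v ∈ P}
  mul_mem' {a b} ha hb v hv := by
    rw [map_mul]
    exact ha _ (hb v hv)
  add_mem' {a b} ha hb v hv := by
    rw [map_add]
    exact P.add_mem (ha v hv) (hb v hv)
  algebraMap_mem' r v hv := by
    rw [AlgHom.commutes]
    exact P.smul_of_tower_mem r hv

theorem eq_top_of_e_mem {S : Subalgebra Fq (FA N)} (h : ∀ x, e x ∈ S) : S = ⊤ := by
  rw [← top_le_iff, ← FreeAlgebra.adjoin_range_ι, Algebra.adjoin_le_iff]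
  rintro _ ⟨x, rfl⟩
  exact h x

/-- The generators other than the `x^+`. -/
def Gen.IsLow : Gen N → Prop
  | xp _ _ => False
  | _ => True

theorem gammaHalf_mem {S : Subalgebra Fq (FA N)} (h1 : e g2 ∈ S) (h2 : e g2inv ∈ S) (m : ℤ) :
    gammaHalf m ∈ S := by
  unfold gammaHalf
  split_ifs
  · exact pow_mem h1 _
  · exact pow_mem h2 _

theorem Ppos_mem {S : Subalgebra Fq (FA N)} (i : Fin N) (h : ∀ m, e (Gen.h i m) ∈ S) (n : ℕ) :
    Ppos d i n ∈ S := by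
  induction n using Nat.strong_induction_on with
  | _ n ih =>
  cases n with
  | zero =>
    rw [Ppos]
    exact one_mem S
  | succ n =>
    rw [Ppos]
    exact S.smul_mem (sum_mem fun l _ => S.smul_mem (mul_mem (h _) (ih _ (by omega))) _) _

theorem Pneg_mem {S : Subalgebra Fq (FA N)} (i : Fin N) (h : ∀ m, e (Gen.h i m) ∈ S) (n : ℕ) :
    Pneg d i n ∈ S := by
  induction n using Nat.strong_induction_on with
  | _ n ih =>
  cases n with
  | zero =>
    rw [Pneg]
    exact one_mem S
  | succ n =>
    rw [Pneg]
    exact S.smul_mem (sum_mem fun l _ => S.smul_mem (mul_mem (h _) (ih _ (by omega))) _) _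

theorem crossElt_mem {S : Subalgebra Fq (FA N)} (h : ∀ x : Gen N, x.IsLow → e x ∈ S) (i j : Fin N)
    (k l : ℤ) : Fock.crossElt d i j k l ∈ S := by
  have hg := gammaHalf_mem (h g2 trivial) (h g2inv trivial)
  unfold Fock.crossElt psiEl phiEl
  split_ifs
  all_goals
    first
    | exact zero_mem S
    | refine S.smul_mem (sub_mem (mul_mem (hg _) ?_) (mul_mem (hg _) ?_)) _
  all_goals
    first
    | exact zero_mem S
    | exact mul_mem (h (Gen.K i) trivial) (Ppos_mem i (fun m => h (Gen.h i m) trivial) _)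
    | exact mul_mem (h (Kinv i) trivial) (Pneg_mem i (fun m => h (Gen.h i m) trivial) _)

/-- The largest subrepresentation contained in a submodule. -/
def innerRep (ρ : FA N →ₐ[Fq] Module.End R V) (P : Submodule R V) : Submodule R V where
  carrier := {v | ∀ u, ρ u v ∈ P}
  zero_mem' u := by simp
  add_mem' ha hb u := by
    rw [map_add]
    exact P.add_mem (ha u) (hb u)
  smul_mem' r v hv u := by
    rw [map_smul]
    exact P.smul_mem r (hv u)

variable {ρ : FA N →ₐ[Fq] Module.End R V} {P W : Submodule R V}

theorem innerRep_le : innerRep ρ P ≤ P := fun v hv => by simpa using hv 1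

theorem map_mem_innerRep (u : FA N) {v : V} (hv : v ∈ innerRep ρ P) : ρ u v ∈ innerRep ρ P :=
  fun u' => by
    rw [← Module.End.mul_apply, ← map_mul]
    exact hv _

theorem le_innerRep (h : CoreRep (E := Module.End R V) d A ρ)
    (hP : ∀ x : Gen N, x.IsLow → e x ∈ stabilizer ρ P) (hW : W ≤ P)
    (hWx : ∀ i r, e (xp i r) ∈ stabilizer ρ W) : W ≤ innerRep ρ P := by
  set Q : Submodule R V := sInf {Q | W ≤ Q ∧ ∀ x : Gen N, x.IsLow → e x ∈ stabilizer ρ Q} with hQ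
  have hWQ : W ≤ Q := le_sInf fun _ h => h.1
  have hQP : Q ≤ P := sInf_le ⟨hW, hP⟩
  have hlow : ∀ x : Gen N, x.IsLow → e x ∈ stabilizer ρ Q := by
    intro x hx v hv
    rw [hQ, Submodule.mem_sInf] at hv ⊢
    exact fun Q' hQ' => hQ'.2 x hx v (hv Q' hQ')
  have hγ := gammaHalf_mem (hlow g2 trivial) (hlow g2inv trivial)
  have hpos : ∀ i r, e (xp i r) ∈ stabilizer ρ Q := by
    let Q' : Submodule R V := Q ⊓ ⨅ (i : Fin N) (r : ℤ), Q.comap (ρ (e (xp i r)))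
    have hmem : ∀ {v}, v ∈ Q' ↔ v ∈ Q ∧ ∀ i r, ρ (e (xp i r)) v ∈ Q := by
      intro v
      simp [Q', Submodule.mem_iInf]
    have hQQ' : Q ≤ Q' := by
      refine sInf_le ⟨fun v hv => hmem.2 ⟨hWQ hv, fun i r => hWQ (hWx i r v hv)⟩, ?_⟩
      intro x hx v hv
      rw [hmem] at hv ⊢
      refine ⟨hlow x hx v hv.1, fun i r => ?_⟩
      have hv2 : ∀ i r, ρ (e x) (ρ (e (xp i r)) v) ∈ Q := fun i r => hlow x hx _ (hv.2 i r)
      suffices h3 : (ρ (e (xp i r)) * ρ (e x)) v ∈ Q from h3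
      cases x with
      | xp => exact hx.elim
      | xm j l =>
        have h4 := h.rel _ _ (.xp_xm i j r l)
        rw [map_sub, map_mul, map_mul, sub_eq_iff_eq_add'] at h4
        rw [h4]
        exact Q.add_mem (hv2 i r) (crossElt_mem hlow i j r l v hv.1)
      | h j s =>
        rcases eq_or_ne s 0 with rfl | hs
        · have h4 := h.rel _ _ (.h_zero j)
          rw [h4]
          simp
        · have h4 := h.rel _ _ (.h_xp j i s r hs)
          rw [map_sub, map_mul, map_mul, sub_eq_iff_eq_add, ← sub_eq_iff_eq_add'] at h4
          rw [← h4, map_smul, map_mul]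
          exact Q.sub_mem (hv2 i r) (Q.smul_of_tower_mem _ (hγ _ _ (hv.2 _ _)))
      | K j =>
        rw [show ρ (e (xp i r)) * ρ (e (Gen.K j)) = _ from h.x_mul_K true j i r]
        exact Q.smul_of_tower_mem _ (hv2 i r)
      | Kinv j =>
        rw [show ρ (e (xp i r)) * ρ (e (Kinv j)) = _ from h.x_mul_Kinv true j i r]
        exact Q.smul_of_tower_mem _ (hv2 i r)
      | g2 =>
        rw [← h.central]
        exact hv2 i r
      | g2inv =>
        have h4 := h.rel _ _ (.g2inv_comm (xp i r))
        rw [map_mul, map_mul] at h4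
        rw [← h4]
        exact hv2 i r
      | D =>
        have h4 : ρ (e (xp i r)) * ρ (e Gen.D) = (qq ^ r)⁻¹ • (ρ (e Gen.D) * ρ (e (xp i r))) :=
          (eq_inv_smul_iff₀ (zpow_ne_zero r qq_notRoot.1)).2 (h.D_mul_x true i r).symm
        rw [h4]
        exact Q.smul_of_tower_mem _ (hv2 i r)
      | Dinv =>
        rw [show ρ (e (xp i r)) * ρ (e Dinv) = _ from h.x_mul_Dinv true i r]
        exact Q.smul_of_tower_mem _ (hv2 i r)
    exact fun i r v hv => (hmem.1 (hQQ' hv)).2 i r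
  have htop : stabilizer ρ Q = ⊤ := eq_top_of_e_mem fun x => by
    cases x with
    | xp i r => exact hpos i r
    | _ => exact hlow _ trivial
  intro w hw u
  have hu : u ∈ stabilizer ρ Q := htop ▸ Algebra.mem_top
  exact hQP (hu w (hWQ hw))

end StableSubmodules

section QuotientRepresentation

variable {N : ℕ} {d : Fin N → ℤ} {A : Fin N → Fin N → ℤ} {R V : Type*} [CommRing R] [Algebra Fq R]
  [AddCommGroup V] [Module R V] [Module Fq V] [IsScalarTower Fq R V]
  {ρ : FA N →ₐ[Fq] Module.End R V} {P : Submodule R V}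

/-- The representation on the quotient by the largest subrepresentation contained in `P`. -/
def quotRep (ρ : FA N →ₐ[Fq] Module.End R V) (P : Submodule R V) :
    FA N →ₐ[Fq] Module.End R (V ⧸ innerRep ρ P) where
  toFun u := (innerRep ρ P).mapQ (innerRep ρ P) (ρ u) fun _ hv => map_mem_innerRep u hv
  map_one' := Submodule.linearMap_qext _ (by ext; simp)
  map_mul' a b := Submodule.linearMap_qext _ (by ext; simp)
  map_zero' := Submodule.linearMap_qext _ (by ext; simp)
  map_add' a b := Submodule.linearMap_qext _ (by ext; simp)
  commutes' r := Submodule.linearMap_qext _ (by ext; simp [Module.algebraMap_end_apply])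

theorem quotRep_mk (u : FA N) (v : V) :
    quotRep ρ P u ((innerRep ρ P).mkQ v) = (innerRep ρ P).mkQ (ρ u v) := rfl

theorem quotRep_eq_zero_iff {u : FA N} : quotRep ρ P u = 0 ↔ ∀ v, ρ u v ∈ innerRep ρ P := by
  constructor
  · intro h v
    have := LinearMap.congr_fun h ((innerRep ρ P).mkQ v)
    rw [quotRep_mk] at this
    simpa using this
  · intro h
    refine Submodule.linearMap_qext _ (LinearMap.ext fun v => ?_)
    have := quotRep_mk (ρ := ρ) (P := P) u v
    simpa using this.trans ((Submodule.Quotient.mk_eq_zero _).2 (h v))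

theorem quotRep_eq_zero {u : FA N} (h : ρ u = 0) : quotRep ρ P u = 0 :=
  quotRep_eq_zero_iff.2 fun v => by simp [h]

theorem quotRep_eq {a b : FA N} (h : ρ a = ρ b) : quotRep ρ P a = quotRep ρ P b := by
  rw [← sub_eq_zero, ← map_sub]
  exact quotRep_eq_zero (by rw [map_sub, h, sub_self])

theorem quotRep_coreRep {g : R} (hg : ρ (e g2) = g • 1)
    (h : CoreRep (E := Module.End R V) d A ρ) :
    CoreRep (E := Module.End R (V ⧸ innerRep ρ P)) d A (quotRep ρ P) := by
  have h1 : quotRep ρ P (e g2) = g • 1 := by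
    refine Submodule.linearMap_qext _ (LinearMap.ext fun v => ?_)
    rw [LinearMap.comp_apply, quotRep_mk, hg]
    rfl
  refine ⟨fun a b hab => quotRep_eq (h.rel a b hab), fun z => ?_⟩
  rw [h1]
  refine LinearMap.ext fun v => ?_
  exact (z.map_smul g v).symm

/-- An element acting into `P` and commuting with the `x^+` on the quotient acts by zero there. -/
theorem quotRep_eq_zero_of_commute (h : CoreRep (E := Module.End R V) d A ρ)
    (hP : ∀ x : Gen N, x.IsLow → e x ∈ stabilizer ρ P) {z : FA N} (hz : ∀ v, ρ z v ∈ P)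
    (hc : ∀ i r, Commute (quotRep ρ P (e (xp i r))) (quotRep ρ P z)) : quotRep ρ P z = 0 := by
  rw [quotRep_eq_zero_iff]
  have hr : ∀ v, ρ z v ∈ innerRep ρ P ⊔ LinearMap.range (ρ z) := fun v =>
    Submodule.mem_sup_right ⟨v, rfl⟩
  refine fun v => le_innerRep (W := innerRep ρ P ⊔ LinearMap.range (ρ z)) h hP ?_ ?_ (hr v)
  · refine sup_le innerRep_le ?_
    rintro _ ⟨v, rfl⟩
    exact hz v
  · intro i r v hv
    obtain ⟨a, ha, _, ⟨b, rfl⟩, rfl⟩ := Submodule.mem_sup.1 hv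
    rw [map_add]
    refine add_mem (Submodule.mem_sup_left (map_mem_innerRep _ ha)) ?_
    have h1 := LinearMap.congr_fun (hc i r).eq ((innerRep ρ P).mkQ b)
    simp only [Module.End.mul_apply, quotRep_mk] at h1
    rw [← sub_eq_zero, ← map_sub, Submodule.mkQ_apply, Submodule.Quotient.mk_eq_zero] at h1
    rw [← sub_add_cancel (ρ (e (xp i r)) (ρ z b)) (ρ z (ρ (e (xp i r)) b))]
    exact add_mem (Submodule.mem_sup_left h1) (hr _)

theorem map_mem_of_mkAlgHom_eq_zero (hd : ∀ i, 0 < d i)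
    (hsym : ∀ i j, d i * A i j = d j * A j i) (hdiag : ∀ i, A i i = 2)
    (hoff : ∀ i j, i ≠ j → A i j ≤ 0) {g : R} (hg : ρ (e g2) = g • 1)
    (h : CoreRep (E := Module.End R V) d A ρ)
    (hP : ∀ x : Gen N, x.IsLow → e x ∈ stabilizer ρ P)
    (hqp : ∀ i j m l, ρ (quadElt d A true i j m l) = 0)
    (hsp : ∀ i j, i ≠ j → ∀ ks l, ρ (serreElt d A true i j ks l) = 0)
    (hqm : ∀ i j m l v, ρ (quadElt d A false i j m l) v ∈ P)
    (hsm : ∀ i j, i ≠ j → ∀ ks l v, ρ (serreElt d A false i j ks l) v ∈ P)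
    {z : FA N} (hz : RingQuot.mkAlgHom Fq (QRel N d A) z = 0) (v : V) : ρ z v ∈ P := by
  have h' : CoreRep (E := Module.End R (V ⧸ innerRep ρ P)) d A (quotRep ρ P) := quotRep_coreRep hg h
  have hq : ∀ pm i j m l, quotRep ρ P (quadElt d A pm i j m l) = 0 := by
    intro pm i j m l
    cases pm
    · refine quotRep_eq_zero_of_commute h hP (hqm i j m l) fun p n => ?_
      have := h'.commute_quadElt hd hsym false p i j n m l
      exact this
    · exact quotRep_eq_zero (hqp i j m l)
  have hs : ∀ pm i j, i ≠ j → ∀ ks l, quotRep ρ P (serreElt d A pm i j ks l) = 0 := by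
    intro pm i j hij ks l
    cases pm
    · refine quotRep_eq_zero_of_commute h hP (hsm i j hij ks l) fun p n => ?_
      have := h'.commute_serreElt hd hsym hdiag hoff false p hij n l ks (hq false)
      exact this
    · exact quotRep_eq_zero (hsp i j hij ks l)
  have hrel := h'.map_eq_of_qRel hq hs
  have h1 : RingQuot.liftAlgHom Fq ⟨quotRep ρ P, hrel⟩ (RingQuot.mkAlgHom Fq (QRel N d A) z) =
      quotRep ρ P z := RingQuot.liftAlgHom_mkAlgHom_apply _ _ _ _
  rw [hz, map_zero] at h1
  exact innerRep_le (quotRep_eq_zero_iff.1 h1.symm v)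

end QuotientRepresentation

section Evaluation

variable {N : ℕ} {d : Fin N → ℤ} {A : Fin N → Fin N → ℤ} {R E : Type*} [CommRing R] [Algebra Fq R]
  [Ring E] [Algebra Fq E] [Algebra R E] [IsScalarTower Fq R E] {g κ : Rˣ}
  {σ : FA N →ₐ[Fq] E}

namespace Fock

/-- The map `w ⊗ c ↦ σ(w) · lam(c)` from the Fock space to an algebra. -/
def ell (σ : FA N →ₐ[Fq] E) (lam : MvPolynomial (Fin N × ℤ) R →ₗ[R] E) : FockSpace N R →ₗ[R] E :=
  Finsupp.lsum R fun w =>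
    (LinearMap.mulLeft R (w.map fun x => σ (e (xm x.1 x.2))).prod).comp lam

omit [Algebra Fq R] [IsScalarTower Fq R E] in
@[simp]
theorem ell_vac (lam : MvPolynomial (Fin N × ℤ) R →ₗ[R] E) (c : MvPolynomial (Fin N × ℤ) R) :
    ell σ lam (Finsupp.single [] c) = lam c := by
  simp [ell]

omit [Algebra Fq R] [IsScalarTower Fq R E] in
@[simp]
theorem ell_prepend (lam : MvPolynomial (Fin N × ℤ) R →ₗ[R] E) (x : Fin N × ℤ)
    (v : FockSpace N R) :
    ell σ lam (WordModule.prepend R _ x v) = σ (e (xm x.1 x.2)) * ell σ lam v := by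
  have : (ell σ lam).comp (WordModule.prepend R _ x) =
      (LinearMap.mulLeft R (σ (e (xm x.1 x.2)))).comp (ell σ lam) :=
    Finsupp.lhom_ext fun w c => by simp [ell]
  exact LinearMap.congr_fun this v

omit [Algebra Fq R] [Algebra Fq E] [IsScalarTower Fq R E] in
theorem lhom_eq_of_prepend {f f' : FockSpace N R →ₗ[R] E}
    (h0 : ∀ c, f (Finsupp.single [] c) = f' (Finsupp.single [] c))
    (h : ∀ x, ∃ a : E, ∀ v, f (WordModule.prepend R _ x v) - f' (WordModule.prepend R _ x v) =
      a * (f v - f' v)) : f = f' := by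
  refine Finsupp.lhom_ext fun w => ?_
  induction w with
  | nil => exact h0
  | cons x w ih =>
    intro c
    obtain ⟨a, ha⟩ := h x
    have := ha (Finsupp.single w c)
    rw [ih, sub_self, mul_zero, WordModule.prepend_single] at this
    exact sub_eq_zero.1 this

theorem ell_diag {β : Module.End R (MvPolynomial (Fin N × ℤ) R)} {s : Fin N × ℤ → Fq} {a b : E}
    (hba : a * b = 1)
    (h : ∀ x, a * σ (e (xm x.1 x.2)) = s x • (σ (e (xm x.1 x.2)) * a))
    (lam : MvPolynomial (Fin N × ℤ) R →ₗ[R] E) (v : FockSpace N R) :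
    ell σ lam (WordModule.diag β s v) =
      a * ell σ ((LinearMap.mulLeft R b).comp (lam.comp β)) v := by
  have : (ell σ lam).comp (WordModule.diag β s) =
      (LinearMap.mulLeft R a).comp (ell σ ((LinearMap.mulLeft R b).comp (lam.comp β))) := by
    refine lhom_eq_of_prepend (fun c => ?_) fun x => ⟨s x • σ (e (xm x.1 x.2)), fun v => ?_⟩
    · simp [WordModule.diag, ← mul_assoc, hba]
    · have h1 := LinearMap.congr_fun (WordModule.diag_mul_prepend β s x) v
      rw [LinearMap.comp_apply, LinearMap.comp_apply, LinearMap.comp_apply, LinearMap.comp_apply]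
      rw [Module.End.mul_apply] at h1
      rw [h1, LinearMap.smul_apply, LinearMap.map_smul_of_tower, Module.End.mul_apply, ell_prepend,
        ell_prepend, LinearMap.mulLeft_apply, LinearMap.mulLeft_apply, ← mul_assoc, h, mul_sub]
      simp only [smul_mul_assoc, mul_assoc]
  exact LinearMap.congr_fun this v

omit [Algebra Fq R] [IsScalarTower Fq R E] in
theorem ell_shift {β : Module.End R (MvPolynomial (Fin N × ℤ) R)} {m : ℤ} {c : Fin N × ℤ → R}
    {a : E}
    (h : ∀ x, a * σ (e (xm x.1 x.2)) - σ (e (xm x.1 x.2)) * a = c x • σ (e (xm x.1 (x.2 + m))))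
    (lam : MvPolynomial (Fin N × ℤ) R →ₗ[R] E) (v : FockSpace N R) :
    ell σ lam (WordModule.shift m β c v) =
      a * ell σ lam v - ell σ ((LinearMap.mulLeft R a).comp lam) v + ell σ (lam.comp β) v := by
  have : (ell σ lam).comp (WordModule.shift m β c) =
      (LinearMap.mulLeft R a).comp (ell σ lam) - ell σ ((LinearMap.mulLeft R a).comp lam) +
        ell σ (lam.comp β) := by
    refine lhom_eq_of_prepend (fun c => ?_) fun x => ⟨σ (e (xm x.1 x.2)), fun v => ?_⟩
    · simp [WordModule.shift]
    · have h1 := LinearMap.congr_fun (WordModule.shift_mul_prepend m β c x) v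
      rw [Module.End.mul_apply, LinearMap.add_apply, Module.End.mul_apply,
        LinearMap.smul_apply] at h1
      simp only [LinearMap.comp_apply, LinearMap.add_apply, LinearMap.sub_apply, h1, map_add,
        map_smul, ell_prepend, LinearMap.mulLeft_apply]
      rw [← smul_mul_assoc, ← h]
      noncomm_ring
  exact LinearMap.congr_fun this v

/-- The common kernel of the evaluations. -/
def evalKer (R : Type*) [CommRing R] [Algebra R E] (σ : FA N →ₐ[Fq] E) :
    Submodule R (FockSpace N R) :=
  ⨅ lam : MvPolynomial (Fin N × ℤ) R →ₗ[R] E, LinearMap.ker (ell σ lam)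

omit [Algebra Fq R] [IsScalarTower Fq R E] in
theorem mem_evalKer {v : FockSpace N R} : v ∈ evalKer R σ ↔ ∀ lam, ell σ lam v = 0 := by
  simp [evalKer, Submodule.mem_iInf]

omit [Algebra Fq R] [IsScalarTower Fq R E] in
theorem algebraMap_zpow (hσ : CoreRep d A σ) (hg : algebraMap R E g = σ (e g2)) (m : ℤ) :
    algebraMap R E ((g ^ m : Rˣ) : R) = (hσ.gu ^ m : Eˣ) := by
  have : Units.map (algebraMap R E).toMonoidHom g = hσ.gu := Units.ext hg
  rw [← this, ← map_zpow]
  rfl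

theorem isLow_mem_stabilizer (hσ : CoreRep d A σ) (hg : algebraMap R E g = σ (e g2)) {x : Gen N}
    (hx : x.IsLow) : e x ∈ stabilizer (rep d A g κ) (evalKer R σ) := by
  intro v hv
  have hK : ∀ i, σ (e (Gen.K i)) * σ (e (Kinv i)) = 1 := fun i => by
    simpa using hσ.rel _ _ (.K_Kinv i)
  have hK' : ∀ i, σ (e (Kinv i)) * σ (e (Gen.K i)) = 1 := fun i => by
    simpa using hσ.rel _ _ (.Kinv_K i)
  have hD : σ (e Gen.D) * σ (e Dinv) = 1 := by simpa using hσ.rel _ _ .D_Dinv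
  have hD' : σ (e Dinv) * σ (e Gen.D) = 1 := by simpa using hσ.rel _ _ .Dinv_D
  rw [rep_e]
  have hv' := hv
  rw [mem_evalKer] at hv
  cases x with
  | xp => exact hx.elim
  | xm i r =>
    rw [mem_evalKer]
    intro lam
    refine (ell_prepend lam (i, r) v).trans ?_
    rw [hv, mul_zero]
  | h i m =>
    rcases eq_or_ne m 0 with rfl | hm
    · have : repGen d A g κ (Gen.h i 0) = 0 := by
        change opH d A g i 0 = 0
        exact if_pos rfl
      rw [this]
      exact zero_mem _
    rw [mem_evalKer]
    intro lam
    have : repGen d A g κ (Gen.h i m) = WordModule.shift m (baseH d A g i m) fun x =>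
      -(hxCoeff d A i x.1 m • ((g ^ |m| : Rˣ) : R)) := if_neg hm
    rw [this, ell_shift (a := σ (e (Gen.h i m)))]
    · simp [hv]
    · intro x
      have h1 := hσ.h_x false i x.1 x.2 hm
      simp only [gx, sgn, if_false, Bool.false_eq_true, neg_neg, one_mul] at h1
      refine h1.trans ?_
      rw [neg_smul, smul_assoc, ← algebraMap_zpow hσ hg, ← Algebra.smul_def, add_comm m, hxCoeff,
        Int.cast_neg, Int.cast_one, neg_one_mul, neg_smul]
  | K i =>
    rw [mem_evalKer]
    intro lam
    refine (ell_diag (hK i) (fun x => ?_) lam v).trans ?_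
    · simpa [gx, sgn] using hσ.K_mul_x false i x.1 x.2
    · rw [hv, mul_zero]
  | Kinv i =>
    rw [mem_evalKer]
    intro lam
    refine (ell_diag (hK' i) (fun x => ?_) lam v).trans ?_
    · have h1 := hσ.x_mul_Kinv false i x.1 x.2
      simp only [gx, sgn, if_false, Bool.false_eq_true, zpow_neg_one] at h1
      exact ((eq_inv_smul_iff₀ (qp_ne_zero d A i x.1)).1 h1).symm
    · rw [hv, mul_zero]
  | D =>
    rw [mem_evalKer]
    intro lam
    refine (ell_diag hD (fun x => ?_) lam v).trans ?_
    · exact hσ.D_mul_x false x.1 x.2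
    · rw [hv, mul_zero]
  | Dinv =>
    rw [mem_evalKer]
    intro lam
    refine (ell_diag hD' (fun x => ?_) lam v).trans ?_
    · rw [inv_zpow]
      exact (eq_inv_smul_iff₀ (zpow_ne_zero _ qq_notRoot.1)).2 (hσ.x_mul_Dinv false x.1 x.2).symm
    · rw [hv, mul_zero]
  | g2 => exact Submodule.smul_mem _ _ hv'
  | g2inv => exact Submodule.smul_mem _ _ hv'

/-- The elements of the free algebra compatible with all evaluations. -/
def evalSubalgebra (d : Fin N → ℤ) (A : Fin N → Fin N → ℤ) (g κ : Rˣ) (σ : FA N →ₐ[Fq] E) :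
    Subalgebra Fq (FA N) where
  carrier := {z | ∀ lam v, ell σ lam (rep d A g κ z v) = σ z * ell σ lam v}
  mul_mem' {a b} ha hb lam v := by
    rw [map_mul, Module.End.mul_apply, ha, hb, map_mul, mul_assoc]
  add_mem' {a b} ha hb lam v := by
    rw [map_add, LinearMap.add_apply, map_add, ha, hb, map_add, add_mul]
  algebraMap_mem' r lam v := by
    rw [AlgHom.commutes, AlgHom.commutes, Module.algebraMap_end_apply,
      LinearMap.map_smul_of_tower, Algebra.smul_def]

theorem xm_mem_evalSubalgebra (i : Fin N) (r : ℤ) : e (xm i r) ∈ evalSubalgebra d A g κ σ := by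
  intro lam v
  rw [rep_e]
  exact ell_prepend lam (i, r) v

theorem g2_mem_evalSubalgebra (hg : algebraMap R E g = σ (e g2)) :
    e g2 ∈ evalSubalgebra d A g κ σ := by
  intro lam v
  rw [rep_e]
  refine ((ell σ lam).map_smul (g : R) v).trans ?_
  rw [Algebra.smul_def, hg]

theorem g2inv_mem_evalSubalgebra (hσ : CoreRep d A σ) (hg : algebraMap R E g = σ (e g2)) :
    e g2inv ∈ evalSubalgebra d A g κ σ := by
  intro lam v
  rw [rep_e]
  refine ((ell σ lam).map_smul ((g⁻¹ : Rˣ) : R) v).trans ?_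
  have := algebraMap_zpow hσ hg (-1)
  rw [zpow_neg_one, zpow_neg_one] at this
  rw [Algebra.smul_def, this]
  rfl

theorem quadElt_mem {S : Subalgebra Fq (FA N)} {pm : Bool} (h : ∀ i r, e (gx pm i r) ∈ S)
    (i j : Fin N) (m l : ℤ) : quadElt d A pm i j m l ∈ S :=
  sub_mem (sub_mem (mul_mem (h _ _) (h _ _)) (S.smul_mem (mul_mem (h _ _) (h _ _)) _))
    (sub_mem (S.smul_mem (mul_mem (h _ _) (h _ _)) _) (mul_mem (h _ _) (h _ _)))

theorem serreElt_mem {S : Subalgebra Fq (FA N)} {pm : Bool} (h : ∀ i r, e (gx pm i r) ∈ S)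
    (i j : Fin N) (ks : Fin (1 - A i j).toNat → ℤ) (l : ℤ) : serreElt d A pm i j ks l ∈ S := by
  refine sum_mem fun _ _ => sum_mem fun _ _ => S.smul_mem (mul_mem (mul_mem ?_ (h _ _)) ?_) _
  all_goals
    refine list_prod_mem fun z hz => ?_
    obtain ⟨t, -, rfl⟩ := List.mem_map.1 hz
    exact h _ _

theorem rep_eq_zero_of_commute {z : FA N} (h0 : ∀ c, rep d A g κ z (Finsupp.single [] c) = 0)
    (hc : ∀ i r, Commute (rep d A g κ (e (xm i r))) (rep d A g κ z)) : rep d A g κ z = 0 := by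
  refine WordModule.eq_zero_of_mul_prepend h0 fun x => ⟨WordModule.prepend R _ x, ?_⟩
  rw [← Prod.mk.eta (p := x), ← rep_xm (d := d) (A := A) (g := g) (κ := κ)]
  exact (hc x.1 x.2).eq.symm

theorem rep_quadElt_true (hd : ∀ i, 0 < d i) (hsym : ∀ i j, d i * A i j = d j * A j i)
    (i j : Fin N) (m l : ℤ) : rep d A g κ (quadElt d A true i j m l) = 0 := by
  have h := rep_coreRep (g := g) (κ := κ) hd hsym
  refine rep_eq_zero_of_commute (fun c => ?_) fun p n => ?_
  · simp [quadElt, gx, rep_xp_vac]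
  · have := h.commute_quadElt hd hsym true p i j n m l
    exact this

theorem rep_serreElt_true (hd : ∀ i, 0 < d i) (hsym : ∀ i j, d i * A i j = d j * A j i)
    (hdiag : ∀ i, A i i = 2) (hoff : ∀ i j, i ≠ j → A i j ≤ 0) {i j : Fin N} (hij : i ≠ j)
    (ks : Fin (1 - A i j).toNat → ℤ) (l : ℤ) : rep d A g κ (serreElt d A true i j ks l) = 0 := by
  have h := rep_coreRep (g := g) (κ := κ) hd hsym
  refine rep_eq_zero_of_commute (fun c => ?_) fun p n => ?_
  · have hx : ∀ L : List (FA N), L ≠ [] → (∀ z ∈ L, ∃ i r, z = e (xp i r)) →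
        rep d A g κ L.prod (Finsupp.single [] c) = 0 := by
      intro L
      induction L with
      | nil => intro h; exact (h rfl).elim
      | cons a L ih =>
        intro _ hL
        rw [List.prod_cons, map_mul, Module.End.mul_apply]
        rcases eq_or_ne L [] with rfl | hL'
        · obtain ⟨i, r, rfl⟩ := hL a (by simp)
          simp [rep_xp_vac]
        · rw [ih hL' fun z hz => hL z (by simp [hz]), map_zero]
    simp only [serreElt, map_sum, map_smul, LinearMap.sum_apply, LinearMap.smul_apply]
    refine sum_eq_zero fun s _ => sum_eq_zero fun r _ => ?_
    have : dsTerm true i j (1 - A i j).toNat ks l s r =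
        ((((List.finRange _).take r).map fun t => e (xp i (ks (s t)))) ++
          e (xp j l) :: (((List.finRange _).drop r).map fun t => e (xp i (ks (s t))))).prod := by
      simp [dsTerm, mul_assoc]
    rw [this, hx _ (by simp), smul_zero]
    intro z hz
    simp only [List.mem_append, List.mem_map, List.mem_cons] at hz
    rcases hz with ⟨t, -, rfl⟩ | rfl | ⟨t, -, rfl⟩ <;> exact ⟨_, _, rfl⟩
  · have := h.commute_serreElt hd hsym hdiag hoff true p hij n l ks (rep_quadElt_true hd hsym)
    exact this

/-- The evaluations kill the relations of the quantum affine algebra. -/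
theorem ell_rep_eq_zero (hd : ∀ i, 0 < d i) (hsym : ∀ i j, d i * A i j = d j * A j i)
    (hdiag : ∀ i, A i i = 2) (hoff : ∀ i j, i ≠ j → A i j ≤ 0) (hσ : CoreRep d A σ)
    (hg : algebraMap R E g = σ (e g2)) (hrel : ∀ a b, QRel N d A a b → σ a = σ b) {z : FA N}
    (hz : RingQuot.mkAlgHom Fq (QRel N d A) z = 0)
    (lam : MvPolynomial (Fin N × ℤ) R →ₗ[R] E) (v : FockSpace N R) :
    ell σ lam (rep d A g κ z v) = 0 := by
  have hx : ∀ i r, e (gx false i r) ∈ evalSubalgebra d A g κ σ := xm_mem_evalSubalgebra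
  have hker : ∀ {z}, z ∈ evalSubalgebra d A g κ σ → σ z = 0 → ∀ v,
      rep d A g κ z v ∈ evalKer R σ := fun hz h0 v => mem_evalKer.2 fun lam => by
    rw [hz lam v, h0, zero_mul]
  refine mem_evalKer.1 ?_ lam
  refine map_mem_of_mkAlgHom_eq_zero hd hsym hdiag hoff (g := (g : R)) ?_ (rep_coreRep hd hsym)
    (fun x hx => isLow_mem_stabilizer hσ hg hx) (rep_quadElt_true hd hsym)
    (fun i j hij => rep_serreElt_true hd hsym hdiag hoff hij)
    (fun i j m l => hker (quadElt_mem hx i j m l) (map_quadElt_eq_zero_of_qRel hrel _ _ _ _ _))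
    (fun i j hij ks l => hker (serreElt_mem hx i j ks l)
      (map_serreElt_eq_zero_of_qRel hrel _ hij _ _)) hz v
  rw [rep_e]
  rfl

end Fock
end Evaluation

section Vacuum

variable {N : ℕ} {d : Fin N → ℤ} {A : Fin N → Fin N → ℤ} {R E : Type*} [CommRing R] [Algebra Fq R]
  [Ring E] [Algebra Fq E] [Algebra R E] [IsScalarTower Fq R E] {g κ : Rˣ}
  {σ : FA N →ₐ[Fq] E}

namespace Fock

theorem expSeq_vac {H S : ℕ → Module.End R (FockSpace N R)}
    (hS : IsExpSeq (E := Module.End R (FockSpace N R)) Fq H S)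
    (Y : Subalgebra R (MvPolynomial (Fin N × ℤ) R)) {t : ℕ → MvPolynomial (Fin N × ℤ) R}
    (hH : ∀ a, ∀ p ∈ Y, H a (Finsupp.single [] p) = Finsupp.single [] (t a * p))
    (ht : ∀ a, t a ∈ Y) (ev : MvPolynomial (Fin N × ℤ) R →ₐ[R] Polynomial R)
    (hev : ∀ a, 0 < a → ev (t a) = Polynomial.X ^ a) (n : ℕ) :
    ∃ p ∈ Y, S n (Finsupp.single [] 1) = Finsupp.single [] p ∧ ev p = Polynomial.X ^ n := by
  induction n using Nat.strong_induction_on with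
  | _ n ih =>
  rcases Nat.eq_zero_or_pos n with rfl | hn
  · exact ⟨1, one_mem _, by rw [hS.zero, Module.End.one_apply], by simp⟩
  have hn' : (n : Fq) ≠ 0 := Nat.cast_ne_zero.2 hn.ne'
  have key : ∀ r ∈ antidiagonal n, ∃ p ∈ Y,
      (H r.1 * S r.2) (Finsupp.single [] 1) = Finsupp.single [] p ∧
        ev p = if r.1 = 0 then 0 else Polynomial.X ^ n := by
    intro r hr
    rw [HasAntidiagonal.mem_antidiagonal] at hr
    rcases Nat.eq_zero_or_pos r.1 with h0 | h0
    · refine ⟨0, zero_mem _, ?_, by simp [h0]⟩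
      have h1 : H 0 = 0 := by simpa [hS.zero] using (hS.deriv 0).symm
      rw [h0, h1, zero_mul]
      simp
    · obtain ⟨p, hp, hp1, hp2⟩ := ih r.2 (by omega)
      refine ⟨t r.1 * p, mul_mem (ht _) hp, ?_, ?_⟩
      · rw [Module.End.mul_apply, hp1, hH _ _ hp]
      · rw [map_mul, hev _ h0, hp2, ← pow_add, hr, if_neg h0.ne']
  choose! p hpY hp1 hp2 using key
  refine ⟨(n : Fq)⁻¹ • ∑ r ∈ antidiagonal n, p r,
    Submodule.smul_of_tower_mem (Subalgebra.toSubmodule Y) _ (sum_mem hpY), ?_, ?_⟩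
  · have h1 : S n = (n : Fq)⁻¹ • ∑ r ∈ antidiagonal n, H r.1 * S r.2 := by
      have := hS.deriv n
      rw [← this, inv_smul_smul₀ hn']
    rw [h1, LinearMap.smul_apply, LinearMap.sum_apply, sum_congr rfl hp1, ← Finsupp.smul_single,
      Finsupp.single_finsetSum]
  · have h2 : ∑ r ∈ antidiagonal n, ev (p r) = (n : Fq) • Polynomial.X ^ n := by
      rw [sum_congr rfl hp2, Nat.sum_antidiagonal_eq_sum_range_succ_mk, sum_range_succ']
      simp [Algebra.smul_def]
    rw [← ev.restrictScalars_apply Fq, map_smul, map_sum]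
    simp only [AlgHom.restrictScalars_apply, h2, inv_smul_smul₀ hn']

/-- The specialization of the polynomial Fock space under which the vacuum values of `ψ_{i,n}` and
`φ_{i,-n}` become powers of the variable. -/
def evVac (d : Fin N → ℤ) (R : Type*) [CommRing R] [Algebra Fq R] :
    MvPolynomial (Fin N × ℤ) R →ₐ[R] Polynomial R :=
  MvPolynomial.aeval fun y =>
    ((y.2 : Fq) * (qi d y.1 - (qi d y.1)⁻¹))⁻¹ • Polynomial.X ^ y.2.natAbs

theorem opH_vac {i : Fin N} {m : ℤ} (hm : m ≠ 0) (c : MvPolynomial (Fin N × ℤ) R) :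
    opH d A g i m (Finsupp.single [] c) = Finsupp.single [] (baseH d A g i m c) := by
  rw [opH, if_neg hm, WordModule.shift]
  exact WordModule.op_vac _ _ _ _

theorem baseH_apply_of_mem {i : Fin N} {m : ℤ} {p : MvPolynomial (Fin N × ℤ) R}
    (hp : p ∈ MvPolynomial.supported R {y : Fin N × ℤ | 0 < y.2 * m}) :
    baseH d A g i m p = MvPolynomial.X (i, m) * p := by
  rw [baseH, heis_apply, add_eq_left]
  refine MvPolynomial.derivation_eq_zero_of_forall_mem_vars fun y hy => ?_
  rw [MvPolynomial.mem_supported] at hp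
  have := hp hy
  rw [MvPolynomial.mkDerivation_X, if_neg, map_zero]
  rintro ⟨h1, h2⟩
  simp only [Set.mem_ofPred_eq, h2] at this
  nlinarith

theorem rep_h_vac {i : Fin N} (s : ℤ) (hs : s ≠ 0) (c : Fq) (a : ℕ)
    {p : MvPolynomial (Fin N × ℤ) R}
    (hp : p ∈ MvPolynomial.supported R {y : Fin N × ℤ | 0 < y.2 * s}) :
    (((a : Fq) * c) • rep d A g κ (e (Gen.h i (s * a)))) (Finsupp.single [] p) =
      Finsupp.single [] ((((a : Fq) * c) • MvPolynomial.X (i, s * a)) * p) := by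
  rcases Nat.eq_zero_or_pos a with rfl | ha
  · simp
  have ha' : (0 : ℤ) < a := by exact_mod_cast ha
  have hsa : s * a ≠ 0 := mul_ne_zero hs ha'.ne'
  have hset : {y : Fin N × ℤ | 0 < y.2 * s} = {y : Fin N × ℤ | 0 < y.2 * (s * a)} := by
    ext y
    rw [Set.mem_ofPred_eq, Set.mem_ofPred_eq, ← mul_assoc, mul_pos_iff_of_pos_right ha']
  rw [hset] at hp
  have h1 := opH_vac (d := d) (A := A) (g := g) (i := i) hsa p
  rw [baseH_apply_of_mem hp] at h1
  rw [LinearMap.smul_apply, rep_e, smul_mul_assoc, ← Finsupp.smul_single]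
  exact congrArg _ h1

theorem rep_expSeq_vac (hd : ∀ i, 0 < d i) {i : Fin N} {S : ℕ → FA N} {s : ℤ} (hs : s ^ 2 = 1)
    (hS : IsExpSeq (E := Module.End R (FockSpace N R)) Fq
      (fun a : ℕ => ((a : Fq) * (s * (qi d i - (qi d i)⁻¹))) •
        rep d A g κ (e (Gen.h i (s * a)))) fun n => rep d A g κ (S n)) (n : ℕ) :
    ∃ p, rep d A g κ (S n) (Finsupp.single [] 1) = Finsupp.single [] p ∧
      evVac d R p = Polynomial.X ^ n := by
  have hs0 : s ≠ 0 := by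
    rintro rfl
    simp at hs
  have hq : (qi d i - (qi d i)⁻¹) ≠ 0 := (qi_notRoot hd i).sub_inv_ne_zero
  refine (expSeq_vac hS (MvPolynomial.supported R {y : Fin N × ℤ | 0 < y.2 * s})
    (t := fun a => ((a : Fq) * (s * (qi d i - (qi d i)⁻¹))) • MvPolynomial.X (i, s * a))
    (fun a p hp => rep_h_vac s hs0 _ a hp) (fun a => ?_) (evVac d R) (fun a ha => ?_) n).imp
    fun p hp => hp.2
  · rcases Nat.eq_zero_or_pos a with rfl | ha
    · simp
    have h1 : s * a * s = a := by linear_combination (a : ℤ) * hs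
    have h2 : (MvPolynomial.X (i, s * a) : MvPolynomial (Fin N × ℤ) R) ∈
        MvPolynomial.supported R {y : Fin N × ℤ | 0 < y.2 * s} :=
      Algebra.subset_adjoin ⟨(i, s * a), by simpa [h1] using ha, rfl⟩
    exact Submodule.smul_of_tower_mem (Subalgebra.toSubmodule
      (MvPolynomial.supported R {y : Fin N × ℤ | 0 < y.2 * s})) _ h2
  · have ha' : (a : Fq) ≠ 0 := Nat.cast_ne_zero.2 ha.ne'
    have hs' : s.natAbs = 1 := by
      have : s.natAbs ^ 2 = 1 := by rw [← Int.natAbs_pow, hs]; rfl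
      simpa using this
    have hsq : (s : Fq) ≠ 0 := Int.cast_ne_zero.2 hs0
    rw [← AlgHom.restrictScalars_apply Fq, map_smul, AlgHom.restrictScalars_apply, evVac,
      MvPolynomial.aeval_X, smul_smul, Int.natAbs_mul, hs', one_mul, Int.natAbs_natCast]
    have h1 : (a : Fq) * (s * (qi d i - (qi d i)⁻¹)) *
        ((((s * (a : ℤ) : ℤ)) : Fq) * (qi d i - (qi d i)⁻¹))⁻¹ = 1 := by
      generalize qi d i - (qi d i)⁻¹ = c at hq
      push_cast
      field_simp
    rw [h1, one_smul]

theorem rep_psiEl_vac (hd : ∀ i, 0 < d i) (i : Fin N) (n : ℕ) :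
    ∃ p, rep d A g κ (psiEl d i n) (Finsupp.single [] 1) = Finsupp.single [] ((κ : R) • p) ∧
      evVac d R p = Polynomial.X ^ n := by
  have hS := CoreRep.ppos_isExpSeq (E := Module.End R (FockSpace N R)) (d := d) (rep d A g κ) i
  obtain ⟨p, hp, hp'⟩ := rep_expSeq_vac (R := R) (A := A) (g := g) (κ := κ) hd (i := i)
    (S := Ppos d i) (s := 1) (by norm_num) (by simpa only [Int.cast_one, one_mul] using hS) n
  refine ⟨p, ?_, hp'⟩
  rw [psiEl, if_pos (by positivity), Int.toNat_natCast, map_mul, Module.End.mul_apply, hp, rep_e]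
  exact WordModule.op_vac _ _ _ _

theorem rep_phiEl_vac (hd : ∀ i, 0 < d i) (i : Fin N) (n : ℕ) :
    ∃ p, rep d A g κ (phiEl d i (-(n : ℤ))) (Finsupp.single [] 1) =
        Finsupp.single [] (((κ⁻¹ : Rˣ) : R) • p) ∧
      evVac d R p = Polynomial.X ^ n := by
  have hS := CoreRep.pneg_isExpSeq (E := Module.End R (FockSpace N R)) (d := d) (rep d A g κ) i
  obtain ⟨p, hp, hp'⟩ := rep_expSeq_vac (R := R) (A := A) (g := g) (κ := κ) hd (i := i)
    (S := Pneg d i) (s := -1) (by norm_num)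
    (by simpa only [Int.cast_neg, Int.cast_one, neg_mul, one_mul] using hS) n
  refine ⟨p, ?_, hp'⟩
  rw [phiEl, if_pos (by simp), neg_neg, Int.toNat_natCast, map_mul, Module.End.mul_apply, hp, rep_e]
  exact WordModule.op_vac _ _ _ _

/-- The evaluation of the vacuum vector `z · 1`. -/
def evalVac (d : Fin N → ℤ) (A : Fin N → Fin N → ℤ) (g κ : Rˣ) (σ : FA N →ₐ[Fq] E)
    (lam : MvPolynomial (Fin N × ℤ) R →ₗ[R] E) : FA N →ₗ[Fq] E where
  toFun z := ell σ lam (rep d A g κ z (Finsupp.single [] 1))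
  map_add' a b := by
    have h : rep d A g κ (a + b) = rep d A g κ a + rep d A g κ b := map_add _ a b
    rw [h, LinearMap.add_apply, map_add]
  map_smul' c a := by
    have h : rep d A g κ (c • a) = c • rep d A g κ a := map_smul _ c a
    rw [h, LinearMap.smul_apply, LinearMap.map_smul_of_tower, RingHom.id_apply]

theorem evalVac_mul {z w : FA N} {c : MvPolynomial (Fin N × ℤ) R}
    (hw : rep d A g κ w (Finsupp.single [] 1) = Finsupp.single [] c)
    (hz : z ∈ evalSubalgebra d A g κ σ) (lam : MvPolynomial (Fin N × ℤ) R →ₗ[R] E) :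
    evalVac d A g κ σ lam (z * w) = σ z * lam c := by
  have h : rep d A g κ (z * w) = rep d A g κ z * rep d A g κ w := map_mul _ z w
  change ell σ lam (rep d A g κ (z * w) _) = _
  rw [h, Module.End.mul_apply, hw, hz, ell_vac]

end Fock
end Vacuum

section VacuumFunctional

variable {N : ℕ} {d : Fin N → ℤ} {A : Fin N → Fin N → ℤ} {R E : Type*} [CommRing R] [Algebra Fq R]
  [Ring E] [Algebra Fq E] [Algebra R E] [IsScalarTower Fq R E] {g : Rˣ} {σ : FA N →ₐ[Fq] E}

theorem Fock.exists_vacuum_functional (hd : ∀ i, 0 < d i)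
    (hsym : ∀ i j, d i * A i j = d j * A j i) (hdiag : ∀ i, A i i = 2)
    (hoff : ∀ i j, i ≠ j → A i j ≤ 0) (hσ : CoreRep d A σ) (hg : algebraMap R E g = σ (e g2))
    (hrel : ∀ a b, QRel N d A a b → σ a = σ b) (hs : Function.Surjective σ)
    (hker : ∀ z, σ z = 0 → RingQuot.mkAlgHom Fq (QRel N d A) z = 0) (κ : Fqˣ) (M : ℕ) :
    ∃ Ev : E →ₗ[Fq] E, ∀ i, ∀ n ∈ Algebra.adjoin Fq ({σ (e g2), σ (e g2inv)} ∪
        Set.range fun p : Fin N × ℤ => σ (e (xm p.1 p.2))),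
      (∀ p : ℕ, Ev (n * σ (psiEl d i p)) = if p = M then (κ : Fq) • n else 0) ∧
      ∀ r : ℕ, Ev (n * σ (phiEl d i (-(r : ℤ)))) =
        if r = M then ((κ⁻¹ : Fqˣ) : Fq) • n else 0 := by
  let κR : Rˣ := Units.map (algebraMap Fq R).toMonoidHom κ
  let lam : MvPolynomial (Fin N × ℤ) R →ₗ[R] E :=
    Algebra.linearMap R E ∘ₗ Polynomial.lcoeff R M ∘ₗ (evVac d R).toLinearMap
  have hlam : ∀ {p : MvPolynomial (Fin N × ℤ) R} {n : ℕ} (c : Fq),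
      evVac d R p = Polynomial.X ^ n →
        lam (algebraMap Fq R c • p) = if n = M then algebraMap Fq E c else 0 := by
    intro p n c hp
    simp only [lam, map_smul, LinearMap.comp_apply, AlgHom.toLinearMap_apply, hp,
      Polynomial.lcoeff_apply, Polynomial.coeff_X_pow, eq_comm (a := M)]
    split_ifs
    · simp [Algebra.smul_def, ← IsScalarTower.algebraMap_apply Fq R E]
    · simp
  let F := evalVac d A g κR σ lam
  obtain ⟨s, hs⟩ := σ.toLinearMap.exists_rightInverse_of_surjective (LinearMap.range_eq_top.2 hs)
  have hF : ∀ z, F (s (σ z)) = F z := by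
    intro z
    rw [← sub_eq_zero, ← map_sub]
    refine ell_rep_eq_zero hd hsym hdiag hoff hσ hg hrel (hker _ ?_) lam _
    rw [map_sub]
    exact sub_eq_zero.2 (LinearMap.congr_fun hs (σ z))
  have hN : ∀ n ∈ Algebra.adjoin Fq ({σ (e g2), σ (e g2inv)} ∪
      Set.range fun p : Fin N × ℤ => σ (e (xm p.1 p.2))),
      ∃ z ∈ evalSubalgebra d A g κR σ, σ z = n := by
    suffices Algebra.adjoin Fq _ ≤ (evalSubalgebra d A g κR σ).map σ from fun n hn => this hn
    refine Algebra.adjoin_le ?_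
    rintro x ((rfl | rfl) | ⟨p, rfl⟩)
    · exact ⟨_, g2_mem_evalSubalgebra hg, rfl⟩
    · exact ⟨_, g2inv_mem_evalSubalgebra hσ hg, rfl⟩
    · exact ⟨_, xm_mem_evalSubalgebra p.1 p.2, rfl⟩
  refine ⟨F ∘ₗ s, fun i n hn => ⟨fun p => ?_, fun r => ?_⟩⟩
  all_goals obtain ⟨z, hz, rfl⟩ := hN n hn
  · obtain ⟨c, hc1, hc2⟩ := rep_psiEl_vac (R := R) (A := A) (g := g) (κ := κR) hd i p
    have h1 : F (z * psiEl d i p) = σ z * lam (algebraMap Fq R κ • c) := evalVac_mul hc1 hz lam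
    rw [LinearMap.comp_apply, ← map_mul, hF, h1, hlam _ hc2, mul_ite, mul_zero,
      ← Algebra.commutes, ← Algebra.smul_def]
  · obtain ⟨c, hc1, hc2⟩ := rep_phiEl_vac (R := R) (A := A) (g := g) (κ := κR) hd i r
    have h1 : F (z * phiEl d i (-(r : ℤ))) = σ z * lam (algebraMap Fq R (κ⁻¹ : Fqˣ) • c) :=
      evalVac_mul hc1 hz lam
    rw [LinearMap.comp_apply, ← map_mul, hF, h1, hlam _ hc2, mul_ite, mul_zero,
      ← Algebra.commutes, ← Algebra.smul_def]

end VacuumFunctional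

section Center

/-- An algebra is an algebra over its center. -/
@[reducible]
def centerAlgebra (k E : Type*) [CommRing k] [Ring E] [Algebra k E] :
    Algebra (Subalgebra.center k E) E where
  algebraMap := (Subalgebra.center k E).val.toRingHom
  commutes' r x := (Subalgebra.mem_center_iff.1 r.2 x).symm
  smul_def' _ _ := rfl

variable {N : ℕ} {d : Fin N → ℤ} {A : Fin N → Fin N → ℤ}

theorem mkAlgHom_coreRep : CoreRep d A (RingQuot.mkAlgHom Fq (QRel N d A)) :=
  CoreRep.of_surjective (RingQuot.mkAlgHom_surjective Fq _) fun _ _ h =>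
    RingQuot.mkAlgHom_rel Fq h.toQRel

/-- Linear functionals on the quantum affine algebra separating the elements `ψ_{i,p}` and
`φ_{i,-r}` of different degrees. -/
theorem exists_vacuum_functional (hd : ∀ i, 0 < d i) (hsym : ∀ i j, d i * A i j = d j * A j i)
    (hdiag : ∀ i, A i i = 2) (hoff : ∀ i j, i ≠ j → A i j ≤ 0) (κ : Fqˣ) (M : ℕ) :
    ∃ Ev : Uq N d A →ₗ[Fq] Uq N d A, ∀ i, ∀ n ∈ Nq d A,
      (∀ p : ℕ, Ev (n * psiU d A i p) = if p = M then (κ : Fq) • n else 0) ∧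
      ∀ r : ℕ, Ev (n * phiU d A i (-(r : ℤ))) = if r = M then ((κ⁻¹ : Fqˣ) : Fq) • n else 0 := by
  have hσ : CoreRep d A (RingQuot.mkAlgHom Fq (QRel N d A)) := mkAlgHom_coreRep
  let R := Subalgebra.center Fq (Uq N d A)
  let _ := centerAlgebra Fq (Uq N d A)
  have : IsScalarTower Fq R (Uq N d A) := ⟨fun a r x => smul_assoc a (r : Uq N d A) x⟩
  have hc : ∀ m : ℤ, ((hσ.gu ^ m : (Uq N d A)ˣ) : Uq N d A) ∈ R := fun m =>
    Subalgebra.mem_center_iff.2 fun z => (hσ.gu_comm m z).symm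
  let g : Rˣ := ⟨⟨_, hc 1⟩, ⟨_, hc (-1)⟩, Subtype.ext (by simp), Subtype.ext (by simp)⟩
  have hg : algebraMap R (Uq N d A) g = RingQuot.mkAlgHom Fq (QRel N d A) (e g2) :=
    congrArg Units.val (zpow_one hσ.gu)
  exact Fock.exists_vacuum_functional (R := R) (g := g) hd hsym hdiag hoff hσ hg
    (fun a b h => RingQuot.mkAlgHom_rel Fq h)
    (RingQuot.mkAlgHom_surjective Fq _) (fun _ h => h) κ M

end Center

section NormalOrdering

variable {k E : Type*} [Field k] [Ring E] [Algebra k E]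

/-- The span of the products `s_p n` with `p < m` and `n ∈ B`. -/
def lowerLeft (B : Subalgebra k E) (s : ℕ → E) (m : ℕ) : Submodule k E :=
  Submodule.span k {z | ∃ p < m, ∃ n ∈ B, z = s p * n}

/-- The span of the products `n s_p` with `p < m` and `n ∈ B`. -/
def lowerRight (B : Subalgebra k E) (s : ℕ → E) (m : ℕ) : Submodule k E :=
  Submodule.span k {z | ∃ p < m, ∃ n ∈ B, z = n * s p}

/-- Elements of `B` can be moved past `s_m`, up to conjugation by `u` and terms of lower degree. -/
structure NormalOrdered (B : Subalgebra k E) (s : ℕ → E) (u : Eˣ) : Prop where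
  conj : ∀ n ∈ B, u * n * ↑u⁻¹ ∈ B
  conj_inv : ∀ n ∈ B, ↑u⁻¹ * n * u ∈ B
  mul_sub_mem : ∀ n ∈ B, ∀ m, n * s m - s m * (↑u⁻¹ * n * u) ∈ lowerLeft B s m

variable {B : Subalgebra k E} {s t : ℕ → E} {u v : Eˣ}

theorem mul_mem_lowerLeft {m p : ℕ} (h : p < m) {n : E} (hn : n ∈ B) : s p * n ∈ lowerLeft B s m :=
  Submodule.subset_span ⟨p, h, n, hn, rfl⟩

theorem mul_mem_lowerRight {m p : ℕ} (h : p < m) {n : E} (hn : n ∈ B) :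
    n * s p ∈ lowerRight B s m :=
  Submodule.subset_span ⟨p, h, n, hn, rfl⟩

theorem lowerLeft_mono : Monotone (lowerLeft B s) := fun _ _ h =>
  Submodule.span_mono fun _ ⟨p, hp, hz⟩ => ⟨p, hp.trans_le h, hz⟩

theorem lowerRight_mono : Monotone (lowerRight B s) := fun _ _ h =>
  Submodule.span_mono fun _ ⟨p, hp, hz⟩ => ⟨p, hp.trans_le h, hz⟩

theorem lowerLeft_mul_mem {m : ℕ} {z n : E} (hz : z ∈ lowerLeft B s m) (hn : n ∈ B) :
    z * n ∈ lowerLeft B s m := by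
  induction hz using Submodule.span_induction with
  | mem z h =>
    obtain ⟨p, hp, n', hn', rfl⟩ := h
    rw [mul_assoc]
    exact mul_mem_lowerLeft hp (mul_mem hn' hn)
  | zero => simp
  | add x y _ _ hx hy => rw [add_mul]; exact add_mem hx hy
  | smul c x _ hx => rw [smul_mul_assoc]; exact Submodule.smul_mem _ _ hx

theorem mul_lowerLeft_mem_of_mul_sub_mem {n : E} (hn : ↑u⁻¹ * n * u ∈ B)
    (h : ∀ m, n * s m - s m * (↑u⁻¹ * n * u) ∈ lowerLeft B s m) {m : ℕ} {z : E}
    (hz : z ∈ lowerLeft B s m) : n * z ∈ lowerLeft B s m := by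
  induction hz using Submodule.span_induction with
  | mem z hz =>
    obtain ⟨p, hp, n', hn', rfl⟩ := hz
    rw [← mul_assoc, ← sub_add_cancel (n * s p) (s p * (↑u⁻¹ * n * u)), add_mul, mul_assoc (s p)]
    exact add_mem (lowerLeft_mul_mem (lowerLeft_mono hp.le (h p)) hn')
      (mul_mem_lowerLeft hp (mul_mem hn hn'))
  | zero => simp
  | add x y _ _ hx hy => rw [mul_add]; exact add_mem hx hy
  | smul c x _ hx => rw [mul_smul_comm]; exact Submodule.smul_mem _ _ hx

theorem conj_mem_adjoin {X : Set E} (h : ∀ x ∈ X, u * x * ↑u⁻¹ ∈ Algebra.adjoin k X) {n : E}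
    (hn : n ∈ Algebra.adjoin k X) : u * n * ↑u⁻¹ ∈ Algebra.adjoin k X := by
  induction hn using Algebra.adjoin_induction with
  | mem x hx => exact h x hx
  | algebraMap r => simp [← Algebra.commutes, mul_assoc]
  | add x y _ _ hx hy => rw [mul_add, add_mul]; exact add_mem hx hy
  | mul x y _ _ hx hy =>
    have : u * (x * y) * ↑u⁻¹ = u * x * ↑u⁻¹ * (u * y * ↑u⁻¹) := by simp [mul_assoc]
    rw [this]
    exact mul_mem hx hy

theorem NormalOrdered.of_adjoin {X : Set E} (s : ℕ → E)
    (h : ∀ x ∈ X, ∃ c : k, c ≠ 0 ∧ x * u = c • (u * x) ∧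
      ∀ m, x * s m - c • (s m * x) ∈ lowerLeft (Algebra.adjoin k X) s m) :
    NormalOrdered (Algebra.adjoin k X) s u := by
  have h1 : ∀ x ∈ X, u * x * ↑u⁻¹ ∈ Algebra.adjoin k X := fun x hx => by
    obtain ⟨c, hc, hcx, -⟩ := h x hx
    rw [(inv_smul_eq_iff₀ hc).2 hcx |>.symm, smul_mul_assoc, Units.mul_inv_cancel_right]
    exact Subalgebra.smul_mem _ (Algebra.subset_adjoin hx) _
  have h2' : ∀ x ∈ X, ∀ c : k, x * u = c • (u * x) → ↑u⁻¹ * x * u = c • x := fun x _ c hcx => by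
    rw [mul_assoc, hcx, mul_smul_comm, Units.inv_mul_cancel_left]
  have h2 : ∀ n ∈ Algebra.adjoin k X, ↑u⁻¹ * n * u ∈ Algebra.adjoin k X := fun n hn => by
    have := conj_mem_adjoin (u := u⁻¹) (X := X) (fun x hx => ?_) hn
    · rwa [inv_inv] at this
    · obtain ⟨c, -, hcx, -⟩ := h x hx
      rw [inv_inv, h2' x hx c hcx]
      exact Subalgebra.smul_mem _ (Algebra.subset_adjoin hx) _
  refine ⟨fun n hn => conj_mem_adjoin h1 hn, h2, fun n hn => ?_⟩
  induction hn using Algebra.adjoin_induction with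
  | mem x hx =>
    obtain ⟨c, -, hcx, hm⟩ := h x hx
    intro m
    rw [h2' x hx c hcx, mul_smul_comm]
    exact hm m
  | algebraMap r =>
    intro m
    rw [mul_assoc, Algebra.commutes r (u : E), Units.inv_mul_cancel_left, Algebra.commutes,
      sub_self]
    exact zero_mem _
  | add x y _ _ hx hy =>
    intro m
    have : (x + y) * s m - s m * (↑u⁻¹ * (x + y) * u) =
      (x * s m - s m * (↑u⁻¹ * x * u)) + (y * s m - s m * (↑u⁻¹ * y * u)) := by noncomm_ring
    rw [this]
    exact add_mem (hx m) (hy m)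
  | mul x y hx' hy' hx hy =>
    intro m
    have : x * y * s m - s m * (↑u⁻¹ * (x * y) * u) =
        x * (y * s m - s m * (↑u⁻¹ * y * u)) +
          (x * s m - s m * (↑u⁻¹ * x * u)) * (↑u⁻¹ * y * u) := by
      simp [mul_sub, sub_mul, mul_assoc]
    rw [this]
    exact add_mem (mul_lowerLeft_mem_of_mul_sub_mem (h2 x hx') hx (hy m))
      (lowerLeft_mul_mem (hx m) (h2 y hy'))

namespace NormalOrdered

theorem mul_lowerLeft_mem (h : NormalOrdered B s u) {n z : E} (hn : n ∈ B) {m : ℕ}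
    (hz : z ∈ lowerLeft B s m) : n * z ∈ lowerLeft B s m :=
  mul_lowerLeft_mem_of_mul_sub_mem (h.conj_inv n hn) (h.mul_sub_mem n hn) hz

theorem sub_mul_mem (h : NormalOrdered B s u) {n : E} (hn : n ∈ B) (m : ℕ) :
    s m * n - u * n * ↑u⁻¹ * s m ∈ lowerLeft B s m := by
  have := h.mul_sub_mem _ (h.conj n hn) m
  have h1 : ↑u⁻¹ * (u * n * ↑u⁻¹) * u = n := by simp [mul_assoc]
  rw [h1] at this
  rw [← neg_sub]
  exact neg_mem this

theorem lowerLeft_le_lowerRight (h : NormalOrdered B s u) (m : ℕ) :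
    lowerLeft B s m ≤ lowerRight B s m := by
  induction m using Nat.strong_induction_on with
  | _ m ih =>
  refine Submodule.span_le.2 ?_
  rintro _ ⟨p, hp, n, hn, rfl⟩
  rw [← sub_add_cancel (s p * n) (u * n * ↑u⁻¹ * s p)]
  exact add_mem (lowerRight_mono hp.le (ih p hp (h.sub_mul_mem hn p)))
    (mul_mem_lowerRight hp (h.conj n hn))

theorem map_mul_eq (h : NormalOrdered B s u) {M : ℕ} {Ev : E →ₗ[k] E} {a : k}
    (hE : ∀ n ∈ B, ∀ p, Ev (n * s p) = if p = M then a • n else 0) {n : E} (hn : n ∈ B) {p : ℕ}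
    (hp : p ≤ M) : Ev (s p * n) = if p = M then a • (u * n * ↑u⁻¹) else 0 := by
  have h0 : ∀ {p}, p ≤ M → lowerRight B s p ≤ LinearMap.ker Ev := fun hp =>
    Submodule.span_le.2 <| by
      rintro _ ⟨p', hp', n, hn, rfl⟩
      exact (hE n hn p').trans (if_neg (by omega))
  have h1 : Ev (s p * n - u * n * ↑u⁻¹ * s p) = 0 :=
    h0 hp (h.lowerLeft_le_lowerRight p (h.sub_mul_mem hn p))
  rw [← hE _ (h.conj n hn), ← sub_eq_zero, ← map_sub, h1]

theorem eq_zero_of_sum_eq_zero (hs : NormalOrdered B s u) (ht : NormalOrdered B t v)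
    {a b : Fin 2 → k} (hab : a 0 * b 1 ≠ a 1 * b 0)
    (hE : ∀ M j, ∃ Ev : E →ₗ[k] E, ∀ n ∈ B,
      (∀ p, Ev (n * s p) = if p = M then a j • n else 0) ∧
      ∀ p, Ev (n * t p) = if p = M then b j • n else 0)
    {Q R : ℕ → E} (hQ : ∀ p, Q p ∈ B) (hR : ∀ p, R p ∈ B) {m : ℕ}
    (h0 : ∑ p ∈ range m, (s p * Q p + t p * R p) = 0) : ∀ p < m, Q p = 0 ∧ R p = 0 := by
  induction m with
  | zero => simp
  | succ m ih =>
    have hj : ∀ j, a j • (u * Q m * ↑u⁻¹) + b j • (v * R m * ↑v⁻¹) = 0 := by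
      intro j
      obtain ⟨Ev, hEv⟩ := hE m j
      have h1 := congrArg Ev h0
      rw [map_zero, map_sum, sum_range_succ, sum_eq_zero, zero_add, map_add,
        hs.map_mul_eq (fun n hn => (hEv n hn).1) (hQ m) le_rfl,
        ht.map_mul_eq (fun n hn => (hEv n hn).2) (hR m) le_rfl, if_pos rfl, if_pos rfl] at h1
      · exact h1
      · intro p hp
        have hp' := mem_range.1 hp
        rw [map_add, hs.map_mul_eq (fun n hn => (hEv n hn).1) (hQ p) hp'.le,
          ht.map_mul_eq (fun n hn => (hEv n hn).2) (hR p) hp'.le, if_neg hp'.ne, if_neg hp'.ne,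
          add_zero]
    have hd : a 0 * b 1 - a 1 * b 0 ≠ 0 := sub_ne_zero.2 hab
    have hQm : Q m = 0 := by
      have h1 : (a 0 * b 1 - a 1 * b 0) • (u * Q m * ↑u⁻¹) = 0 := by
        linear_combination (norm := module) b 1 • hj 0 - b 0 • hj 1
      have h2 := (smul_eq_zero.1 h1).resolve_left hd
      simpa using h2
    have hRm : R m = 0 := by
      have h1 : (a 0 * b 1 - a 1 * b 0) • (v * R m * ↑v⁻¹) = 0 := by
        linear_combination (norm := module) a 0 • hj 1 - a 1 • hj 0
      have h2 := (smul_eq_zero.1 h1).resolve_left hd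
      simpa using h2
    rw [sum_range_succ, hQm, hRm, mul_zero, mul_zero, add_zero, add_zero] at h0
    intro p hp
    rcases Nat.lt_succ_iff_lt_or_eq.1 hp with hp | rfl
    · exact ih h0 p hp
    · exact ⟨hQm, hRm⟩

end NormalOrdered
end NormalOrdering

section NormalOrdering

variable {k E : Type*} [Field k] [Ring E] [Algebra k E] {B : Subalgebra k E}

theorem lowerLeft_le_of_central {s t : ℕ → E} {c : ℕ → E} (hc : ∀ p z, c p * z = z * c p)
    (hcB : ∀ p, c p ∈ B) (hs : ∀ p, s p = c p * t p) (m : ℕ) :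
    lowerLeft B s m ≤ lowerLeft B t m := by
  refine Submodule.span_le.2 ?_
  rintro _ ⟨p, hp, n, hn, rfl⟩
  rw [hs, hc, mul_assoc]
  exact mul_mem_lowerLeft hp (mul_mem (hcB p) hn)

theorem TwistRel.mul_coeff_sub_mem {θ : PowerSeries E} {x : ℤ → E} {R : k}
    (h : TwistRel θ x R) (hx : ∀ l, x l ∈ B) (l : ℤ) (n : ℕ) :
    x l * PowerSeries.coeff n θ - R⁻¹ • (PowerSeries.coeff n θ * x l) ∈
      lowerLeft B (fun p => PowerSeries.coeff p θ) n := by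
  have h1 := congrArg (PowerSeries.coeff n) (h l)
  set y := current x R l - R • (PowerSeries.X * current x R (l + 1))
  have hy : ∀ p, PowerSeries.coeff p y ∈ B := by
    intro p
    rw [map_sub, coeff_field_smul]
    refine sub_mem ?_ (B.smul_mem ?_ _)
    · rw [current, PowerSeries.coeff_mk]
      exact B.smul_mem (hx _) _
    · cases p with
      | zero => rw [PowerSeries.coeff_zero_X_mul]; exact zero_mem B
      | succ p =>
        rw [PowerSeries.coeff_succ_X_mul, current, PowerSeries.coeff_mk]
        exact B.smul_mem (hx _) _
  have hy0 : PowerSeries.coeff 0 y = R⁻¹ • x l := by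
    simp only [y, map_sub, coeff_field_smul, PowerSeries.coeff_zero_X_mul, current,
      PowerSeries.coeff_mk]
    simp
  rw [PowerSeries.coeff_C_mul, PowerSeries.coeff_mul, Nat.sum_antidiagonal_eq_sum_range_succ_mk,
    sum_range_succ, Nat.sub_self, hy0, mul_smul_comm] at h1
  rw [h1, add_sub_cancel_right]
  exact sum_mem fun p hp => mul_mem_lowerLeft (s := fun p => PowerSeries.coeff p θ)
    (mem_range.1 hp) (hy _)

theorem TwistRel.mul_sub_mem {θ : PowerSeries E} {x : ℤ → E} {R : k}
    (h : TwistRel θ x R) (hx : ∀ l, x l ∈ B) {s : ℕ → E} {c : ℕ → Eˣ}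
    (hc : ∀ p (z : E), c p * z = z * c p) (hcB : ∀ p, (c p : E) ∈ B) (hcB' : ∀ p, ↑(c p)⁻¹ ∈ B)
    (hs : ∀ p, s p = c p * PowerSeries.coeff p θ) (l : ℤ) (m : ℕ) :
    x l * s m - R⁻¹ • (s m * x l) ∈ lowerLeft B s m := by
  have hc' : ∀ p (z : E), ↑(c p)⁻¹ * z = z * ↑(c p)⁻¹ := fun p z =>
    ((show Commute (c p : E) z from hc p z).units_inv_left).eq
  have h1 := lowerLeft_mul_mem (h.mul_coeff_sub_mem hx l m) (hcB m)
  have h2 := lowerLeft_le_of_central (t := s) hc' hcB' (fun p => by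
    rw [hs, Units.inv_mul_cancel_left]) m h1
  rwa [← hc, mul_sub, ← mul_assoc, hc, mul_assoc, ← hs, mul_smul_comm, ← mul_assoc, ← hs] at h2

end NormalOrdering

section Drinfeld

variable {N : ℕ} {d : Fin N → ℤ} {A : Fin N → Fin N → ℤ}

theorem xm_mem_Nq (i : Fin N) (l : ℤ) : G d A (xm i l) ∈ Nq d A := (xmN d A i l).2

theorem G_g2_comm (z : Uq N d A) : G d A g2 * z = z * G d A g2 :=
  mkAlgHom_coreRep.central z

theorem G_g2inv_comm (z : Uq N d A) : G d A g2inv * z = z * G d A g2inv :=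
  (Commute.units_inv_left
    (show Commute ((mkAlgHom_coreRep (d := d) (A := A)).gu : Uq N d A) z from G_g2_comm z)).eq

theorem gU_mem_Nq (m : ℤ) : gU d A m ∈ Nq d A := by
  unfold gU gammaHalf
  split_ifs
  · rw [map_pow]; exact pow_mem (g2N d A).2 _
  · rw [map_pow]; exact pow_mem (g2invN d A).2 _

theorem gU_eq (m : ℤ) : gU d A m = ((mkAlgHom_coreRep (d := d) (A := A)).gu ^ m : (Uq N d A)ˣ) :=
  mkAlgHom_coreRep.map_gammaHalf m

theorem gU_comm (m : ℤ) (z : Uq N d A) : gU d A m * z = z * gU d A m := by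
  rw [gU_eq, CoreRep.gu_comm]

theorem gU_add (m n : ℤ) : gU d A (m + n) = gU d A m * gU d A n := by
  simp only [gU_eq, CoreRep.gu_add]

theorem gU_zero : gU d A 0 = 1 := by
  rw [gU_eq, zpow_zero, Units.val_one]

theorem gU_mul_neg (m : ℤ) : gU d A m * gU d A (-m) = 1 := by
  rw [← gU_add, add_neg_cancel, gU_zero]

theorem NormalOrdered.of_generators {s : ℕ → Uq N d A} {u : (Uq N d A)ˣ} (c : Fin N → Fq)
    (hc : ∀ j, c j ≠ 0) (hu : ∀ j l, G d A (xm j l) * u = c j • (u * G d A (xm j l)))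
    (hs : ∀ j l m, G d A (xm j l) * s m - c j • (s m * G d A (xm j l)) ∈ lowerLeft (Nq d A) s m) :
    NormalOrdered (Nq d A) s u := by
  refine NormalOrdered.of_adjoin s ?_
  rintro x ((rfl | rfl) | ⟨p, rfl⟩)
  · refine ⟨1, one_ne_zero, by rw [G_g2_comm, one_smul], fun m => ?_⟩
    rw [G_g2_comm, one_smul, sub_self]
    exact zero_mem _
  · refine ⟨1, one_ne_zero, by rw [G_g2inv_comm, one_smul], fun m => ?_⟩
    rw [G_g2inv_comm, one_smul, sub_self]
    exact zero_mem _
  · exact ⟨c p.1, hc _, hu _ _, hs _ _⟩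

theorem psiU_normalOrdered (hd : ∀ i, 0 < d i) (i : Fin N) :
    NormalOrdered (Nq d A) (fun p : ℕ => psiU d A i p) (mkAlgHom_coreRep.Ku i) := by
  have hσ : CoreRep d A (RingQuot.mkAlgHom Fq (QRel N d A)) := mkAlgHom_coreRep
  have hR : ∀ j, qp d A i j ^ sgn false ≠ 0 := fun j => zpow_ne_zero _ (qp_ne_zero d A i j)
  refine NormalOrdered.of_generators (fun j => (qp d A i j ^ sgn false)⁻¹)
    (fun j => inv_ne_zero (hR j)) (fun j l => hσ.x_mul_K false i j l) fun j l m => ?_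
  refine (hσ.cartanRel hd false i j).pos.mul_sub_mem (xm_mem_Nq j)
    (c := fun p => hσ.gu ^ (-sgn false * (p : ℤ))) (fun p => hσ.gu_comm _)
    (fun p => ?_) (fun p => ?_) (fun p => ?_) l m
  · rw [← hσ.map_gammaHalf]; exact gU_mem_Nq _
  · rw [← zpow_neg, ← hσ.map_gammaHalf]; exact gU_mem_Nq _
  · refine (hσ.map_psiEl false i p).trans ?_
    rw [coeffInt, if_pos (Int.natCast_nonneg p), Int.toNat_natCast]

theorem phiU_normalOrdered (hd : ∀ i, 0 < d i) (i : Fin N) :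
    NormalOrdered (Nq d A) (fun r : ℕ => phiU d A i (-(r : ℤ))) (mkAlgHom_coreRep.Ku i)⁻¹ := by
  have hσ : CoreRep d A (RingQuot.mkAlgHom Fq (QRel N d A)) := mkAlgHom_coreRep
  have hR : ∀ j, qp d A i j ^ sgn false ≠ 0 := fun j => zpow_ne_zero _ (qp_ne_zero d A i j)
  refine NormalOrdered.of_generators (fun j => qp d A i j ^ sgn false) hR
    (fun j l => hσ.x_mul_Kinv false i j l) fun j l m => ?_
  have := (hσ.cartanRel hd false i j).neg.mul_sub_mem (B := Nq d A)
    (fun l => xm_mem_Nq j (-l)) (s := fun r : ℕ => phiU d A i (-(r : ℤ)))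
    (c := fun p => hσ.gu ^ (sgn false * -(p : ℤ))) (fun p => hσ.gu_comm _)
    (fun p => ?_) (fun p => ?_) (fun p => ?_) (-l) m
  · rw [inv_inv, neg_neg] at this
    exact this
  · rw [← hσ.map_gammaHalf]; exact gU_mem_Nq _
  · rw [← zpow_neg, ← hσ.map_gammaHalf]; exact gU_mem_Nq _
  · refine (hσ.map_phiEl false i (-p)).trans ?_
    rw [coeffInt, neg_neg, if_pos (Int.natCast_nonneg p), Int.toNat_natCast]

end Drinfeld

section NormalOrdering

variable {k E : Type*} [Field k] [Ring E] [Algebra k E] {B : Subalgebra k E}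

theorem exists_finsupp_of_mem_lowerLeft {s t : ℕ → E} {c : ℕ → E} (hcB : ∀ p, c p ∈ B)
    (hs : ∀ p, s p = t p * c p) {m : ℕ} {z : E} (hz : z ∈ lowerLeft B s m) :
    ∃ Q : ℕ →₀ B, z = Q.sum fun p n => t p * (n : E) := by
  induction hz using Submodule.span_induction with
  | mem z hz =>
    obtain ⟨p, -, n, hn, rfl⟩ := hz
    refine ⟨Finsupp.single p ⟨c p * n, mul_mem (hcB p) hn⟩, ?_⟩
    rw [Finsupp.sum_single_index (by simp), ← mul_assoc, hs]
  | zero => exact ⟨0, by simp⟩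
  | add x y _ _ hx hy =>
    obtain ⟨Q, rfl⟩ := hx
    obtain ⟨R, rfl⟩ := hy
    exact ⟨Q + R, (Finsupp.sum_add_index' (by simp) (by simp [mul_add])).symm⟩
  | smul a x _ hx =>
    obtain ⟨Q, rfl⟩ := hx
    refine ⟨a • Q, ?_⟩
    rw [Finsupp.sum_smul_index' (by simp), Finsupp.smul_sum]
    simp

theorem sub_mul_mem_sup_of_adjoin {S : Submodule k E} {X : Set E} {x : E}
    (hl : ∀ n ∈ Algebra.adjoin k X, ∀ z ∈ S, n * z ∈ S)
    (hr : ∀ n ∈ Algebra.adjoin k X, ∀ z ∈ S, z * n ∈ S)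
    (h : ∀ y ∈ X, x * y - y * x ∈ S) {n : E} (hn : n ∈ Algebra.adjoin k X) :
    x * n - n * x ∈ S := by
  induction hn using Algebra.adjoin_induction with
  | mem y hy => exact h y hy
  | algebraMap r => rw [Algebra.commutes, sub_self]; exact zero_mem _
  | add y z _ _ hy hz =>
    rw [mul_add, add_mul, add_sub_add_comm]
    exact add_mem hy hz
  | mul y z hy' hz' hy hz =>
    have : x * (y * z) - y * z * x = (x * y - y * x) * z + y * (x * z - z * x) := by noncomm_ring
    rw [this]
    exact add_mem (hr _ hz' _ hy) (hl _ hy' _ hz)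

theorem existsUnique_finsupp_sum {f g : ℕ → E}
    (h0 : ∀ Q R : ℕ →₀ B, Q.sum (fun p n => f p * (n : E)) + R.sum (fun p n => g p * (n : E)) = 0 →
      Q = 0 ∧ R = 0) {a : k} (ha : a ≠ 0) {z : E}
    (hz : ∃ QR : (ℕ →₀ B) × (ℕ →₀ B), a • z =
      QR.1.sum (fun p n => f p * (n : E)) + QR.2.sum (fun p n => g p * (n : E))) :
    ∃! QR : (ℕ →₀ B) × (ℕ →₀ B), z = a⁻¹ •
      (QR.1.sum (fun p n => f p * (n : E)) + QR.2.sum (fun p n => g p * (n : E))) := by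
  obtain ⟨x, hx⟩ := hz
  refine ⟨x, by simp only [← hx, inv_smul_smul₀ ha], fun y hy => ?_⟩
  have h := h0 (y.1 - x.1) (y.2 - x.2) ?_
  · exact Prod.ext (sub_eq_zero.1 h.1) (sub_eq_zero.1 h.2)
  · have hsub : ∀ (f : ℕ → E) (Q R : ℕ →₀ B), (Q - R).sum (fun p n => f p * (n : E)) =
        Q.sum (fun p n => f p * (n : E)) - R.sum (fun p n => f p * (n : E)) := fun f Q R =>
      Finsupp.sum_sub_index fun p a b => by simp [mul_sub]
    rw [hsub, hsub, sub_add_sub_comm, ← hx, hy, smul_inv_smul₀ ha, sub_self]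

/-- The span of all products `s_p n` with `n ∈ B`. -/
def leftSpan (B : Subalgebra k E) (s : ℕ → E) : Submodule k E := ⨆ m, lowerLeft B s m

theorem mem_leftSpan {s : ℕ → E} {z : E} : z ∈ leftSpan B s ↔ ∃ m, z ∈ lowerLeft B s m :=
  Submodule.mem_iSup_of_directed _ lowerLeft_mono.directed_le

theorem leftSpan_mul_mem {s : ℕ → E} {z n : E} (hz : z ∈ leftSpan B s) (hn : n ∈ B) :
    z * n ∈ leftSpan B s := by
  obtain ⟨m, hm⟩ := mem_leftSpan.1 hz
  exact mem_leftSpan.2 ⟨m, lowerLeft_mul_mem hm hn⟩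

theorem NormalOrdered.mul_leftSpan_mem {s : ℕ → E} {u : Eˣ} (h : NormalOrdered B s u) {z n : E}
    (hn : n ∈ B) (hz : z ∈ leftSpan B s) : n * z ∈ leftSpan B s := by
  obtain ⟨m, hm⟩ := mem_leftSpan.1 hz
  exact mem_leftSpan.2 ⟨m, h.mul_lowerLeft_mem hn hm⟩

theorem NormalOrdered.commutator_mem {X : Set E} {s t : ℕ → E} {u v : Eˣ}
    (hs : NormalOrdered (Algebra.adjoin k X) s u) (ht : NormalOrdered (Algebra.adjoin k X) t v)
    {x : E} (h : ∀ y ∈ X, x * y - y * x ∈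
      leftSpan (Algebra.adjoin k X) s ⊔ leftSpan (Algebra.adjoin k X) t)
    {n : E} (hn : n ∈ Algebra.adjoin k X) :
    x * n - n * x ∈ leftSpan (Algebra.adjoin k X) s ⊔ leftSpan (Algebra.adjoin k X) t := by
  refine sub_mul_mem_sup_of_adjoin (fun n hn z hz => ?_) (fun n hn z hz => ?_) h hn
  all_goals obtain ⟨a, ha, b, hb, rfl⟩ := Submodule.mem_sup.1 hz
  · rw [mul_add]
    exact Submodule.add_mem_sup (hs.mul_leftSpan_mem hn ha) (ht.mul_leftSpan_mem hn hb)
  · rw [add_mul]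
    exact Submodule.add_mem_sup (leftSpan_mul_mem ha hn) (leftSpan_mul_mem hb hn)

end NormalOrdering

section Drinfeld

variable {N : ℕ} {d : Fin N → ℤ} {A : Fin N → Fin N → ℤ}

theorem psiU_of_neg (i : Fin N) {m : ℤ} (hm : m < 0) : psiU d A i m = 0 := by
  rw [psiU, psiEl, if_neg hm.not_ge, map_zero]

theorem phiU_of_pos (i : Fin N) {m : ℤ} (hm : 0 < m) : phiU d A i m = 0 := by
  rw [phiU, phiEl, if_neg hm.not_ge, map_zero]

theorem gU_mul_psiU_mem (i : Fin N) (l m : ℤ) :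
    gU d A l * psiU d A i m ∈ leftSpan (Nq d A) fun p : ℕ => psiU d A i p := by
  rcases lt_or_ge m 0 with hm | hm
  · rw [psiU_of_neg i hm, mul_zero]; exact zero_mem _
  · lift m to ℕ using hm
    rw [gU_comm]
    exact mem_leftSpan.2 ⟨m + 1, mul_mem_lowerLeft (s := fun p : ℕ => psiU d A i p)
      m.lt_succ_self (gU_mem_Nq l)⟩

theorem gU_mul_phiU_mem (i : Fin N) (l m : ℤ) :
    gU d A l * phiU d A i m ∈ leftSpan (Nq d A) fun r : ℕ => phiU d A i (-(r : ℤ)) := by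
  rcases lt_or_ge 0 m with hm | hm
  · rw [phiU_of_pos i hm, mul_zero]; exact zero_mem _
  · obtain ⟨n, rfl⟩ := Int.exists_eq_neg_ofNat hm
    rw [gU_comm]
    exact mem_leftSpan.2 ⟨n + 1, mul_mem_lowerLeft (s := fun r : ℕ => phiU d A i (-(r : ℤ)))
      n.lt_succ_self (gU_mem_Nq l)⟩

theorem xp_commutator_mem (hd : ∀ i, 0 < d i) (i : Fin N) (m : ℤ) {n : Uq N d A}
    (hn : n ∈ Nq d A) : G d A (xp i m) * n - n * G d A (xp i m) ∈
      leftSpan (Nq d A) (fun p : ℕ => psiU d A i p) ⊔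
        leftSpan (Nq d A) (fun r : ℕ => phiU d A i (-(r : ℤ))) := by
  refine (psiU_normalOrdered hd i).commutator_mem (phiU_normalOrdered hd i) ?_ hn
  rintro y ((rfl | rfl) | ⟨⟨j, l⟩, rfl⟩)
  · rw [G_g2_comm, sub_self]
    exact zero_mem _
  · rw [G_g2inv_comm, sub_self]
    exact zero_mem _
  · have h := RingQuot.mkAlgHom_rel Fq (QRel.xp_xm (d := d) (A := A) i j m l)
    rw [map_sub, map_mul, map_mul] at h
    refine Set.mem_of_eq_of_mem h ?_
    split_ifs
    · rw [map_smul, map_sub, map_mul, map_mul]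
      exact Submodule.smul_mem _ _ (sub_mem (Submodule.mem_sup_left (gU_mul_psiU_mem i _ _))
        (Submodule.mem_sup_right (gU_mul_phiU_mem i _ _)))
    · rw [map_zero]; exact zero_mem _

theorem exists_eq_psiU_sum_add_phiU_sum {i : Fin N} {z : Uq N d A}
    (hz : z ∈ leftSpan (Nq d A) (fun p : ℕ => psiU d A i p) ⊔
        leftSpan (Nq d A) (fun r : ℕ => phiU d A i (-(r : ℤ)))) :
    ∃ QR : (ℕ →₀ Nq d A) × (ℕ →₀ Nq d A),
      z = QR.1.sum (fun p Q => psiU d A i (p : ℤ) * gU d A (p : ℤ) * (Q : Uq N d A)) +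
        QR.2.sum (fun r R => phiU d A i (-(r : ℤ)) * gU d A (r : ℤ) * (R : Uq N d A)) := by
  have hg : ∀ (x : Uq N d A) (m : ℤ), x = x * gU d A m * gU d A (-m) := fun x m => by
    rw [mul_assoc, gU_mul_neg, mul_one]
  obtain ⟨a, ha, b, hb, rfl⟩ := Submodule.mem_sup.1 hz
  obtain ⟨m, ha⟩ := mem_leftSpan.1 ha
  obtain ⟨n, hb⟩ := mem_leftSpan.1 hb
  obtain ⟨Q, rfl⟩ := exists_finsupp_of_mem_lowerLeft
    (t := fun p : ℕ => psiU d A i (p : ℤ) * gU d A (p : ℤ)) (fun p => gU_mem_Nq (-(p : ℤ)))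
    (fun p => hg _ _) ha
  obtain ⟨R, rfl⟩ := exists_finsupp_of_mem_lowerLeft
    (t := fun r : ℕ => phiU d A i (-(r : ℤ)) * gU d A (r : ℤ)) (fun p => gU_mem_Nq (-(p : ℤ)))
    (fun p => hg _ _) hb
  exact ⟨(Q, R), rfl⟩

theorem eq_zero_of_psiU_sum_add_phiU_sum_eq_zero (hd : ∀ i, 0 < d i)
    (hsym : ∀ i j, d i * A i j = d j * A j i) (hdiag : ∀ i, A i i = 2)
    (hoff : ∀ i j, i ≠ j → A i j ≤ 0) (i : Fin N) {Q R : ℕ →₀ Nq d A}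
    (h : Q.sum (fun p Q => psiU d A i (p : ℤ) * gU d A (p : ℤ) * (Q : Uq N d A)) +
      R.sum (fun r R => phiU d A i (-(r : ℤ)) * gU d A (r : ℤ) * (R : Uq N d A)) = 0) :
    Q = 0 ∧ R = 0 := by
  obtain ⟨m, hm⟩ := (Q.support ∪ R.support).exists_nat_subset_range
  rw [Finsupp.sum_of_support_subset Q (subset_union_left.trans hm) _ (by simp),
    Finsupp.sum_of_support_subset R (subset_union_right.trans hm) _ (by simp),
    ← sum_add_distrib] at h
  simp only [mul_assoc] at h
  have hE : ∀ (M : ℕ) (j : Fin 2), ∃ Ev : Uq N d A →ₗ[Fq] Uq N d A, ∀ n ∈ Nq d A,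
      (∀ p : ℕ, Ev (n * psiU d A i p) = if p = M then (![1, 2] : Fin 2 → Fq) j • n else 0) ∧
      ∀ p : ℕ, Ev (n * phiU d A i (-(p : ℤ))) =
        if p = M then (![1, 2⁻¹] : Fin 2 → Fq) j • n else 0 := by
    intro M j
    let κ : Fin 2 → Fqˣ := ![1, Units.mk0 2 two_ne_zero]
    obtain ⟨Ev, hEv⟩ := exists_vacuum_functional hd hsym hdiag hoff (κ j) M
    have h1 : (![1, 2] : Fin 2 → Fq) j = κ j := by fin_cases j <;> simp [κ]
    have h2 : (![1, 2⁻¹] : Fin 2 → Fq) j = ((κ j)⁻¹ : Fqˣ) := by fin_cases j <;> simp [κ]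
    exact ⟨Ev, by rw [h1, h2]; exact hEv i⟩
  have hab : (![1, 2] : Fin 2 → Fq) 0 * (![1, 2⁻¹] : Fin 2 → Fq) 1 ≠
      (![1, 2] : Fin 2 → Fq) 1 * (![1, 2⁻¹] : Fin 2 → Fq) 0 := by norm_num
  have key := NormalOrdered.eq_zero_of_sum_eq_zero (psiU_normalOrdered hd i)
    (phiU_normalOrdered hd i) hab hE (Q := fun p => gU d A p * (Q p : Uq N d A))
    (R := fun p => gU d A p * (R p : Uq N d A)) (fun p => mul_mem (gU_mem_Nq _) (Q p).2)
    (fun p => mul_mem (gU_mem_Nq _) (R p).2) h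
  have hg : ∀ (p : ℤ) (x : Uq N d A), gU d A p * x = 0 → x = 0 := fun p x hx => by
    rw [← one_mul x, ← gU_mul_neg p, gU_comm, mul_assoc, hx, mul_zero]
  have hout : ∀ S : ℕ →₀ Nq d A, S.support ⊆ range m → (∀ p < m, (S p : Uq N d A) = 0) → S = 0 := by
    intro S hS h0
    ext p
    by_cases hp : p < m
    · rw [h0 p hp]; rfl
    · rw [Finsupp.notMem_support_iff.1 fun hp' => hp (mem_range.1 (hS hp'))]; rfl
  exact ⟨hout Q (subset_union_left.trans hm) fun p hp => hg _ _ (key p hp).1,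
    hout R (subset_union_right.trans hm) fun p hp => hg _ _ (key p hp).2⟩

theorem existsUnique_commutator (hd : ∀ i, 0 < d i)
    (hsym : ∀ i j, d i * A i j = d j * A j i) (hdiag : ∀ i, A i i = 2)
    (hoff : ∀ i j, i ≠ j → A i j ≤ 0) (i : Fin N) (m : ℤ) (P : Nq d A) :
    ∃! QR : (ℕ →₀ Nq d A) × (ℕ →₀ Nq d A),
      G d A (xp i m) * (P : Uq N d A) - (P : Uq N d A) * G d A (xp i m) =
        ((qi d i - (qi d i)⁻¹)⁻¹) •
          (QR.1.sum (fun p Q => psiU d A i (p : ℤ) * gU d A (p : ℤ) * (Q : Uq N d A)) +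
            QR.2.sum (fun r R => phiU d A i (-(r : ℤ)) * gU d A (r : ℤ) * (R : Uq N d A))) := by
  have h := xp_commutator_mem hd i m P.2
  exact existsUnique_finsupp_sum
    (fun _ _ => eq_zero_of_psiU_sum_add_phiU_sum_eq_zero hd hsym hdiag hoff i)
    (qi_notRoot hd i).sub_inv_ne_zero
    (exists_eq_psiU_sum_add_phiU_sum (Submodule.smul_mem _ _ h))

end Drinfeld

end

/-- For every `i`, `k ∈ ℤ` and `P ∈ N_q^-` there are unique finitely
supported families `(Q_p)_{p ≥ 0}` and `(R_r)_{r ≥ 0}` of elements of `N_q^-` such that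
`[x^+_{i,k}, P] = (q_i - q_i^{-1})^{-1}(∑_{p≥0} ψ_{i,p} γ^{p/2} Q_p +
∑_{r≥0} φ_{i,-r} γ^{r/2} R_r)` holds in `U_q`. -/
theorem commutator_lemma_exists_unique
    (hN : 0 < N)
    (hdpos : ∀ i, 0 < d i)
    (hgcd : Finset.univ.gcd (fun i => (d i).natAbs) = 1)
    (hdiag : ∀ i, A i i = 2)
    (hoff : ∀ i j, i ≠ j → A i j ≤ 0)
    (hsym : ∀ i j, d i * A i j = d j * A j i)
    (i : Fin N) (k : ℤ) (P : Nq d A) :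
    ∃! QR : (ℕ →₀ Nq d A) × (ℕ →₀ Nq d A),
      G d A (Gen.xp i k) * (P : Uq N d A) - (P : Uq N d A) * G d A (Gen.xp i k) =
        ((qi d i - (qi d i)⁻¹)⁻¹) •
          (QR.1.sum (fun p Q => psiU d A i (p : ℤ) * gU d A (p : ℤ) * (Q : Uq N d A)) +
           QR.2.sum (fun r R => phiU d A i (-(r : ℤ)) * gU d A (r : ℤ) * (R : Uq N d A))) := by
  exact existsUnique_commutator hdpos hsym hdiag hoff i k P

end
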